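/- Let n ∈ ℕ, 1 ≤ p ≤ n and 0 ≤ l ≤ n-2 < r ≤ 2n-3. The number of (n,l,r)-alternating sign pentagons P with ρ(P) = p is the constant term with respect to t of t^{1-p} · Σ_{1 ≤ e_1 < ... < e_{n-1} ≤ r+1} det_{1≤i,j≤n-1}( t·C(j-1, e_i - j) − t·C(j-1, r - e_i - l + 2n - 1 - j) + C(j-1, e_i - 1 - j) − C(j-1, r - e_i - l + 2n - j) ), where C(a,b) denotes the binomial coefficient (taken to be 0 when b < 0 or b > a). -/

import Mathlib

open Finset

/-- An alternating sign triangle of order `n`: a triangular array with rows `i = 1,…,n`,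
row `i` occupying columns `i,…,2n-i` (so the central column is column `n`).
Entries outside this region are `0`. -/
structure AST (n : ℕ) where
  entry : ℕ → ℕ → ℤ
  support : ∀ i j, entry i j ≠ 0 → 1 ≤ i ∧ i ≤ n ∧ i ≤ j ∧ j ≤ 2 * n - i
  entries : ∀ i j, entry i j = -1 ∨ entry i j = 0 ∨ entry i j = 1
  rowSum : ∀ i, 1 ≤ i → i ≤ n → ∑ j ∈ Icc i (2 * n - i), entry i j = 1
  altRow : ∀ i j₁ j₂, j₁ < j₂ → entry i j₁ ≠ 0 → entry i j₂ ≠ 0 →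
      (∀ j, j₁ < j → j < j₂ → entry i j = 0) → entry i j₁ * entry i j₂ = -1
  altCol : ∀ j i₁ i₂, i₁ < i₂ → entry i₁ j ≠ 0 → entry i₂ j ≠ 0 →
      (∀ i, i₁ < i → i < i₂ → entry i j = 0) → entry i₁ j * entry i₂ j = -1
  topOne : ∀ i j, entry i j ≠ 0 → (∀ i', i' < i → entry i' j = 0) → entry i j = 1

namespace AST

variable {n : ℕ} (T : AST n)

/-- The sum of the entries of column `j`. -/
def colSum (j : ℕ) : ℤ := ∑ i ∈ Icc 1 n, T.entry i j

/-- The bottom entry of column `j` (the entry of column `j` with the largest row index). -/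
def bottom (j : ℕ) : ℤ := T.entry (min j (2 * n - j)) j

/-- A `1`-column: a column summing to `1`. -/
def IsOneCol (j : ℕ) : Prop := T.colSum j = 1

/-- An `11`-column: a `1`-column with bottom entry `1`. -/
def IsElevenCol (j : ℕ) : Prop := T.colSum j = 1 ∧ T.bottom j = 1

/-- A `10`-column: a `1`-column with bottom entry `0`. -/
def IsTenCol (j : ℕ) : Prop := T.colSum j = 1 ∧ T.bottom j = 0

instance : DecidablePred T.IsOneCol := fun j =>
  inferInstanceAs (Decidable (T.colSum j = 1))
instance : DecidablePred T.IsElevenCol := fun j =>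
  inferInstanceAs (Decidable (T.colSum j = 1 ∧ T.bottom j = 1))
instance : DecidablePred T.IsTenCol := fun j =>
  inferInstanceAs (Decidable (T.colSum j = 1 ∧ T.bottom j = 0))

/-- The statistic `ρ`: `1` + (number of `11`-columns strictly left of the central column)
+ (number of `10`-columns strictly right of the central column). -/
def rho : ℕ :=
  1 + ((Icc 1 (n - 1)).filter T.IsElevenCol).card
    + ((Icc (n + 1) (2 * n - 1)).filter T.IsTenCol).card

end AST

/-- The label in `{0,…,2n-3}` of the non-central column with natural index
`j ∈ {1,…,2n-1} \ {n}` of an AST of order `n` (labels go left to right, skipping the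
central column). -/
def AST.label (n j : ℕ) : ℕ := if j < n then j - 1 else j - 2

namespace AST

variable {n : ℕ} (T : AST n)

/-- `T` is an `(n,l,r)`-alternating sign pentagon: every non-central `1`-column has its
label between `l` and `r`. -/
def IsASP (l r : ℕ) : Prop :=
  ∀ j, 1 ≤ j → j ≤ 2 * n - 1 → j ≠ n → T.IsOneCol j → l ≤ AST.label n j ∧ AST.label n j ≤ r

end AST

/-- Binomial coefficient `C(a, b)` with integer lower index, `0` for `b < 0`
(and `0` for `b > a`, as usual). -/
def intChoose (a : ℕ) (b : ℤ) : ℤ := if 0 ≤ b then (a.choose b.toNat : ℤ) else 0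

/-- The index set `{1 ≤ e_1 < e_2 < … < e_m ≤ r + 1}` as strictly increasing
`m`-tuples. -/
def incTuples (m r : ℕ) : Finset (Fin m → ℕ) :=
  (Fintype.piFinset fun _ => Finset.Icc 1 (r + 1)).filter
    fun e => ∀ i j : Fin m, i < j → e i < e j

/-- The `(n-1) × (n-1)` determinant (a polynomial in `t = X`)
`det( t·C(j-1, e_i - j) − t·C(j-1, r - e_i - l + 2n - 1 - j)
      + C(j-1, e_i - 1 - j) − C(j-1, r - e_i - l + 2n - j) )`,
where rows and columns are indexed by `i, j ∈ {1,…,n-1}` (here `0`-based, so the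
paper's `j` is `(j : ℕ) + 1` and the paper's `j - 1` is `(j : ℕ)`). -/
noncomputable def astDet (n l r : ℕ) (e : Fin (n - 1) → ℕ) : Polynomial ℤ :=
  Matrix.det fun i j : Fin (n - 1) =>
    Polynomial.C (intChoose (j : ℕ) ((e i : ℤ) - ((j : ℕ) + 1))
        - intChoose (j : ℕ) ((r : ℤ) - (e i : ℤ) - (l : ℤ) + 2 * (n : ℤ) - 1 - ((j : ℕ) + 1)))
      * Polynomial.X
    + Polynomial.C (intChoose (j : ℕ) ((e i : ℤ) - 1 - ((j : ℕ) + 1))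
        - intChoose (j : ℕ) ((r : ℤ) - (e i : ℤ) - (l : ℤ) + 2 * (n : ℤ) - ((j : ℕ) + 1)))

namespace ASPaux

section pairs
variable {R : Type*} [CommRing R]

/-- product over pairs i<j -/
def pairProd {m : ℕ} (f : Fin m → Fin m → R) : R := ∏ i, ∏ j, if i < j then f i j else 1

lemma pairProd_Ioi {m : ℕ} (f : Fin m → Fin m → R) :
    pairProd f = ∏ i, ∏ j ∈ Ioi i, f i j := by
  unfold pairProd
  refine prod_congr rfl fun i _ => ?_
  rw [← prod_filter]
  refine prod_congr ?_ fun _ _ => rfl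
  ext j; simp

lemma pairProd_mul {m : ℕ} (f g : Fin m → Fin m → R) :
    pairProd (fun i j => f i j * g i j) = pairProd f * pairProd g := by
  unfold pairProd
  simp_rw [← prod_mul_distrib]
  refine prod_congr rfl fun i _ => prod_congr rfl fun j _ => ?_
  split_ifs <;> simp

lemma map_pairProd {m : ℕ} {S : Type*} [CommRing S] (φ : R →+* S) (f : Fin m → Fin m → R) :
    φ (pairProd f) = pairProd (fun i j => φ (f i j)) := by
  unfold pairProd
  simp_rw [map_prod]
  refine prod_congr rfl fun i _ => prod_congr rfl fun j _ => ?_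
  split_ifs <;> simp

lemma pairProd_succAbove {m : ℕ} (f : Fin (m+1) → Fin (m+1) → R) (k : Fin (m+1)) :
    pairProd f = pairProd (fun i j => f (k.succAbove i) (k.succAbove j)) *
      ∏ j, (if k.succAbove j < k then f (k.succAbove j) k else f k (k.succAbove j)) := by
  unfold pairProd
  rw [Fin.prod_univ_succAbove _ k]
  simp_rw [Fin.prod_univ_succAbove _ k]
  rw [prod_mul_distrib]
  simp only [lt_self_iff_false, if_false, one_mul, Fin.succAbove_lt_succAbove_iff]
  rw [mul_left_comm, ← mul_assoc, mul_comm, mul_comm (∏ _, _) (∏ _, _), ← prod_mul_distrib, mul_comm]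
  rw [mul_comm]
  congr 1
  refine prod_congr rfl fun j _ => ?_
  have := Fin.succAbove_ne k j
  rcases lt_or_gt_of_ne this with h | h
  · simp [h, h.not_gt]
  · simp [h, h.not_gt]

lemma pairProd_swap {m : ℕ} (f : Fin m → Fin m → R) (a b : Fin m) (hab : a.val + 1 = b.val) :
    pairProd (fun i j => f (Equiv.swap a b i) (Equiv.swap a b j)) * f a b = pairProd f * f b a := by
  have key : ∀ c d : Fin m, f c d = ∏ i, ∏ j, if i = c ∧ j = d then f i j else 1 := by
    intro c d
    rw [Fintype.prod_eq_single c, Fintype.prod_eq_single d]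
    · simp
    · intro j hj; simp [hj]
    · intro i hi; simp [hi]
  have h1 : pairProd (fun i j => f (Equiv.swap a b i) (Equiv.swap a b j))
      = ∏ i, ∏ j, if Equiv.swap a b i < Equiv.swap a b j then f i j else 1 := by
    unfold pairProd
    rw [← Equiv.prod_comp (Equiv.swap a b)]
    refine prod_congr rfl fun i _ => ?_
    rw [← Equiv.prod_comp (Equiv.swap a b)]
    simp
  rw [h1, key a b, key b a]
  unfold pairProd
  simp_rw [← prod_mul_distrib]
  refine prod_congr rfl fun i _ => prod_congr rfl fun j _ => ?_
  have h2 : ∀ x : Fin m, ((Equiv.swap a b x : Fin m) : ℕ) = if x = a then (b:ℕ) else if x = b then (a:ℕ) else x := by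
    intro x; rw [Equiv.swap_apply_def]; split_ifs <;> rfl
  simp only [Fin.lt_def, h2, Fin.ext_iff]
  by_cases hia : (i:ℕ) = a <;> by_cases hib : (i:ℕ) = b <;> by_cases hja : (j:ℕ) = a <;>
    by_cases hjb : (j:ℕ) = b <;> simp only [hia, hib, hja, hjb, if_true, if_false, and_true, and_false, true_and, false_and]
  all_goals first | omega | skip
  all_goals (split_ifs <;> first | omega | simp)

end pairs

section theta
variable {K : Type*} [CommRing K]
open MvPolynomial

/-- constant exponent vector -/
noncomputable def cst (m k : ℕ) : Fin m →₀ ℕ := Finsupp.equivFunOnFinite.symm fun _ => k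

@[simp] lemma cst_apply (m k : ℕ) (i : Fin m) : cst m k i = k := rfl

noncomputable def cP (K : Type*) [CommRing K] (m : ℕ) : MvPolynomial (Fin m) K :=
  pairProd fun i j => 1 + X j + X i * X j
noncomputable def vP (K : Type*) [CommRing K] (m : ℕ) : MvPolynomial (Fin m) K :=
  pairProd fun i j => X i - X j

noncomputable def gP {m : ℕ} (g : Fin m → Polynomial K) : MvPolynomial (Fin m) K :=
  ∏ i, Polynomial.aeval (X i : MvPolynomial (Fin m) K) (g i)

noncomputable def Theta (s : ℕ) {m : ℕ} (g : Fin m → Polynomial K) : K :=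
  coeff (cst m (m - 1 + s)) (gP g * cP K m * vP K m)

lemma coeff_cst_X_pow_mul {m N : ℕ} (k : Fin (m+1)) (p : MvPolynomial (Fin (m+1)) K) :
    coeff (cst (m+1) N) (X k ^ N * p) =
    coeff (cst m N) (aeval (k.insertNth (0 : MvPolynomial (Fin m) K) X) p) := by
  induction p using MvPolynomial.induction_on' with
  | add p q hp hq => rw [mul_add, coeff_add, hp, hq, map_add, coeff_add]
  | monomial d a =>
    rw [aeval_monomial, X_pow_eq_monomial, monomial_mul, coeff_monomial, one_mul]
    rw [Finsupp.prod_fintype _ _ (by simp), Fin.prod_univ_succAbove _ k]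
    simp only [Fin.insertNth_apply_same, Fin.insertNth_apply_succAbove]
    by_cases hk : d k = 0
    · rw [hk, pow_zero, one_mul]
      have : (∏ i : Fin m, (X i : MvPolynomial (Fin m) K) ^ d (k.succAbove i)) =
          monomial (Finsupp.equivFunOnFinite.symm fun i => d (k.succAbove i)) 1 := by
        rw [monomial_eq, Finsupp.prod_fintype _ _ (by simp)]; simp
      rw [this, algebraMap_eq, C_mul_monomial, coeff_monomial, mul_one]
      congr 1
      rw [eq_iff_iff, Finsupp.ext_iff, Finsupp.ext_iff]
      rw [Fin.forall_iff_succAbove k]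
      simp [hk, Finsupp.single_apply, (Fin.succAbove_ne k _).symm]
    · rw [zero_pow hk, zero_mul, mul_zero, coeff_zero, if_neg]
      intro h
      have := DFunLike.congr_fun h k
      simp at this; exact hk this

lemma vP_expand (m : ℕ) : vP K (m+1) = ∑ k : Fin (m+1), (-1)^(k:ℕ) * X k ^ m *
    pairProd (fun i j => (X (k.succAbove i) - X (k.succAbove j) : MvPolynomial (Fin (m+1)) K)) := by
  have h : ∀ (r : ℕ) (x : Fin r → MvPolynomial (Fin (m+1)) K), pairProd (fun i j => x i - x j) =
      (Matrix.projVandermonde (1) x).det := by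
    intro r x
    rw [Matrix.det_projVandermonde, pairProd_Ioi]
    simp
  rw [vP, h, Matrix.det_succ_column_zero]
  refine sum_congr rfl fun k _ => ?_
  rw [h m (fun i => X (k.succAbove i))]
  congr 1
  · simp [Matrix.projVandermonde_apply]
  · congr 1
    ext i j
    simp [Matrix.projVandermonde_apply, Fin.rev_succ]

lemma Theta_expand (m : ℕ) (g : Fin (m+1) → Polynomial K) :
    Theta 0 g = ∑ k : Fin (m+1), (-1)^(k:ℕ) * (g k).coeff 0 *
      Theta 1 (fun j : Fin m => if k.succAbove j < k then g (k.succAbove j)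
        else (1 + Polynomial.X) * g (k.succAbove j)) := by
  rcases Nat.eq_zero_or_pos m with rfl | hm
  · simp only [Theta, gP, vP, cP, pairProd]
    simp
    have : cst 1 0 = 0 := by ext; rfl
    have h0 : ∀ k, cst 0 k = 0 := by intro k; exact Subsingleton.elim _ _
    rw [this, h0]
    simp [← constantCoeff_eq, Polynomial.aeval_def, Polynomial.hom_eval₂, Polynomial.coeff_zero_eq_eval_zero, Polynomial.eval₂_at_zero]
  unfold Theta
  rw [vP_expand, mul_sum, coeff_sum]
  refine sum_congr rfl fun k _ => ?_
  have e1 : m + 1 - 1 + 0 = m := by omega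
  have e2 : m - 1 + 1 = m := by omega
  rw [e1, e2]
  rw [show ∀ a b c d e : MvPolynomial (Fin (m+1)) K, a * b * (c * d * e) = c * (d * (a * b * e)) by intros; ring]
  rw [show ((-1 : MvPolynomial (Fin (m+1)) K)^(k:ℕ)) = C ((-1)^(k:ℕ)) by simp, coeff_C_mul, mul_assoc ((-1 : K)^(k:ℕ))]
  congr 1
  rw [coeff_cst_X_pow_mul]
  set φ := aeval (R := K) (k.insertNth (0 : MvPolynomial (Fin m) K) X) with hφ
  have hX : ∀ i, φ (X (k.succAbove i)) = X i := by intro i; simp [hφ]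
  have hXk : φ (X k) = 0 := by simp [hφ]
  have hv : φ (pairProd (fun i j => (X (k.succAbove i) - X (k.succAbove j)))) = vP K m := by
    have := map_pairProd φ.toRingHom (fun i j => (X (k.succAbove i) - X (k.succAbove j)))
    erw [this]
    unfold vP
    congr 1
    ext1 i; ext1 j
    show φ _ = _
    rw [map_sub, hX, hX]
  have hc : φ (cP K (m+1)) = cP K m * ∏ j : Fin m, if k.succAbove j < k then 1 else (1 + X j) := by
    unfold cP
    rw [pairProd_succAbove _ k, map_mul]
    congr 1
    · have := map_pairProd φ.toRingHom (fun i j => (1 + X (k.succAbove j) + X (k.succAbove i) * X (k.succAbove j)))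
      erw [this]
      congr 1
      ext1 i; ext1 j
      show φ _ = _
      simp only [map_add, map_mul, map_one, hX]
    · rw [map_prod]
      refine prod_congr rfl fun j _ => ?_
      split_ifs <;> simp [hX, hXk]
  have hg : φ (gP g) = C ((g k).coeff 0) * ∏ j : Fin m, Polynomial.aeval (X j : MvPolynomial (Fin m) K) (g (k.succAbove j)) := by
    unfold gP
    rw [Fin.prod_univ_succAbove _ k, map_mul, map_prod]
    congr 1
    · rw [← Polynomial.aeval_algHom_apply, hXk, Polynomial.aeval_def, Polynomial.eval₂_at_zero]; rfl
    · refine prod_congr rfl fun j _ => ?_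
      rw [← Polynomial.aeval_algHom_apply, hX]
  rw [map_mul, map_mul, hv, hc, hg]
  rw [show ∀ a b c d e : MvPolynomial (Fin m) K, a * b * (c * d) * e = a * ((b * d) * c * e) by intros; ring, coeff_C_mul]
  congr 1
  unfold gP
  rw [← prod_mul_distrib]
  congr 3
  refine prod_congr rfl fun j _ => ?_
  by_cases h : k.succAbove j < k
  · simp only [h, if_true, mul_one]
  · simp only [h, if_false, map_mul, map_add, map_one, Polynomial.aeval_X, mul_comm]

end theta
end ASPaux

namespace ASPaux
section thetaList
variable {K : Type*} [CommRing K]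
open MvPolynomial

noncomputable def Tl (s : ℕ) (L : List (Polynomial K)) : K :=
  Theta s (fun i : Fin L.length => L.getD i 0)

lemma Tl_eq (s : ℕ) {m : ℕ} (L : List (Polynomial K)) (h : L.length = m) (g : Fin m → Polynomial K)
    (hg : ∀ i : Fin m, L.getD i 0 = g i) : Tl s L = Theta s g := by
  subst h
  unfold Tl
  congr 1
  funext i
  exact hg i

lemma getD_mid {α : Type*} (d : α) (P Q : List α) (g h : α) (i : ℕ) :
    (P ++ g :: Q).getD i d = if i = P.length then g else (P ++ h :: Q).getD i d := by
  simp only [List.getD_eq_getElem?_getD]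
  rcases lt_trichotomy i P.length with hi | hi | hi
  · rw [List.getElem?_append_left hi, List.getElem?_append_left hi, if_neg hi.ne]
  · subst hi; simp
  · rw [List.getElem?_append_right hi.le, List.getElem?_append_right hi.le, if_neg hi.ne']
    obtain ⟨k, rfl⟩ : ∃ k, i = P.length + (k + 1) := ⟨i - P.length - 1, by omega⟩
    simp

lemma Tl_mid (s : ℕ) (P Q : List (Polynomial K)) (g : Polynomial K) :
    Tl s (P ++ g :: Q) = Theta s (Function.update
      (fun i : Fin (P.length + (Q.length + 1)) => (P ++ 0 :: Q).getD i 0) ⟨P.length, by omega⟩ g) := by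
  apply Tl_eq
  · simp
  · intro i
    rw [getD_mid 0 P Q g 0, Function.update_apply]
    simp [Fin.ext_iff]

lemma gP_update {m : ℕ} (F : Fin m → Polynomial K) (i : Fin m) (g : Polynomial K) :
    gP (Function.update F i g) = Polynomial.aeval (X i) g *
      ∏ j ∈ univ.erase i, Polynomial.aeval (X j : MvPolynomial (Fin m) K) (F j) := by
  unfold gP
  rw [← mul_prod_erase univ _ (mem_univ i), Function.update_self]
  congr 1
  refine prod_congr rfl fun j hj => ?_
  rw [Function.update_of_ne (ne_of_mem_erase hj)]

lemma Tl_add (s : ℕ) (P Q : List (Polynomial K)) (g h : Polynomial K) :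
    Tl s (P ++ (g + h) :: Q) = Tl s (P ++ g :: Q) + Tl s (P ++ h :: Q) := by
  simp only [Tl_mid, Theta, gP_update, map_add, add_mul, coeff_add]

lemma Tl_smul (s : ℕ) (P Q : List (Polynomial K)) (a : K) (g : Polynomial K) :
    Tl s (P ++ (Polynomial.C a * g) :: Q) = a * Tl s (P ++ g :: Q) := by
  simp only [Tl_mid, Theta, gP_update, map_mul, Polynomial.aeval_C, algebraMap_eq, mul_assoc, coeff_C_mul]

lemma Tl_neg (s : ℕ) (P Q : List (Polynomial K)) (g : Polynomial K) :
    Tl s (P ++ (-g) :: Q) = - Tl s (P ++ g :: Q) := by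
  have := Tl_smul s P Q (-1) g
  simpa using this

lemma Tl_sub (s : ℕ) (P Q : List (Polynomial K)) (g h : Polynomial K) :
    Tl s (P ++ (g - h) :: Q) = Tl s (P ++ g :: Q) - Tl s (P ++ h :: Q) := by
  rw [sub_eq_add_neg, Tl_add, Tl_neg, sub_eq_add_neg]

lemma prod_X_eq (m : ℕ) : (∏ i : Fin m, (X i : MvPolynomial (Fin m) K)) = monomial (cst m 1) 1 := by
  rw [monomial_eq, Finsupp.prod_fintype _ _ (by simp)]; simp

lemma Tl_X (s : ℕ) (L : List (Polynomial K)) :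
    Tl (s+1) (L.map (Polynomial.X * ·)) = Tl s L := by
  rw [Tl_eq (s+1) (m := L.length) (L.map (Polynomial.X * ·)) (by simp) (fun i => Polynomial.X * L.getD i 0)
    (by intro i; simp)]
  unfold Tl Theta gP
  simp only [map_mul, Polynomial.aeval_X, prod_mul_distrib, prod_X_eq, mul_assoc]
  have : cst L.length (L.length - 1 + (s+1)) = cst L.length 1 + cst L.length (L.length - 1 + s) := by
    ext i; simp; omega
  rw [this, coeff_monomial_mul, one_mul]

/-- signed expansion -/
noncomputable def Wl : List (Polynomial K) → List (Polynomial K) → K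
  | _, [] => 0
  | P, g :: gs => g.coeff 0 * Tl 1 (P ++ gs.map ((1 + Polynomial.X) * ·)) - Wl (P ++ [g]) gs

lemma Wl_eq (gs : List (Polynomial K)) : ∀ P, Wl P gs = ∑ k : Fin gs.length, (-1)^(k:ℕ) *
    (gs.getD k 0).coeff 0 * Tl 1 (P ++ (gs.take k ++ (gs.drop (k+1)).map ((1 + Polynomial.X) * ·))) := by
  induction gs with
  | nil => intro P; simp [Wl]
  | cons g gs ih =>
    intro P
    rw [Wl, ih]
    erw [Fin.sum_univ_succ]
    simp only [Fin.val_zero, pow_zero, one_mul, List.getD_cons_zero, List.take_zero, List.nil_append,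
      zero_add, List.drop_one, List.tail_cons, Fin.val_succ, List.getD_cons_succ, List.take_succ_cons,
      List.drop_succ_cons, sub_eq_add_neg, ← sum_neg_distrib]
    congr 1
    refine sum_congr rfl fun k _ => ?_
    rw [pow_succ]
    simp

lemma Tl_expand (gs : List (Polynomial K)) (h : gs ≠ []) : Tl 0 gs = Wl [] gs := by
  obtain ⟨m, hm⟩ : ∃ m, gs.length = m + 1 := ⟨gs.length - 1, by
    have := List.length_pos_iff.mpr h; omega⟩
  rw [Tl_eq 0 gs hm (fun i => gs.getD i 0) (fun _ => rfl), Theta_expand, Wl_eq]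
  refine Fintype.sum_equiv (finCongr hm.symm) _ _ fun k => ?_
  simp only [finCongr_apply, Fin.val_cast, List.nil_append]
  congr 1
  symm
  apply Tl_eq
  · simp; omega
  · intro i
    simp only [List.getD_eq_getElem?_getD]
    have hk := k.2
    have hi := i.2
    by_cases hik : (i:ℕ) < k
    · have : k.succAbove i < k := by rw [Fin.succAbove_lt_iff_castSucc_lt]; exact hik
      rw [if_pos this, List.getElem?_append_left (by simp; omega), List.getElem?_take_of_lt hik,
        Fin.succAbove_of_castSucc_lt _ _ hik]; rfl
    · have : ¬ k.succAbove i < k := by rw [Fin.succAbove_lt_iff_castSucc_lt]; exact hik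
      rw [if_neg this, List.getElem?_append_right (by simp; omega), List.length_take,
        Fin.succAbove_of_le_castSucc _ _ (not_lt.mp hik), List.getElem?_map, List.getElem?_drop]
      have : (k:ℕ) + 1 + (i - min (k:ℕ) gs.length) = i + 1 := by omega
      rw [this, Fin.val_succ, List.getElem?_eq_getElem (by omega)]
      simp

lemma coeff_rename_perm {m N : ℕ} (σ : Equiv.Perm (Fin m)) (p : MvPolynomial (Fin m) K) :
    coeff (cst m N) (rename σ p) = coeff (cst m N) p := by
  have : cst m N = Finsupp.mapDomain σ (cst m N) := by
    ext i
    rw [← Finsupp.equivMapDomain_eq_mapDomain]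
    simp [Finsupp.equivMapDomain_apply]
  conv_lhs => rw [this]
  exact coeff_rename_mapDomain _ σ.injective _ _

variable [IsDomain K] [CharZero K]

lemma rename_pairProd {m : ℕ} (σ : Equiv.Perm (Fin m)) (f : Fin m → Fin m → MvPolynomial (Fin m) K) :
    rename σ (pairProd f) = pairProd fun i j => rename σ (f i j) :=
  map_pairProd (rename (R := K) σ).toRingHom f

lemma vP_swap {m : ℕ} (a b : Fin m) (hab : a.val + 1 = b.val) :
    rename (Equiv.swap a b) (vP K m) = - vP K m := by
  have h := pairProd_swap (fun i j => (X i - X j : MvPolynomial (Fin m) K)) a b hab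
  have hne : (X a - X b : MvPolynomial (Fin m) K) ≠ 0 := by
    rw [sub_ne_zero]
    intro h
    have := X_injective h
    rw [this] at hab; omega
  apply mul_right_cancel₀ hne
  unfold vP
  rw [rename_pairProd]
  simp only [map_sub, rename_X]
  rw [h]; ring

lemma cP_swap {m : ℕ} (a b : Fin m) (hab : a.val + 1 = b.val) :
    rename (Equiv.swap a b) ((1 + X a + X b * X a) * cP K m) = (1 + X a + X b * X a) * cP K m := by
  have h := pairProd_swap (fun i j => (1 + X j + X i * X j : MvPolynomial (Fin m) K)) a b hab
  unfold cP
  rw [map_mul, rename_pairProd]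
  simp only [map_add, map_mul, map_one, rename_X, Equiv.swap_apply_left, Equiv.swap_apply_right]
  rw [mul_comm, h, mul_comm]

lemma Tl_adj (s : ℕ) (P Q : List (Polynomial K)) (G : Polynomial K) :
    Tl s (P ++ ((1 + Polynomial.X) * G) :: ((1 + Polynomial.X) * G) :: Q)
    - Tl s (P ++ G :: ((1 + Polynomial.X) * G) :: Q) + Tl s (P ++ G :: G :: Q) = 0 := by
  set m := P.length + (Q.length + 2)
  let a : Fin m := ⟨P.length, by omega⟩
  let b : Fin m := ⟨P.length + 1, by omega⟩
  have hab : a.val + 1 = b.val := rfl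
  have hne : a ≠ b := by intro h; rw [h] at hab; omega
  let F : Fin m → Polynomial K := fun i => (P ++ G :: G :: Q).getD i 0
  have key : ∀ g h : Polynomial K, Tl s (P ++ g :: h :: Q) = coeff (cst m (m - 1 + s))
      (Polynomial.aeval (X a) g * (Polynomial.aeval (X b) h * (∏ j ∈ (univ.erase a).erase b,
        Polynomial.aeval (X j : MvPolynomial (Fin m) K) (F j)) * cP K m * vP K m)) := by
    intro g h
    rw [Tl_eq s (m := m) (P ++ g :: h :: Q) (by simp [m]) (Function.update (Function.update F b h) a g)]
    · rw [Theta, gP_update, ← mul_prod_erase _ _ (mem_erase.mpr ⟨hne.symm, mem_univ b⟩), Function.update_self]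
      rw [prod_congr rfl (g := fun j => Polynomial.aeval (X j : MvPolynomial (Fin m) K) (F j))]
      · simp only [mul_assoc]
      · intro j hj
        rw [Function.update_of_ne (ne_of_mem_erase hj)]
    · intro i
      rw [getD_mid 0 P (h :: Q) g G, Function.update_apply]
      simp only [Fin.ext_iff, a]
      split_ifs with h1
      · rfl
      · rw [show P ++ G :: h :: Q = (P ++ [G]) ++ h :: Q by simp, getD_mid 0 _ Q h G, Function.update_apply]
        simp [Fin.ext_iff, b, F]
  rw [key, key, key, ← coeff_sub, ← coeff_add]
  set R := ∏ j ∈ (univ.erase a).erase b, Polynomial.aeval (X j : MvPolynomial (Fin m) K) (F j)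
  have hR : rename (Equiv.swap a b) R = R := by
    simp only [R]
    rw [map_prod]
    refine prod_congr rfl fun j hj => ?_
    rw [← Polynomial.aeval_algHom_apply, rename_X, Equiv.swap_apply_of_ne_of_ne]
    · exact ne_of_mem_erase (mem_of_mem_erase hj)
    · exact ne_of_mem_erase hj
  set E := Polynomial.aeval (X a : MvPolynomial (Fin m) K) G * Polynomial.aeval (X b : MvPolynomial (Fin m) K) G
    * R * ((1 + X a + X b * X a) * cP K m) * vP K m with hE
  have h1 : coeff (cst m (m - 1 + s)) E = 0 := by
    have h2 : rename (Equiv.swap a b) E = - E := by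
      rw [hE, map_mul, map_mul, cP_swap a b hab, vP_swap a b hab, map_mul, map_mul, hR,
        ← Polynomial.aeval_algHom_apply, ← Polynomial.aeval_algHom_apply, rename_X, rename_X,
        Equiv.swap_apply_left, Equiv.swap_apply_right]
      ring
    have h3 := coeff_rename_perm (N := m - 1 + s) (Equiv.swap a b) E
    rw [h2, coeff_neg] at h3
    exact self_eq_neg.mp h3.symm
  rw [← h1]
  congr 1
  rw [hE]
  simp only [map_mul, map_add, map_one, Polynomial.aeval_X]
  ring

end thetaList
end ASPaux

namespace ASPaux
section tele
variable {K : Type*} [CommRing K]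

/-- sum over lists interlacing with `a :: xs` -/
def Qs : ℕ → List ℕ → (List ℕ → K) → K
  | _, [], f => f []
  | a, x :: xs, f => (∑ y ∈ Ico a x, Qs x xs (fun ys => f (y :: ys))) +
      Qs (x+1) xs (fun ys => f (x :: ys))

def SI : List ℕ → (List ℕ → K) → K
  | [], _ => 0
  | x :: xs, f => Qs x xs f

def DD : (List ℕ → K) → List ℕ → K
  | H, [] => H []
  | H, y :: ys => DD (fun zs => H ((y+1) :: zs)) ys - DD (fun zs => H (y :: zs)) ys

def TT : List ℕ → (List ℕ → K) → K
  | [], _ => 0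
  | x :: xs, H => H (xs.map (· + 1)) - TT xs (fun ys => H (x :: ys))

lemma Qs_lin (c d : K) (xs : List ℕ) : ∀ (a : ℕ) (f g : List ℕ → K),
    Qs a xs (fun ys => c * f ys + d * g ys) = c * Qs a xs f + d * Qs a xs g := by
  induction xs with
  | nil => intro a f g; simp [Qs]
  | cons x xs ih =>
    intro a f g
    simp only [Qs, ih, sum_add_distrib, ← mul_sum]
    ring

lemma SI_lin (c d : K) (xs : List ℕ) (f g : List ℕ → K) :
    SI xs (fun ys => c * f ys + d * g ys) = c * SI xs f + d * SI xs g := by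
  cases xs with
  | nil => simp [SI]
  | cons x xs => exact Qs_lin c d xs x f g

lemma Qs_sub (xs : List ℕ) (a : ℕ) (f g : List ℕ → K) :
    Qs a xs (fun ys => f ys - g ys) = Qs a xs f - Qs a xs g := by
  have := Qs_lin 1 (-1) xs a f g
  simpa [sub_eq_add_neg] using this

lemma TT_lin (c d : K) (xs : List ℕ) : ∀ (f g : List ℕ → K),
    TT xs (fun ys => c * f ys + d * g ys) = c * TT xs f + d * TT xs g := by
  induction xs with
  | nil => intro f g; simp [TT]
  | cons x xs ih =>
    intro f g
    simp only [TT, ih]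
    ring

lemma TT_zero (xs : List ℕ) (f : List ℕ → K) (h : ∀ ys, f ys = 0) : TT xs f = 0 := by
  have : f = fun ys => 0 * f ys + 0 * f ys := by funext ys; simp [h]
  rw [this, TT_lin]; simp

/-- adjacency condition -/
def Adj (H : List ℕ → K) : Prop := ∀ (P Q : List ℕ) (x : ℕ),
  H (P ++ (x+1) :: (x+1) :: Q) - H (P ++ x :: (x+1) :: Q) + H (P ++ x :: x :: Q) = 0

lemma Adj.cons {H : List ℕ → K} (h : Adj H) (y : ℕ) : Adj (fun zs => H (y :: zs)) := by
  intro P Q x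
  exact h (y :: P) Q x

lemma Qs_DD (xs : List ℕ) : ∀ (a : ℕ) (H : List ℕ → K), Adj H → (∀ x ∈ xs, a ≤ x) → xs.Pairwise (· < ·) →
    Qs a xs (DD H) = TT (a :: xs) H := by
  induction xs with
  | nil => intro a H _ _ _; simp [Qs, DD, TT]
  | cons x xs ih =>
    intro a H hH ha hs
    have hax : a ≤ x := ha x (by simp)
    rw [List.pairwise_cons] at hs
    have h1 : ∀ y, Qs x xs (DD fun zs => H (y :: zs)) = TT (x :: xs) (fun zs => H (y :: zs)) := fun y =>
      ih x _ (hH.cons y) (fun z hz => (hs.1 z hz).le) hs.2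
    have h2 : ∀ y, Qs (x+1) xs (DD fun zs => H (y :: zs)) = TT ((x+1) :: xs) (fun zs => H (y :: zs)) := fun y =>
      ih (x+1) _ (hH.cons y) (fun z hz => (hs.1 z hz)) hs.2
    rw [Qs]
    simp only [DD, Qs_sub, h1, h2]
    rw [Finset.sum_Ico_sub (fun y => TT (x :: xs) (fun zs => H (y :: zs))) hax]
    have h3 := TT_zero xs (fun zs => H ((x+1) :: (x+1) :: zs) - H (x :: (x+1) :: zs) + H (x :: x :: zs))
      (fun ys => hH [] ys x)
    have h4 : TT xs (fun zs => H ((x+1) :: (x+1) :: zs) - H (x :: (x+1) :: zs) + H (x :: x :: zs)) =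
        TT xs (fun zs => H ((x+1) :: (x+1) :: zs)) - TT xs (fun zs => H (x :: (x+1) :: zs)) +
        TT xs (fun zs => H (x :: x :: zs)) := by
      have e1 := TT_lin 1 (-1) xs (fun zs => H ((x+1) :: (x+1) :: zs)) (fun zs => H (x :: (x+1) :: zs))
      have e2 := TT_lin 1 1 xs (fun zs => H ((x+1) :: (x+1) :: zs) - H (x :: (x+1) :: zs)) (fun zs => H (x :: x :: zs))
      simp only [one_mul, neg_mul, ← sub_eq_add_neg] at e1 e2
      rw [e2, e1]
    rw [h4] at h3
    simp only [TT, List.map_cons]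
    linear_combination -h3

lemma Qs_head (i : ℕ) (xs : List ℕ) (hi : ∀ x ∈ xs, i < x) (g : List ℕ → K) (hg : ∀ ys, i ∉ ys → g ys = 0) :
    Qs i xs g = SI xs (fun ys => g (i :: ys)) := by
  have aux : ∀ (xs : List ℕ) (a : ℕ) (g : List ℕ → K), i < a → (∀ x ∈ xs, i < x) → (∀ ys, i ∉ ys → g ys = 0) →
      Qs a xs g = 0 := by
    intro xs
    induction xs with
    | nil => intro a g _ _ h; simp [Qs, h]
    | cons x xs ih =>
      intro a g ha hx hg
      rw [Qs, ih (x+1) _ _ (fun z hz => hx z (by simp [hz])), sum_eq_zero, add_zero]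
      · intro y hy
        rw [mem_Ico] at hy
        apply ih x _ (hx x (by simp)) (fun z hz => hx z (by simp [hz]))
        intro ys hys
        apply hg
        simp only [List.mem_cons, not_or]; exact ⟨by omega, hys⟩
      · intro ys hys
        apply hg
        have := hx x (by simp)
        simp only [List.mem_cons, not_or]; exact ⟨by omega, hys⟩
      · have := hx x (by simp); omega
  cases xs with
  | nil => simp [Qs, SI, hg]
  | cons x xs =>
    have hx := hi x (by simp)
    have hxs : ∀ z ∈ xs, i < z := fun z hz => hi z (by simp [hz])
    rw [Qs, SI, aux xs (x+1) _ (by omega) hxs, add_zero, Finset.sum_eq_sum_Ico_succ_bot hx, sum_eq_zero, add_zero]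
    · intro y hy
      rw [mem_Ico] at hy
      apply aux xs x _ hx hxs
      intro ys hys
      apply hg
      simp only [List.mem_cons, not_or]; exact ⟨by omega, hys⟩
    · intro ys hys
      apply hg
      simp only [List.mem_cons, not_or]; exact ⟨by omega, hys⟩

lemma Qs_last (c : ℕ) (xs : List ℕ) : ∀ (a : ℕ) (g : List ℕ → K), (∀ x ∈ xs, x < c) → a ≤ c →
    (∀ ys, c ∉ ys → g ys = 0) → Qs a (xs ++ [c]) g = Qs a xs (fun ys => g (ys ++ [c])) := by
  induction xs with
  | nil =>
    intro a g _ ha hg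
    simp only [List.nil_append, Qs]
    rw [sum_eq_zero, zero_add]
    intro y hy
    rw [mem_Ico] at hy
    apply hg
    simp; omega
  | cons x xs ih =>
    intro a g hx ha hg
    have hxc := hx x (by simp)
    have hxs : ∀ z ∈ xs, z < c := fun z hz => hx z (by simp [hz])
    have hh : ∀ y < c, ∀ ys, c ∉ ys → g (y :: ys) = 0 := by
      intro y hy ys hys
      apply hg
      simp only [List.mem_cons, not_or]; exact ⟨by omega, hys⟩
    simp only [List.cons_append, Qs]
    rw [ih (x+1) _ hxs (by omega) (hh x hxc)]
    congr 1
    refine sum_congr rfl fun y hy => ?_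
    rw [mem_Ico] at hy
    exact ih x _ hxs (by omega) (hh y (by omega))

lemma SI_last (c : ℕ) (xs : List ℕ) (g : List ℕ → K) (hx : ∀ x ∈ xs, x < c)
    (hg : ∀ ys, c ∉ ys → g ys = 0) : SI (xs ++ [c]) g = SI xs (fun ys => g (ys ++ [c])) := by
  cases xs with
  | nil => simp [SI, Qs, hg]
  | cons x xs => exact Qs_last c xs x g (fun z hz => hx z (by simp [hz])) (hx x (by simp)).le hg

end tele

section GLsec
variable {K : Type*} [CommRing K] 

/-- powers of 1+X -/
noncomputable def uu (K : Type*) [CommRing K] (c : ℕ) : Polynomial K := (1 + Polynomial.X) ^ c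

lemma uu_succ (c : ℕ) : uu K (c+1) = (1 + Polynomial.X) * uu K c := by rw [uu, uu, pow_succ']

lemma uu_coeff (c : ℕ) : (uu K c).coeff 0 = 1 := by
  simp [uu, Polynomial.coeff_zero_eq_eval_zero]

lemma DD_Tl (ys : List ℕ) : ∀ (P R : List (Polynomial K)),
    DD (fun zs => Tl 1 (P ++ (zs.map (uu K) ++ R))) ys = Tl 1 (P ++ (ys.map (fun y => Polynomial.X * uu K y) ++ R)) := by
  induction ys with
  | nil => intro P R; simp [DD]
  | cons y ys ih =>
    intro P R
    have h := fun z => ih (P ++ [uu K z]) R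
    simp only [List.append_assoc, List.singleton_append] at h
    simp only [DD, List.map_cons, List.cons_append, h]
    rw [← Tl_sub]
    congr 3
    rw [uu_succ]; ring

lemma Wl_zero_left (Ls gs : List (Polynomial K)) (h : ∀ g ∈ Ls, g.coeff 0 = 0) : ∀ P,
    Wl P (Ls ++ gs) = (-1)^Ls.length * Wl (P ++ Ls) gs := by
  induction Ls with
  | nil => intro P; simp
  | cons g Ls ih =>
    intro P
    rw [List.cons_append, Wl, ih (fun g hg => h g (by simp [hg])), h g (by simp)]
    simp [pow_succ]

lemma Wl_nil (Ls : List (Polynomial K)) (h : ∀ g ∈ Ls, g.coeff 0 = 0) (P) : Wl P Ls = 0 := by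
  have := Wl_zero_left Ls [] h P
  simpa [Wl] using this

lemma Wl_TT (R : List (Polynomial K)) (hR : ∀ g ∈ R, g.coeff 0 = 0) (A : List ℕ) : ∀ P,
    Wl P (A.map (uu K) ++ R) =
      TT A (fun ys => Tl 1 (P ++ (ys.map (uu K) ++ R.map ((1 + Polynomial.X) * ·)))) := by
  induction A with
  | nil => intro P; simp [TT, Wl_nil R hR]
  | cons x xs ih =>
    intro P
    simp only [List.map_cons, List.cons_append, Wl, TT, ih, uu_coeff, one_mul]
    simp [uu_succ, Function.comp_def]

lemma Tl_negX (s : ℕ) (Ls : List (Polynomial K)) : ∀ (P R : List (Polynomial K)), 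
   Tl s (P ++ (Ls.map (fun g => -Polynomial.X * g) ++ R)) =
     (-1)^Ls.length * Tl s (P ++ (Ls.map (fun g => Polynomial.X * g) ++ R)) := by
  induction Ls with
  | nil => intro P R; simp
  | cons g Ls ih =>
    intro P R
    have := ih (P ++ [-Polynomial.X * g]) R
    simp only [List.map_cons, List.cons_append, List.length_cons, List.append_assoc, List.nil_append] at this ⊢
    rw [this, neg_mul, Tl_neg, pow_succ]; ring

variable [IsDomain K] [CharZero K]

theorem gl_main (Lp Rq : List (Polynomial K)) (A : List ℕ) (hA : A.Pairwise (· < ·)) (hne : Lp ≠ [] ∨ A ≠ [] ∨ Rq ≠ []) :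
    SI A (fun ys => Tl 0 (Lp ++ (ys.map (uu K) ++ Rq.map ((1 + Polynomial.X) * ·)))) =
    Tl 0 (Lp.map (fun g => -Polynomial.X * g) ++ (A.map (uu K) ++ Rq.map (Polynomial.X * ·))) := by
  rw [Tl_expand]
  swap
  · simpa [imp_iff_not_or] using hne
  rw [Wl_zero_left _ _ (by simp), Wl_TT _ (by simp)]
  simp only [List.nil_append, List.length_map]
  have h1 := fun ys : List ℕ => Tl_negX 1 Lp [] (ys.map (uu K) ++ (Rq.map (Polynomial.X * ·)).map ((1 + Polynomial.X) * ·))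
  simp only [List.nil_append] at h1
  simp only [h1]
  have h2 := TT_lin ((-1)^Lp.length) 0 A (fun ys => Tl 1 (Lp.map (fun g => Polynomial.X * g) ++ (ys.map (uu K) ++ (Rq.map (Polynomial.X * ·)).map ((1 + Polynomial.X) * ·)))) (fun _ => 0)
  simp only [mul_zero, add_zero, zero_mul] at h2
  rw [h2, ← mul_assoc, ← mul_pow, neg_one_mul, neg_neg, one_pow, one_mul]
  cases A with
  | nil => simp [SI, TT]
  | cons x xs =>
    rw [List.pairwise_cons] at hA
    rw [SI, ← Qs_DD xs x _ _ (fun z hz => (hA.1 z hz).le) hA.2]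
    · congr 1
      funext ys
      rw [DD_Tl, ← Tl_X]
      simp only [List.map_append, List.map_map]
      congr 4
      funext g
      simp; ring
    · intro P Q x
      have := Tl_adj 1 (Lp.map (fun g => Polynomial.X * g) ++ P.map (uu K)) (Q.map (uu K) ++ (Rq.map (Polynomial.X * ·)).map ((1 + Polynomial.X) * ·)) (uu K x)
      simpa [uu_succ] using this


open Classical in
lemma gl_right (t : K) (Lp Rq : List (Polynomial K)) (A : List ℕ) (c : ℕ) (hc : 1 ≤ c) (hA : (A ++ [c]).Pairwise (· < ·)) :
    SI (A ++ [c]) (fun ys : List ℕ => (if c ∈ ys then t else 1) * Tl 0 (Lp ++ (ys.map (uu K) ++ Rq.map ((1 + Polynomial.X) * ·)))) =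
    Tl 0 (Lp.map (fun g => -Polynomial.X * g) ++ (A.map (uu K) ++
      (uu K (c-1) * (1 + Polynomial.C t * Polynomial.X)) :: Rq.map (Polynomial.X * ·))) := by
  have h1 : (fun ys : List ℕ => (if c ∈ ys then t else 1) * Tl 0 (Lp ++ (ys.map (uu K) ++ Rq.map ((1 + Polynomial.X) * ·)))) =
    fun ys : List ℕ => 1 * Tl 0 (Lp ++ (ys.map (uu K) ++ Rq.map ((1 + Polynomial.X) * ·))) +
      (t-1) * ((if c ∈ ys then 1 else 0) * Tl 0 (Lp ++ (ys.map (uu K) ++ Rq.map ((1 + Polynomial.X) * ·)))) := by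
    funext ys
    split_ifs <;> ring
  rw [h1, SI_lin, gl_main _ _ _ hA (by simp)]
  rw [List.pairwise_append] at hA
  rw [SI_last c A _ (fun x hx => hA.2.2 x hx c (by simp)) (by intro ys hys; simp [hys])]
  have h2 := gl_main Lp (uu K (c-1) :: Rq) A hA.1 (by simp)
  have h3 : (1 + Polynomial.X) * uu K (c-1) = uu K c := by
    rw [← uu_succ]; congr 1; omega
  simp only [List.map_cons, h3] at h2
  simp only [List.mem_append, List.mem_singleton, or_true, if_true, one_mul, List.map_append, List.map_cons, List.map_nil,
    List.append_assoc, List.singleton_append, List.cons_append, List.nil_append] at h2 ⊢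
  rw [h2]
  simp only [← List.append_assoc]
  rw [← Tl_smul, ← Tl_add]
  congr 3
  rw [← h3, map_sub, map_one]; ring

open Classical in
/-- general: right factor either trivial or `c`, left factor either trivial or `i`. -/
lemma gl_left (t : K) (Lp E : List (Polynomial K)) (xs : List ℕ) (i : ℕ) (hx : ∀ x ∈ xs, i < x)
    (F : List (Polynomial K) → List ℕ → K) (hF : ∀ ys, F Lp (i :: ys) = F (Lp ++ [uu K i]) ys)
    (h1 : SI (i :: xs) (F Lp) = Tl 0 (Lp.map (fun g => -Polynomial.X * g) ++ uu K i :: E))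
    (h2 : SI xs (F (Lp ++ [uu K i])) = Tl 0 ((Lp ++ [uu K i]).map (fun g => -Polynomial.X * g) ++ E)) :
    SI (i :: xs) (fun ys => (if i ∈ ys then 1 else t) * F Lp ys) =
    Tl 0 (Lp.map (fun g => -Polynomial.X * g) ++
      (uu K i * (Polynomial.C t - (1 - Polynomial.C t) * Polynomial.X)) :: E) := by
  have e1 : (fun ys => (if i ∈ ys then 1 else t) * F Lp ys) =
    fun ys => t * F Lp ys + (1-t) * ((if i ∈ ys then 1 else 0) * F Lp ys) := by
    funext ys
    split_ifs <;> ring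
  rw [e1, SI_lin, h1]
  rw [SI, Qs_head i xs hx _ (by intro ys hys; simp [hys])]
  simp only [List.mem_cons, true_or, if_true, one_mul, hF]
  rw [h2]
  simp only [List.map_append, List.map_cons, List.map_nil, List.append_assoc, List.singleton_append]
  rw [← Tl_smul, ← Tl_smul, ← Tl_add]
  congr 3
  rw [map_sub, map_one]; ring

end GLsec
end ASPaux

namespace ASPaux

def indz (A : Finset ℕ) (j : ℕ) : ℤ := if j ∈ A then 1 else 0

/-- elements of `A` in `[j, j+len)`, increasing -/
def LL (A : Finset ℕ) (j len : ℕ) : List ℕ := (List.range' j len).filter (· ∈ A)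

lemma LL_zero (A : Finset ℕ) (j : ℕ) : LL A j 0 = [] := rfl

lemma LL_succ (A : Finset ℕ) (j len : ℕ) : LL A j (len+1) =
    if j ∈ A then j :: LL A (j+1) len else LL A (j+1) len := by
  unfold LL
  rw [List.range'_succ, List.filter_cons]
  simp

lemma LL_append (A : Finset ℕ) (j l1 l2 : ℕ) : LL A j (l1 + l2) = LL A j l1 ++ LL A (j + l1) l2 := by
  unfold LL
  rw [← List.filter_append]
  congr 1
  have := List.range'_append (s := j) (m := l1) (n := l2) (step := 1)
  simp only [one_mul] at this
  rw [this]

lemma mem_LL {A : Finset ℕ} {j len x : ℕ} : x ∈ LL A j len ↔ (j ≤ x ∧ x < j + len) ∧ x ∈ A := by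
  simp [LL, List.mem_range'_1]

lemma LL_sorted (A : Finset ℕ) (j len : ℕ) : (LL A j len).Pairwise (· < ·) := by
  unfold LL
  apply List.Pairwise.filter
  exact List.pairwise_lt_range'

lemma LL_congr {A B : Finset ℕ} {j len : ℕ} (h : ∀ k, j ≤ k → k < j + len → (k ∈ A ↔ k ∈ B)) :
    LL A j len = LL B j len := by
  unfold LL
  apply List.filter_congr
  intro x hx
  rw [List.mem_range'_1] at hx
  simp [h x hx.1 hx.2]

def prefR : ℕ → ℕ → ℤ → Finset ℕ → Finset ℕ → Prop
  | 0, _, s, _, _ => s = 1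
  | len+1, j, s, A, B => (s + indz A j - indz B j = 0 ∨ s + indz A j - indz B j = 1) ∧
      prefR len (j+1) (s + indz A j - indz B j) A B

lemma prefR_congr {A B B' : Finset ℕ} (len : ℕ) : ∀ (j : ℕ) (s : ℤ),
    (∀ k, j ≤ k → k < j + len → (k ∈ B ↔ k ∈ B')) → (prefR len j s A B ↔ prefR len j s A B') := by
  induction len with
  | zero => intro j s h; rfl
  | succ len ih =>
    intro j s h
    have h1 : indz B j = indz B' j := by simp [indz, h j le_rfl (by omega)]
    rw [prefR, prefR, h1, ih]
    intro k h2 h3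
    exact h k (by omega) (by omega)

lemma prefR_length {A B : Finset ℕ} (len : ℕ) : ∀ (j : ℕ) (s : ℤ), prefR len j s A B →
    s + (LL A j len).length = (LL B j len).length + 1 := by
  induction len with
  | zero => intro j s h; simp [LL_zero]; exact h
  | succ len ih =>
    intro j s h
    have := ih _ _ h.2
    rw [LL_succ, LL_succ]
    simp only [indz] at this
    split_ifs at this ⊢ <;> simp at this ⊢ <;> linarith

section
variable {K : Type*} [CommRing K]

lemma Qs_self (j : ℕ) (xs : List ℕ) (f : List ℕ → K) : Qs j (j :: xs) f = Qs (j+1) xs (fun ys => f (j :: ys)) := by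
  simp [Qs]

lemma Qs_step (j : ℕ) (xs : List ℕ) (h : ∀ x ∈ xs, j < x) (f : List ℕ → K) :
    Qs j xs f = Qs (j+1) xs f + SI xs (fun ys => f (j :: ys)) := by
  cases xs with
  | nil => simp [Qs, SI]
  | cons x xs =>
    rw [Qs, Qs, SI, Finset.sum_eq_sum_Ico_succ_bot (h x (by simp))]
    ring

open Classical in
lemma sum_prefR (A : Finset ℕ) (len : ℕ) : ∀ (j : ℕ) (f : List ℕ → K),
    (∑ B ∈ (Ico j (j+len)).powerset, (if prefR len j 1 A B then f (LL B j len) else 0) = Qs j (LL A j len) f) ∧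
    (∑ B ∈ (Ico j (j+len)).powerset, (if prefR len j 0 A B then f (LL B j len) else 0) = SI (LL A j len) f) := by
  induction len with
  | zero => intro j f; simp [prefR, LL_zero, Qs, SI]
  | succ len ih =>
    intro j f
    have hI : Ico j (j + (len + 1)) = insert j (Ico (j+1) (j+1+len)) := by
      ext x; simp; omega
    have hj : j ∉ Ico (j+1) (j+1+len) := by simp
    have hjB : ∀ B ∈ (Ico (j+1) (j+1+len)).powerset, j ∉ B := by
      intro B hB h
      exact hj (mem_powerset.mp hB h)
    have hLi : ∀ B : Finset ℕ, LL (insert j B) j (len+1) = j :: LL B (j+1) len := by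
      intro B
      rw [LL_succ, if_pos (by simp)]
      congr 1
      apply LL_congr
      intro k hk _
      simp; omega
    have hLn : ∀ B : Finset ℕ, j ∉ B → LL B j (len+1) = LL B (j+1) len := by
      intro B h
      rw [LL_succ, if_neg h]
    have hpi : ∀ (B : Finset ℕ) (s : ℤ), prefR len (j+1) s A (insert j B) ↔ prefR len (j+1) s A B := by
      intro B s
      apply prefR_congr
      intro k hk _
      simp; omega
    have hlt : ∀ x ∈ LL A (j+1) len, j < x := by
      intro x hx
      rw [mem_LL] at hx; omega
    obtain ⟨ih1, ih0⟩ := ih (j+1) f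
    obtain ⟨ihj1, ihj0⟩ := ih (j+1) (fun ys => f (j :: ys))
    have hi1 : ∀ B, indz (insert j B) j = 1 := by intro B; simp [indz]
    have hi0 : ∀ B ∈ (Ico (j+1) (j+1+len)).powerset, indz B j = 0 := by intro B hB; simp [indz, hjB B hB]
    rw [hI, sum_powerset_insert hj, sum_powerset_insert hj]
    have e : ∀ s : ℤ, ∑ B ∈ (Ico (j+1) (j+1+len)).powerset, (if prefR (len+1) j s A B then f (LL B j (len+1)) else 0)
       = ∑ B ∈ (Ico (j+1) (j+1+len)).powerset, (if (s + indz A j = 0 ∨ s + indz A j = 1) ∧ prefR len (j+1) (s + indz A j) A B then f (LL B (j+1) len) else 0) := by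
      intro s
      refine sum_congr rfl fun B hB => ?_
      rw [prefR, hi0 B hB, hLn B (hjB B hB), sub_zero]
      congr
    have e' : ∀ s : ℤ, ∑ B ∈ (Ico (j+1) (j+1+len)).powerset, (if prefR (len+1) j s A (insert j B) then f (LL (insert j B) j (len+1)) else 0)
       = ∑ B ∈ (Ico (j+1) (j+1+len)).powerset, (if (s + indz A j - 1 = 0 ∨ s + indz A j - 1 = 1) ∧ prefR len (j+1) (s + indz A j - 1) A B then f (j :: LL B (j+1) len) else 0) := by
      intro s
      refine sum_congr rfl fun B hB => ?_
      rw [prefR, hi1 B, hLi, hpi]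
      congr
    rw [e, e, e', e']
    by_cases hA : j ∈ A
    · have hiA : indz A j = 1 := by simp [indz, hA]
      rw [hiA, LL_succ, if_pos hA, Qs_self, SI, Qs_step j _ hlt, ← ih1, ← ihj1, ← ihj0]
      constructor
      · simp
      · simp
    · have hiA : indz A j = 0 := by simp [indz, hA]
      rw [hiA, LL_succ, if_neg hA, Qs_step j _ hlt, ← ih1, ← ihj0, ← ih0]
      constructor
      · simp
      · simp

end

section Zsec
variable {K : Type*} [CommRing K] (t : K) (n : ℕ)

def RowR (i : ℕ) (S S' : Finset ℕ) : Prop :=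
  (∀ j ∈ Ico 1 (2*n), (j < i ∨ 2*n - i < j) → (j ∈ S ↔ j ∈ S')) ∧ prefR (2*n - 2*i + 1) i 0 S S'

def wt (i : ℕ) (S S' : Finset ℕ) : K :=
  if i = n then 1 else (if i ∈ S then (if i ∈ S' then 1 else t) else 1) *
    (if 2*n - i ∈ S then (if 2*n - i ∈ S' then t else 1) else 1)

open Classical in
noncomputable def Zf : ℕ → Finset ℕ → K
  | 0, S => if S = ∅ then 1 else 0
  | k+1, S => ∑ S' ∈ (Ico 1 (2*n)).powerset, if RowR n (k+1) S S' then wt t n (k+1) S S' * Zf k S' else 0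

noncomputable def GG (i c : ℕ) : Polynomial K :=
  if c ≤ i then uu K c * (-Polynomial.X)^(i-c) * (Polynomial.C t - (1 - Polynomial.C t) * Polynomial.X)
  else if c < 2*n - i then uu K c
  else Polynomial.X^(i+c-2*n) * uu K (2*n-i-1) * (1 + Polynomial.C t * Polynomial.X)

open Classical in
lemma row_sum (i : ℕ) (h1 : 1 ≤ i) (hn : i ≤ n) (S : Finset ℕ) (F : Finset ℕ → K) 
    (F' : List ℕ → K) (hF : ∀ B ∈ (Ico i (i + (2*n-2*i+1))).powerset, F ((S \ Ico i (i + (2*n-2*i+1))) ∪ B) = F' (LL B i (2*n-2*i+1)))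
    (hS : S ⊆ Ico 1 (2*n)) :
    (∑ S' ∈ (Ico 1 (2*n)).powerset, if RowR n i S S' then F S' else 0) = SI (LL S i (2*n-2*i+1)) F' := by
  rw [← (sum_prefR S (2*n-2*i+1) i F').2, ← sum_filter, ← sum_filter]
  set len := 2*n-2*i+1 with hlen
  set J := Ico i (i + len) with hJ
  refine sum_nbij' (fun S' => S' ∩ J) (fun B => (S \ J) ∪ B) ?_ ?_ ?_ ?_ ?_
  · intro S' hS'
    rw [mem_filter] at hS' ⊢
    refine ⟨by simp, ?_⟩
    refine (prefR_congr len i 0 ?_).mp hS'.2.2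
    intro k hk1 hk2
    simp [hJ, hk1, hk2]
  · intro B hB
    rw [mem_filter, mem_powerset] at hB ⊢
    refine ⟨?_, ?_, ?_⟩
    · apply union_subset (sdiff_subset.trans hS)
      refine hB.1.trans ?_
      intro x; simp [hJ]; omega
    · intro j hj hj2
      have : j ∉ J := by simp [hJ]; omega
      have h3 : j ∉ B := fun h => this (hB.1 h)
      simp [this, h3]
    · refine (prefR_congr len i 0 ?_).mp hB.2
      intro k hk1 hk2
      simp [hJ, hk1, hk2]
  · intro S' hS'
    rw [mem_filter, mem_powerset] at hS'
    ext j
    by_cases hj : j ∈ J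
    · simp [hj]
    · simp only [mem_union, mem_sdiff, hj, not_false_eq_true, and_true, mem_inter, and_false, or_false]
      by_cases hjn : j ∈ Ico 1 (2*n)
      · apply hS'.2.1 j hjn
        simp [hJ] at hj; omega
      · exact ⟨fun h => absurd (hS h) hjn, fun h => absurd (hS'.1 h) hjn⟩
  · intro B hB
    rw [mem_filter, mem_powerset] at hB
    ext j
    by_cases hj : j ∈ J
    · simp [hj]
    · simp [hj]; exact fun h => hj (hB.1 h)
  · intro S' hS'
    rw [mem_filter, mem_powerset] at hS'
    have := hF (S' ∩ J) (by simp)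
    rw [← this]
    congr 1
    ext j
    by_cases hj : j ∈ J
    · simp [hj]
    · simp only [mem_union, mem_sdiff, hj, not_false_eq_true, and_true, mem_inter, and_false, or_false]
      by_cases hjn : j ∈ Ico 1 (2*n)
      · symm
        apply hS'.2.1 j hjn
        simp [hJ] at hj; omega
      · exact ⟨fun h => absurd (hS'.1 h) hjn, fun h => absurd (hS h) hjn⟩

lemma RowR_length (i : ℕ) (h1 : 1 ≤ i) (hn : i ≤ n) (S S' : Finset ℕ) (h : RowR n i S S') :
    (LL S 1 (2*n-1)).length = (LL S' 1 (2*n-1)).length + 1 := by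
  have h2 := prefR_length _ _ _ h.2
  have h' := h.1
  obtain ⟨len, hlen⟩ : ∃ len, len = 2*n-2*i+1 := ⟨_, rfl⟩
  rw [← hlen] at h2
  have e : 2*n-1 = (i-1) + (len + (i-1)) := by omega
  rw [e]
  simp only [LL_append, List.length_append]
  have e1 : 1 + (i-1) = i := by omega
  rw [e1]
  have h3 : LL S 1 (i-1) = LL S' 1 (i-1) := LL_congr (by
    intro k hk1 hk2
    exact h' k (by rw [mem_Ico]; omega) (by omega))
  have h4 : LL S (i + len) (i-1) = LL S' (i + len) (i-1) := LL_congr (by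
    intro k hk1 hk2
    exact h' k (by rw [mem_Ico]; omega) (by omega))
  rw [h3, h4]
  omega

end Zsec
end ASPaux

namespace ASPaux
section Zthm
variable {K : Type*} [CommRing K] [IsDomain K] [CharZero K] (t : K) (n : ℕ)

lemma Tl_nil : Tl 0 ([] : List (Polynomial K)) = 1 := by
  unfold Tl Theta gP cP vP pairProd
  simp
  rw [show cst 0 0 = 0 from Subsingleton.elim _ _]
  simp

open Classical in
lemma gl_right' (Lp Rq : List (Polynomial K)) (A : List ℕ) (c : ℕ) (hc : 1 ≤ c) (S : Finset ℕ)
    (hA : (A ++ (if c ∈ S then [c] else [])).Pairwise (· < ·))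
    (hne : Lp ≠ [] ∨ A ≠ [] ∨ Rq ≠ [] ∨ c ∈ S) :
    SI (A ++ (if c ∈ S then [c] else [])) (fun ys : List ℕ => (if c ∈ S then (if c ∈ ys then t else 1) else 1) *
      Tl 0 (Lp ++ (ys.map (uu K) ++ Rq.map ((1 + Polynomial.X) * ·)))) =
    Tl 0 (Lp.map (fun g => -Polynomial.X * g) ++ (A.map (uu K) ++
      ((if c ∈ S then [uu K (c-1) * (1 + Polynomial.C t * Polynomial.X)] else []) ++ Rq.map (Polynomial.X * ·)))) := by
  by_cases h : c ∈ S
  · simp only [h, if_true] at hA ⊢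
    rw [gl_right t Lp Rq A c hc hA]
    simp
  · simp only [h, if_false, List.append_nil, one_mul, List.nil_append] at hA ⊢
    rw [gl_main Lp Rq A hA (by tauto)]

open Classical in
lemma gl_both (Lp Rq : List (Polynomial K)) (mid : List ℕ) (i c : ℕ) (hic : i < c) (S : Finset ℕ)
    (hi : ∀ x ∈ mid, i < x) (hm : ∀ x ∈ mid, x < c) (hmid : mid.Pairwise (· < ·))
    (hne : Lp ≠ [] ∨ mid ≠ [] ∨ Rq ≠ [] ∨ c ∈ S ∨ i ∈ S) :
    SI ((if i ∈ S then [i] else []) ++ (mid ++ (if c ∈ S then [c] else []))) (fun ys : List ℕ =>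
      (if i ∈ S then (if i ∈ ys then 1 else t) else 1) * ((if c ∈ S then (if c ∈ ys then t else 1) else 1) *
      Tl 0 (Lp ++ (ys.map (uu K) ++ Rq.map ((1 + Polynomial.X) * ·))))) =
    Tl 0 (Lp.map (fun g => -Polynomial.X * g) ++ 
      ((if i ∈ S then [uu K i * (Polynomial.C t - (1 - Polynomial.C t) * Polynomial.X)] else []) ++ (mid.map (uu K) ++
      ((if c ∈ S then [uu K (c-1) * (1 + Polynomial.C t * Polynomial.X)] else []) ++ Rq.map (Polynomial.X * ·))))) := by
  have hs : (mid ++ (if c ∈ S then [c] else [])).Pairwise (· < ·) := by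
    split_ifs
    · rw [List.pairwise_append]; exact ⟨hmid, by simp, by simpa using hm⟩
    · simpa using hmid
  have hs2 : ∀ x ∈ (mid ++ (if c ∈ S then [c] else [])), i < x := by
    intro x hx
    rw [List.mem_append] at hx
    rcases hx with hx | hx
    · exact hi x hx
    · split_ifs at hx <;> simp at hx
      omega
  by_cases h : i ∈ S
  · simp only [h, if_true, List.singleton_append]
    have := gl_left t Lp (mid.map (uu K) ++
      ((if c ∈ S then [uu K (c-1) * (1 + Polynomial.C t * Polynomial.X)] else []) ++ Rq.map (Polynomial.X * ·)))
      (mid ++ (if c ∈ S then [c] else [])) i hs2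
      (fun Lp ys => ((if c ∈ S then (if c ∈ ys then t else 1) else 1) *
      Tl 0 (Lp ++ (ys.map (uu K) ++ Rq.map ((1 + Polynomial.X) * ·))))) ?_ ?_ ?_
    · exact this
    · intro ys
      have : c ≠ i := by omega
      simp [this]
    · rw [← List.cons_append, gl_right' t Lp Rq (i :: mid) c (by omega) S]
      · simp
      · rw [List.cons_append, List.pairwise_cons]; exact ⟨hs2, hs⟩
      · simp
    · rw [gl_right' t (Lp ++ [uu K i]) Rq mid c (by omega) S hs (by simp)]
  · simp only [h, if_false, List.nil_append, one_mul] at hne ⊢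
    rw [gl_right' t Lp Rq mid c (by omega) S hs (by tauto)]

open Classical in
theorem Zf_eq (i : ℕ) : i + 1 ≤ n → ∀ S : Finset ℕ, S ⊆ Ico 1 (2*n) → Zf t n i S =
    if (LL S 1 (2*n-1)).length = i then Tl 0 ((LL S 1 (2*n-1)).map (GG t n i)) else 0 := by
  induction i with
  | zero =>
    intro hn S hS
    rw [Zf]
    by_cases h : S = ∅
    · subst h
      have : LL ∅ 1 (2*n-1) = [] := by simp [LL]
      simp [this, Tl_nil]
    · rw [if_neg h, if_neg]
      obtain ⟨x, hx⟩ := Finset.nonempty_iff_ne_empty.mpr h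
      have hx2 := hS hx
      rw [mem_Ico] at hx2
      have : x ∈ LL S 1 (2*n-1) := mem_LL.mpr ⟨by omega, hx⟩
      intro h0
      rw [List.length_eq_zero_iff] at h0
      rw [h0] at this; simp at this
  | succ k ih =>
    intro hn S hS
    rw [Zf]
    have ih' := ih (by omega)
    by_cases hl : (LL S 1 (2*n-1)).length = k + 1
    swap
    · rw [if_neg hl]
      apply sum_eq_zero
      intro S' hS'
      split_ifs with hR
      · have := RowR_length n (k+1) (by omega) (by omega) S S' hR
        rw [ih' S' (mem_powerset.mp hS'), if_neg (by omega), mul_zero]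
      · rfl
    rw [if_pos hl]
    have e1 : ∀ S' ∈ (Ico 1 (2*n)).powerset, (if RowR n (k+1) S S' then wt t n (k+1) S S' * Zf t n k S' else 0) =
        if RowR n (k+1) S S' then wt t n (k+1) S S' * Tl 0 ((LL S' 1 (2*n-1)).map (GG t n k)) else 0 := by
      intro S' hS'
      split_ifs with hR
      · have := RowR_length n (k+1) (by omega) (by omega) S S' hR
        rw [ih' S' (mem_powerset.mp hS'), if_pos (by omega)]
      · rfl
    rw [sum_congr rfl e1]
    obtain ⟨c, hc⟩ : ∃ c, c = 2*n - (k+1) := ⟨_, rfl⟩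
    obtain ⟨d, hd⟩ : ∃ d, d = 2*n - 2*(k+1) - 1 := ⟨_, rfl⟩
    have hlen : 2*n - 2*(k+1) + 1 = 1 + (d + 1) := by omega
    have htot : 2*n - 1 = k + ((1 + (d+1)) + k) := by omega
    set Lp := (LL S 1 k).map (GG t n k) with hLp
    set Rq := (LL S (c+1) k).map (fun c' => Polynomial.X^(k+c'-2*n) * uu K (2*n-k-2) * (1 + Polynomial.C t * Polynomial.X)) with hRq
    rw [row_sum n (k+1) (by omega) (by omega) S _ (fun ys : List ℕ =>
      (if (k+1) ∈ S then (if (k+1) ∈ ys then 1 else t) else 1) * ((if c ∈ S then (if c ∈ ys then t else 1) else 1) *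
      Tl 0 (Lp ++ (ys.map (uu K) ++ Rq.map ((1 + Polynomial.X) * ·))))) ?_ hS]
    · have e2 : LL S (k+1) (2*n - 2*(k+1) + 1) = (if (k+1) ∈ S then [k+1] else []) ++ (LL S (k+2) d ++ (if c ∈ S then [c] else [])) := by
        rw [hlen, LL_append, LL_append]
        congr 1
        · rw [LL_succ]; simp [LL_zero]
        · congr 1
          rw [LL_succ, show k + 1 + 1 + d = c by omega]; simp [LL_zero]
      have e3 : LL S 1 (2*n-1) = LL S 1 k ++ (((if (k+1) ∈ S then [k+1] else []) ++ (LL S (k+2) d ++ (if c ∈ S then [c] else []))) ++ LL S (c+1) k) := by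
        rw [← e2, htot, LL_append, LL_append, hlen, show 1 + k = k + 1 by omega, show k + 1 + (1 + (d+1)) = c + 1 by omega]
      rw [e2, gl_both t Lp Rq _ (k+1) c (by omega) S]
      · rw [e3]
        simp only [List.map_append, List.append_assoc]
        congr 1
        congr 1
        · rw [hLp, List.map_map]
          apply List.map_congr_left
          intro x hx
          rw [mem_LL] at hx
          have h1 : x ≤ k := by omega
          have h2 : x ≤ k + 1 := by omega
          simp only [GG, Function.comp, h1, h2, if_true]
          rw [show k + 1 - x = (k - x) + 1 by omega, pow_succ]; ring
        congr 1
        · split_ifs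
          · simp [GG]
          · rfl
        congr 1
        · apply List.map_congr_left
          intro x hx
          rw [mem_LL] at hx
          have h1 : ¬ x ≤ k + 1 := by omega
          have h2 : x < 2*n - (k+1) := by omega
          simp only [GG, h1, h2, if_true, if_false]
        congr 1
        · split_ifs
          · have h1 : ¬ c ≤ k + 1 := by omega
            have h2 : ¬ c < 2*n - (k+1) := by omega
            simp only [List.map_cons, List.map_nil, GG, h1, h2, if_false]
            rw [show k + 1 + c - 2*n = 0 by omega, ← hc, pow_zero, one_mul]
          · rfl
        · rw [hRq, List.map_map]
          apply List.map_congr_left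
          intro x hx
          rw [mem_LL] at hx
          have h1 : ¬ x ≤ k + 1 := by omega
          have h2 : ¬ x < 2*n - (k+1) := by omega
          simp only [GG, Function.comp, h1, h2, if_false]
          rw [show k + 1 + x - 2*n = (k + x - 2*n) + 1 by omega, pow_succ, show 2*n - (k+1) - 1 = 2*n - k - 2 by omega]; ring
      · intro x hx
        rw [mem_LL] at hx; omega
      · intro x hx
        rw [mem_LL] at hx; omega
      · exact LL_sorted _ _ _
      · by_contra hcon
        simp only [not_or, not_not] at hcon
        obtain ⟨h1, h2, h3, h4, h5⟩ := hcon
        rw [hLp, List.map_eq_nil_iff] at h1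
        rw [hRq, List.map_eq_nil_iff] at h3
        rw [e3, h1, h2, h3, if_neg h4, if_neg h5] at hl
        simp at hl
    · intro B hB
      rw [mem_powerset] at hB
      rw [hlen] at hB ⊢
      set J := Ico (k+1) (k+1+(1+(d+1))) with hJ
      have hcB : c ∈ J := by rw [hJ, mem_Ico]; omega
      have hiB : k+1 ∈ J := by rw [hJ, mem_Ico]; omega
      have m1 : ∀ x ∈ J, (x ∈ S \ J ∪ B ↔ x ∈ LL B (k+1) (1+(d+1))) := by
        intro x hx
        rw [mem_LL]
        have := hx
        rw [hJ, mem_Ico] at this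
        simp [hx, this]
      have m2 : LL (S \ J ∪ B) 1 (2*n-1) = LL S 1 k ++ (LL B (k+1) (1+(d+1)) ++ LL S (c+1) k) := by
        rw [htot, LL_append, LL_append, show 1 + k = k + 1 by omega, show k + 1 + (1 + (d+1)) = c + 1 by omega]
        have out : ∀ x, (x < k+1 ∨ c < x) → (x ∈ S \ J ∪ B ↔ x ∈ S) := by
          intro x hx
          have h1 : x ∉ J := by rw [hJ, mem_Ico]; omega
          have h2 : x ∉ B := fun h => h1 (hB h)
          simp [h1, h2]
        congr 1
        · apply LL_congr
          intro x _ h2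
          exact out x (by omega)
        congr 1
        · apply LL_congr
          intro x h1 h2
          have : x ∈ J := by rw [hJ, mem_Ico]; omega
          simp [this]
        · apply LL_congr
          intro x h1 _
          exact out x (by omega)
      rw [m2, wt, if_neg (by omega), ← hc, mul_assoc]
      simp only [m1 _ hcB, m1 _ hiB]
      congr 3
      rw [List.map_append, List.map_append]
      congr 2
      · apply List.map_congr_left
        intro x hx
        rw [mem_LL] at hx
        have h1 : ¬ x ≤ k := by omega
        have h2 : x < 2*n - k := by omega
        simp only [GG, h1, h2, if_true, if_false]
      · rw [hRq, List.map_map]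
        apply List.map_congr_left
        intro x hx
        rw [mem_LL] at hx
        have h1 : ¬ x ≤ k := by omega
        have h2 : ¬ x < 2*n - k := by omega
        simp only [GG, Function.comp, h1, h2, if_false]
        rw [show 2*n - k - 1 = (2*n - k - 2) + 1 by omega, uu_succ]; ring

/-- last row -/
lemma Zf_last (hn : 1 ≤ n) (S : Finset ℕ) (hS : S ⊆ Ico 1 (2*n)) (hmem : n ∈ S) :
    Zf t n n S = Zf t n (n-1) (S.erase n) := by
  classical
  obtain ⟨k, rfl⟩ : ∃ k, n = k + 1 := ⟨n - 1, by omega⟩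
  rw [Zf, Nat.add_sub_cancel]
  rw [Finset.sum_eq_single (S.erase (k+1))]
  · rw [if_pos, wt, if_pos rfl, one_mul]
    refine ⟨?_, ?_⟩
    · intro j _ hj
      have : j ≠ k + 1 := by omega
      simp [this]
    · rw [Nat.sub_self]
      simp [prefR, indz, hmem]
  · intro S' hS' hne
    rw [if_neg]
    rintro ⟨h1, h2⟩
    rw [Nat.sub_self] at h2
    simp only [prefR, indz, hmem, if_true] at h2
    apply hne
    ext j
    rw [mem_erase]
    by_cases hj : j = k + 1
    · subst hj
      simp only [ne_eq, not_true_eq_false, false_and, iff_false]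
      intro h
      rw [if_pos h] at h2
      simp at h2
    · by_cases hjn : j ∈ Ico 1 (2*(k+1))
      · rw [← h1 j hjn (by omega)]; simp [hj]
      · exact ⟨fun h => absurd (mem_powerset.mp hS' h) hjn, fun h => absurd (hS h.2) hjn⟩
  · intro h
    exact absurd (mem_powerset.mpr ((erase_subset _ _).trans hS)) h

lemma Zf_last' (hn : 1 ≤ n) (S : Finset ℕ) (hmem : n ∉ S) :
    Zf t n n S = 0 := by
  classical
  obtain ⟨k, rfl⟩ : ∃ k, n = k + 1 := ⟨n - 1, by omega⟩
  rw [Zf]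
  apply sum_eq_zero
  intro S' _
  rw [if_neg]
  rintro ⟨h1, h2⟩
  rw [Nat.sub_self] at h2
  simp only [prefR, indz, hmem, if_false] at h2
  split_ifs at h2 <;> simp at h2

end Zthm
end ASPaux

namespace ASPaux

/-! ### Chains -/
section chains
variable {K : Type*} [CommRing K] (t : K) (n : ℕ)

structure IsCh (i : ℕ) (S : Finset ℕ) (c : ℕ → Finset ℕ) : Prop where
  zero : c 0 = ∅
  last : c i = S
  out : ∀ k, i < k → c k = ∅
  sub : ∀ k, k < i → c k ⊆ Ico 1 (2*n)
  row : ∀ k, k < i → RowR n (k+1) (c (k+1)) (c k)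

lemma IsCh_zero (S : Finset ℕ) (c : ℕ → Finset ℕ) : IsCh n 0 S c ↔ (S = ∅ ∧ c = fun _ => ∅) := by
  constructor
  · rintro ⟨h1, h2, h3, h4, h5⟩
    refine ⟨h2.symm.trans h1, ?_⟩
    funext k
    rcases Nat.eq_zero_or_pos k with h | h
    · rw [h, h1]
    · exact h3 k h
  · rintro ⟨rfl, rfl⟩
    exact ⟨rfl, rfl, fun _ _ => rfl, fun _ h => absurd h (by omega), fun _ h => absurd h (by omega)⟩

lemma IsCh_succ_mk {i : ℕ} {S S' : Finset ℕ} {c : ℕ → Finset ℕ} (hS' : S' ⊆ Ico 1 (2*n))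
    (hr : RowR n (i+1) S S') (h : IsCh n i S' c) : IsCh n (i+1) S (Function.update c (i+1) S) := by
  refine ⟨?_, by simp, ?_, ?_, ?_⟩
  · rw [Function.update_of_ne (by omega)]; exact h.zero
  · intro k hk
    rw [Function.update_of_ne (by omega)]; exact h.out k (by omega)
  · intro k hk
    rw [Function.update_of_ne (by omega)]
    rcases Nat.lt_or_ge k i with h1 | h1
    · exact h.sub k h1
    · have : k = i := by omega
      subst this
      rw [h.last]; exact hS'
  · intro k hk
    rw [Function.update_of_ne (a := k) (by omega)]
    rcases Nat.lt_or_ge k i with h1 | h1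
    · rw [Function.update_of_ne (by omega)]; exact h.row k h1
    · have : k = i := by omega
      subst this
      rw [h.last]; simpa using hr

lemma IsCh_succ_cut {i : ℕ} {S : Finset ℕ} {c : ℕ → Finset ℕ} (h : IsCh n (i+1) S c) :
    IsCh n i (c i) (Function.update c (i+1) ∅) := by
  refine ⟨?_, ?_, ?_, ?_, ?_⟩
  · rw [Function.update_of_ne (by omega)]; exact h.zero
  · rw [Function.update_of_ne (by omega)]
  · intro k hk
    rcases Nat.eq_or_lt_of_le (Nat.succ_le_of_lt hk) with h1 | h1
    · subst h1; simp
    · rw [Function.update_of_ne (by omega)]; exact h.out k (by omega)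
  · intro k hk
    rw [Function.update_of_ne (by omega)]; exact h.sub k (by omega)
  · intro k hk
    rw [Function.update_of_ne (by omega), Function.update_of_ne (by omega)]; exact h.row k (by omega)

open Classical in
noncomputable def Ch : ℕ → Finset ℕ → Finset (ℕ → Finset ℕ)
  | 0, S => if S = ∅ then {fun _ => ∅} else ∅
  | i+1, S => (((Ico 1 (2*n)).powerset.filter (fun S' => RowR n (i+1) S S'))).biUnion
      (fun S' => (Ch i S').image (fun c => Function.update c (i+1) S))

lemma mem_Ch (i : ℕ) : ∀ (S : Finset ℕ) (c : ℕ → Finset ℕ), c ∈ Ch n i S ↔ IsCh n i S c := by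
  induction i with
  | zero =>
    intro S c
    rw [IsCh_zero, Ch]
    split_ifs with h <;> simp [h]
  | succ i ih =>
    intro S c
    rw [Ch]
    simp only [mem_biUnion, mem_filter, mem_powerset, mem_image]
    constructor
    · rintro ⟨S', ⟨h1, h2⟩, c', h3, rfl⟩
      exact IsCh_succ_mk n h1 h2 ((ih _ _).mp h3)
    · intro h
      refine ⟨c i, ⟨h.sub i (by omega), ?_⟩, Function.update c (i+1) ∅, (ih _ _).mpr (IsCh_succ_cut n h), ?_⟩
      · rw [← h.last]; exact h.row i (by omega)
      · rw [Function.update_idem]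
        rw [← h.last]; simp

open Classical in
lemma Zf_eq_sum_Ch (i : ℕ) : ∀ (S : Finset ℕ), Zf t n i S =
    ∑ c ∈ Ch n i S, ∏ k ∈ range i, wt t n (k+1) (c (k+1)) (c k) := by
  induction i with
  | zero =>
    intro S
    rw [Zf, Ch]
    split_ifs with h <;> simp
  | succ i ih =>
    intro S
    rw [Zf, Ch, sum_biUnion, ← sum_filter]
    · refine sum_congr rfl fun S' hS' => ?_
      rw [sum_image, ih, mul_sum]
      · refine sum_congr rfl fun c hc => ?_
        rw [mem_Ch] at hc
        rw [prod_range_succ, mul_comm]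
        congr 1
        · refine prod_congr rfl fun k hk => ?_
          rw [mem_range] at hk
          rw [Function.update_of_ne (by omega), Function.update_of_ne (by omega)]
        · rw [Function.update_of_ne (a := i) (by omega), hc.last]; simp
      · intro c hc c' hc' he
        rw [mem_coe, mem_Ch] at hc hc'
        funext k
        by_cases hk : k = i+1
        · rw [hc.out k (by omega), hc'.out k (by omega)]
        · have := congrFun he k
          simp only at this
          rwa [Function.update_of_ne hk, Function.update_of_ne hk] at this
    · intro S1 h1 S2 h2 hne
      rw [Function.onFun, disjoint_left]
      intro c hc1 hc2
      rw [mem_image] at hc1 hc2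
      obtain ⟨c1, hc1, rfl⟩ := hc1
      obtain ⟨c2, hc2, he⟩ := hc2
      rw [mem_Ch] at hc1 hc2
      apply hne
      have := congrFun he i
      rw [Function.update_of_ne (by omega), Function.update_of_ne (by omega), hc1.last, hc2.last] at this
      exact this.symm
end chains

/-! ### alternating sequences -/

lemma alt_pfx (f : ℕ → ℤ) (h3 : ∀ i, f i = -1 ∨ f i = 0 ∨ f i = 1)
    (halt : ∀ i j, i < j → f i ≠ 0 → f j ≠ 0 → (∀ k, i < k → k < j → f k = 0) → f i * f j = -1) :
    (∀ i, f i = 0) ∨ ∃ m, f m ≠ 0 ∧ (∀ k < m, f k = 0) ∧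
      ∀ k, ∑ i ∈ range k, f i = 0 ∨ ∑ i ∈ range k, f i = f m := by
  by_cases h0 : ∀ i, f i = 0
  · exact Or.inl h0
  right
  push Not at h0
  classical
  refine ⟨Nat.find h0, Nat.find_spec h0, fun k hk => by simpa using Nat.find_min h0 hk, ?_⟩
  set m := Nat.find h0 with hm
  have hm0 : f m ≠ 0 := Nat.find_spec h0
  have hml : ∀ k < m, f k = 0 := fun k hk => by simpa using Nat.find_min h0 hk
  have key : ∀ k, (k ≤ m ∧ ∑ i ∈ range k, f i = 0) ∨ (m < k ∧ ∃ q < k, (∀ i, q < i → i < k → f i = 0) ∧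
      ((f q = f m ∧ ∑ i ∈ range k, f i = f m) ∨ (f q = - f m ∧ ∑ i ∈ range k, f i = 0))) := by
    intro k
    induction k with
    | zero => left; simp
    | succ k ih =>
      rw [sum_range_succ]
      rcases ih with ⟨h1, h2⟩ | ⟨h1, q, hq, hz, hh⟩
      · rcases Nat.eq_or_lt_of_le h1 with h | h
        · right
          refine ⟨by omega, k, by omega, fun i _ _ => by omega, Or.inl ⟨by rw [h], by rw [h2, h]; ring⟩⟩
        · left
          exact ⟨h, by rw [h2, hml k h]; ring⟩
      · right
        refine ⟨by omega, ?_⟩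
        by_cases hk : f k = 0
        · refine ⟨q, by omega, ?_, ?_⟩
          · intro i hi1 hi2
            rcases Nat.lt_or_ge i k with h | h
            · exact hz i hi1 h
            · have : i = k := by omega
              rw [this]; exact hk
          · rw [hk, add_zero]; exact hh
        · refine ⟨k, by omega, fun i _ _ => by omega, ?_⟩
          have hq0 : f q ≠ 0 := by
            rcases hh with h | h
            · rw [h.1]; exact hm0
            · rw [h.1]; simpa using hm0
          have hp := halt q k hq hq0 hk hz
          have : f k = - f q := by
            rcases h3 q with h | h | h <;> rcases h3 k with h' | h' | h' <;> rw [h, h'] at hp ⊢ <;> simp at hp ⊢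
          rcases hh with h | h
          · right; rw [this, h.1, h.2]; exact ⟨rfl, by ring⟩
          · left; rw [this, h.1, h.2]; exact ⟨by ring, by ring⟩
  intro k
  rcases key k with h | ⟨_, q, _, _, h | h⟩
  · exact Or.inl h.2
  · exact Or.inr h.2
  · exact Or.inl h.2

lemma pfx_alt (f : ℕ → ℤ) (hp : ∀ k, ∑ i ∈ range k, f i = 0 ∨ ∑ i ∈ range k, f i = 1) :
    (∀ i, f i = -1 ∨ f i = 0 ∨ f i = 1) ∧
    (∀ i j, i < j → f i ≠ 0 → f j ≠ 0 → (∀ k, i < k → k < j → f k = 0) → f i * f j = -1) ∧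
    (∀ i, f i ≠ 0 → (∀ k < i, f k = 0) → f i = 1) := by
  have h3 : ∀ i, f i = -1 ∨ f i = 0 ∨ f i = 1 := by
    intro i
    have h1 := hp i
    have h2 := hp (i+1)
    rw [sum_range_succ] at h2
    omega
  refine ⟨h3, ?_, ?_⟩
  · intro i j hij hi hj hz
    have e : ∑ k ∈ range j, f k = ∑ k ∈ range (i+1), f k := by
      symm
      apply sum_subset
      · intro x; simp; omega
      · intro x hx hx2
        simp at hx hx2
        exact hz x (by omega) hx
    have h1 := hp i
    have h2 := hp (i+1)
    have h4 := hp (j+1)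
    rw [sum_range_succ, e] at h4
    rw [sum_range_succ] at h2 h4
    rcases h3 i with h | h | h <;> rcases h3 j with h' | h' | h' <;> rw [h, h'] <;> rw [h] at h2 h4 hi <;> rw [h'] at h4 hj <;> first | omega | norm_num
  · intro i hi hz
    have h2 := hp (i+1)
    rw [sum_range_succ, sum_eq_zero (fun k hk => hz k (mem_range.mp hk))] at h2
    omega

lemma prefR_iff (A B : Finset ℕ) (len : ℕ) : ∀ (j : ℕ) (s : ℤ), (s = 0 ∨ s = 1) → (prefR len j s A B ↔
    (∀ m ≤ len, s + ∑ k ∈ Ico j (j+m), (indz A k - indz B k) = 0 ∨ s + ∑ k ∈ Ico j (j+m), (indz A k - indz B k) = 1) ∧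
      s + ∑ k ∈ Ico j (j+len), (indz A k - indz B k) = 1) := by
  induction len with
  | zero => intro j s hs; simp [prefR, hs]
  | succ len ih =>
    intro j s hs
    have e : ∀ m, ∑ k ∈ Ico j (j+(m+1)), (indz A k - indz B k) = (indz A j - indz B j) + ∑ k ∈ Ico (j+1) (j+1+m), (indz A k - indz B k) := by
      intro m
      rw [sum_eq_sum_Ico_succ_bot (by omega)]
      congr 2
      congr 1; omega
    rw [prefR]
    constructor
    · rintro ⟨h1, h2⟩
      rw [ih _ _ h1] at h2
      refine ⟨?_, ?_⟩
      · intro m hm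
        cases m with
        | zero => simpa using hs
        | succ m =>
          rw [e]
          have := h2.1 m (by omega)
          omega
      · rw [e]; have := h2.2; omega
    · rintro ⟨h1, h2⟩
      have h0 : s + indz A j - indz B j = 0 ∨ s + indz A j - indz B j = 1 := by
        have := h1 1 (by omega)
        simp at this
        omega
      refine ⟨h0, (ih _ _ h0).mpr ⟨?_, ?_⟩⟩
      · intro m hm
        have := h1 (m+1) (by omega)
        rw [e] at this; omega
      · rw [e] at h2; omega
end ASPaux

namespace ASPaux

section toChain
variable {n : ℕ} (T : AST n)

lemma AST_col_pfx (j k : ℕ) : ∑ i ∈ range k, T.entry i j = 0 ∨ ∑ i ∈ range k, T.entry i j = 1 := by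
  rcases alt_pfx (fun i => T.entry i j) (fun i => T.entries i j) (T.altCol j) with h | ⟨m, h1, h2, h3⟩
  · left; exact sum_eq_zero fun i _ => h i
  · have := T.topOne m j h1 (fun i hi => h2 i hi)
    rw [← this]; exact h3 k

lemma AST_out {i j : ℕ} (h : ¬ (1 ≤ i ∧ i ≤ n ∧ i ≤ j ∧ j ≤ 2*n - i)) : T.entry i j = 0 := by
  by_contra hc
  exact h (T.support i j hc)

lemma AST_row_total (i : ℕ) (h1 : 1 ≤ i) (h2 : i ≤ n) (N : ℕ) (hN : 2*n - i < N) : ∑ j ∈ range N, T.entry i j = 1 := by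
  rw [← T.rowSum i h1 h2]
  symm
  apply sum_subset
  · intro x; simp; omega
  · intro x _ hx
    apply AST_out
    simp at hx; omega

lemma AST_row_pfx (i k : ℕ) (h1 : 1 ≤ i) (h2 : i ≤ n) : ∑ j ∈ range k, T.entry i j = 0 ∨ ∑ j ∈ range k, T.entry i j = 1 := by
  have ht := AST_row_total T i h1 h2 (2*n) (by omega)
  rcases alt_pfx (fun j => T.entry i j) (fun j => T.entries i j) (T.altRow i) with h | ⟨m, h3, h4, h5⟩
  · rw [sum_eq_zero (fun j _ => h j)] at ht; omega
  · have h6 := h5 (2*n)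
    rw [ht] at h6
    have : T.entry i m = 1 := by omega
    rw [← this]; exact h5 k

/-- the chain of an AST -/
def toCh (k : ℕ) : Finset ℕ :=
  if k ≤ n then (Ico 1 (2*n)).filter (fun j => ∑ i ∈ range (k+1), T.entry i j = 1) else ∅

lemma toCh_sub (k : ℕ) : toCh T k ⊆ Ico 1 (2*n) := by
  unfold toCh; split_ifs
  · exact filter_subset _ _
  · simp

lemma indz_toCh (k j : ℕ) (hk : k ≤ n) : indz (toCh T k) j = ∑ i ∈ range (k+1), T.entry i j := by
  unfold indz toCh
  rw [if_pos hk]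
  simp only [mem_filter]
  by_cases hj : j ∈ Ico 1 (2*n)
  · rcases AST_col_pfx T j (k+1) with h | h
    · simp [hj, h]
    · simp [hj, h]
  · have : ∑ i ∈ range (k+1), T.entry i j = 0 := by
      apply sum_eq_zero
      intro i _
      apply AST_out
      simp at hj; omega
    simp [hj, this]

lemma entry_toCh (k j : ℕ) (hk : k + 1 ≤ n) : T.entry (k+1) j = indz (toCh T (k+1)) j - indz (toCh T k) j := by
  rw [indz_toCh _ _ _ hk, indz_toCh _ _ _ (by omega), sum_range_succ _ (k+1)]; ring

lemma indz_eq {A B : Finset ℕ} {j : ℕ} (h : indz A j = indz B j) : j ∈ A ↔ j ∈ B := by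
  unfold indz at h
  split_ifs at h <;> simp_all

lemma toCh_IsCh : IsCh n n (toCh T n) (toCh T) := by
  refine ⟨?_, rfl, ?_, fun k _ => toCh_sub T k, ?_⟩
  · ext j
    have h := indz_toCh T 0 j (by omega)
    simp only [zero_add, range_one, sum_singleton] at h
    rw [AST_out T (by omega)] at h
    simp [indz] at h
    simp [h]
  · intro k hk
    unfold toCh
    rw [if_neg (by omega)]
  · intro k hk
    refine ⟨?_, ?_⟩
    · intro j hj hj2
      apply indz_eq
      have := entry_toCh T k j hk
      rw [AST_out T (by omega)] at this
      omega
    · rw [prefR_iff _ _ _ _ _ (Or.inl rfl)]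
      simp only [← entry_toCh T k _ hk, zero_add]
      have e : ∀ m, ∑ j ∈ Ico (k+1) (k+1+m), T.entry (k+1) j = ∑ j ∈ range (k+1+m), T.entry (k+1) j := by
        intro m
        apply sum_subset
        · intro x; simp
        · intro x h1 h2
          apply AST_out
          simp at h1 h2; omega
      refine ⟨?_, ?_⟩
      · intro m _
        rw [e]; exact AST_row_pfx T (k+1) _ (by omega) hk
      · rw [e]; exact AST_row_total T (k+1) (by omega) hk _ (by omega)

end toChain

section ofChain
variable {n : ℕ} {S : Finset ℕ} {c : ℕ → Finset ℕ} 

def ofE (n : ℕ) (c : ℕ → Finset ℕ) (i j : ℕ) : ℤ := if 1 ≤ i ∧ i ≤ n then indz (c i) j - indz (c (i-1)) j else 0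

lemma indz_01 (A : Finset ℕ) (j : ℕ) : indz A j = 0 ∨ indz A j = 1 := by
  unfold indz; split_ifs <;> simp

lemma indz_congr {A B : Finset ℕ} {j : ℕ} (h : j ∈ A ↔ j ∈ B) : indz A j = indz B j := by
  unfold indz; simp [h]

lemma IsCh_sub' (hS : S ⊆ Ico 1 (2*n)) (h : IsCh n n S c) (k : ℕ) : c k ⊆ Ico 1 (2*n) := by
  rcases lt_trichotomy k n with h1 | h1 | h1
  · exact h.sub k h1
  · rw [h1, h.last]; exact hS
  · rw [h.out k h1]; simp

lemma ofE_col (h : IsCh n n S c) (k j : ℕ) (hk : k ≤ n) : ∑ i ∈ range (k+1), ofE n c i j = indz (c k) j := by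
  induction k with
  | zero => simp [ofE, h.zero, indz]
  | succ k ih =>
    rw [sum_range_succ, ih (by omega), ofE, if_pos (by omega)]
    simp

lemma ofE_col' (h : IsCh n n S c) (k j : ℕ) : ∑ i ∈ range k, ofE n c i j = 0 ∨ ∑ i ∈ range k, ofE n c i j = 1 := by
  rcases Nat.eq_zero_or_pos k with h0 | h0
  · left; simp [h0]
  obtain ⟨k, rfl⟩ : ∃ k', k = k'+1 := ⟨k-1, by omega⟩
  by_cases hk : k ≤ n
  · rw [ofE_col h k j hk]; exact indz_01 _ _
  · have : ∑ i ∈ range (k+1), ofE n c i j = ∑ i ∈ range (n+1), ofE n c i j := by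
      symm
      apply sum_subset
      · intro x; simp; omega
      · intro x _ hx
        rw [ofE, if_neg (by simp at hx; omega)]
    rw [this, ofE_col h n j le_rfl]; exact indz_01 _ _

lemma ofE_out (hS : S ⊆ Ico 1 (2*n)) (h : IsCh n n S c) {i j : ℕ} (hij : ¬ (1 ≤ i ∧ i ≤ n ∧ i ≤ j ∧ j ≤ 2*n - i)) :
    ofE n c i j = 0 := by
  unfold ofE
  split_ifs with hi
  · have hr := h.row (i-1) (by omega)
    have e : i - 1 + 1 = i := by omega
    rw [e] at hr
    rw [sub_eq_zero]
    apply indz_congr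
    by_cases hj : j ∈ Ico 1 (2*n)
    · exact hr.1 j hj (by omega)
    · exact ⟨fun hh => absurd (IsCh_sub' hS h _ hh) hj, fun hh => absurd (IsCh_sub' hS h _ hh) hj⟩
  · rfl

lemma ofE_row (h : IsCh n n S c) (i : ℕ) (h1 : 1 ≤ i) (h2 : i ≤ n) :
    (∀ m ≤ 2*n-2*i+1, ∑ j ∈ Ico i (i+m), ofE n c i j = 0 ∨ ∑ j ∈ Ico i (i+m), ofE n c i j = 1) ∧
    ∑ j ∈ Ico i (i+(2*n-2*i+1)), ofE n c i j = 1 := by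
  have hr := h.row (i-1) (by omega)
  have e : i - 1 + 1 = i := by omega
  rw [e] at hr
  have := (prefR_iff _ _ _ _ _ (Or.inl rfl)).mp hr.2
  have e2 : ∀ j, ofE n c i j = indz (c i) j - indz (c (i-1)) j := by
    intro j; rw [ofE, if_pos ⟨h1, h2⟩]
  simp only [e2]
  simpa only [zero_add] using this

lemma ofE_row_pfx (hS : S ⊆ Ico 1 (2*n)) (h : IsCh n n S c) (i k : ℕ) :
    ∑ j ∈ range k, ofE n c i j = 0 ∨ ∑ j ∈ range k, ofE n c i j = 1 := by
  by_cases hi : 1 ≤ i ∧ i ≤ n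
  · obtain ⟨h1, h2⟩ := ofE_row h i hi.1 hi.2
    have e : ∀ m ≤ 2*n-2*i+1, k ≤ i → ∑ j ∈ range k, ofE n c i j = 0 := by
      intro m _ hk
      apply sum_eq_zero
      intro j hj
      apply ofE_out hS h
      simp at hj; omega
    rcases Nat.lt_or_ge k i with h3 | h3
    · left; exact e 0 (by omega) h3.le
    · rcases Nat.lt_or_ge k (i+(2*n-2*i+1)) with h4 | h4
      · have := h1 (k - i) (by omega)
        rw [show i + (k-i) = k by omega] at this
        have e2 : ∑ j ∈ range k, ofE n c i j = ∑ j ∈ Ico i k, ofE n c i j := by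
          symm
          apply sum_subset
          · intro x; simp
          · intro x h1 h2
            apply ofE_out hS h
            simp at h1 h2; omega
        rw [e2]; exact this
      · right
        rw [← h2]
        symm
        apply sum_subset
        · intro x; simp; omega
        · intro x h1 h2
          apply ofE_out hS h
          simp at h1 h2; omega
  · left
    apply sum_eq_zero
    intro j _
    rw [ofE, if_neg hi]

def ofCh (hS : S ⊆ Ico 1 (2*n)) (h : IsCh n n S c) : AST n where
  entry := ofE n c
  support := by
    intro i j hij
    by_contra hc
    exact hij (ofE_out hS h hc)
  entries := fun i j => (pfx_alt (fun j => ofE n c i j) (ofE_row_pfx hS h i)).1 j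
  rowSum := by
    intro i h1 h2
    rw [← (ofE_row h i h1 h2).2]
    apply sum_congr _ (fun _ _ => rfl)
    ext x; simp; omega
  altRow := fun i => (pfx_alt (fun j => ofE n c i j) (ofE_row_pfx hS h i)).2.1
  altCol := fun j => (pfx_alt (fun i => ofE n c i j) (fun k => ofE_col' h k j)).2.1
  topOne := fun i j => (pfx_alt (fun i => ofE n c i j) (fun k => ofE_col' h k j)).2.2 i

lemma toCh_ofCh (hS : S ⊆ Ico 1 (2*n)) (h : IsCh n n S c) : toCh (ofCh hS h) = c := by
  funext k
  by_cases hk : k ≤ n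
  · ext j
    apply indz_eq
    rw [indz_toCh _ _ _ hk]
    exact ofE_col h k j hk
  · rw [h.out k (by omega), toCh, if_neg hk]

lemma AST_ext' {T T' : AST n} (h : T.entry = T'.entry) : T = T' := by
  cases T; cases T'; simp at h; simp [h]

lemma toCh_injective : Function.Injective (toCh (n := n)) := by
  intro T T' h
  apply AST_ext'
  funext i j
  by_cases hi : 1 ≤ i ∧ i ≤ n
  · obtain ⟨k, rfl⟩ : ∃ k', i = k'+1 := ⟨i-1, by omega⟩
    rw [entry_toCh T k j hi.2, entry_toCh T' k j hi.2, h]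
  · rw [AST_out T (by omega), AST_out T' (by omega)]

end ofChain
end ASPaux

namespace ASPaux
section stat
variable {n : ℕ} (T : AST n)

lemma colSum_eq (j : ℕ) : T.colSum j = indz (toCh T n) j := by
  rw [indz_toCh T n j le_rfl, AST.colSum]
  apply sum_subset
  · intro x; simp
  · intro x _ hx
    apply AST_out
    simp at hx; omega

lemma mem_toCh_stable (j i k : ℕ) (hj : j ∈ Ico 1 (2*n)) (hik : i ≤ k) (hk : k ≤ n) (h : min j (2*n-j) ≤ i) :
    j ∈ toCh T k ↔ j ∈ toCh T i := by
  induction k, hik using Nat.le_induction with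
  | base => rfl
  | succ k hk' ih =>
    rw [← ih (by omega)]
    refine ((toCh_IsCh T).row k (by omega)).1 j hj ?_
    rw [mem_Ico] at hj
    omega

lemma isOneCol_iff (j : ℕ) : T.IsOneCol j ↔ j ∈ toCh T n := by
  rw [AST.IsOneCol, colSum_eq, indz]
  split_ifs with h <;> simp [h]

lemma eleven_iff (k : ℕ) (hk : k + 1 < n) : T.IsElevenCol (k+1) ↔ (k+1 ∈ toCh T (k+1) ∧ k+1 ∉ toCh T k) := by
  have h1 := isOneCol_iff T (k+1)
  rw [mem_toCh_stable T (k+1) (k+1) n (by rw [mem_Ico]; omega) (by omega) le_rfl (by omega)] at h1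
  rw [AST.IsElevenCol, ← AST.IsOneCol, h1, AST.bottom, show min (k+1) (2*n-(k+1)) = k+1 by omega,
    entry_toCh T k _ (by omega)]
  simp only [indz]
  split_ifs <;> simp_all

lemma ten_iff (k : ℕ) (hk : k + 1 < n) : T.IsTenCol (2*n-(k+1)) ↔ (2*n-(k+1) ∈ toCh T (k+1) ∧ 2*n-(k+1) ∈ toCh T k) := by
  have h1 := isOneCol_iff T (2*n-(k+1))
  rw [mem_toCh_stable T _ (k+1) n (by rw [mem_Ico]; omega) (by omega) le_rfl (by omega)] at h1
  rw [AST.IsTenCol, ← AST.IsOneCol, h1, AST.bottom, show min (2*n-(k+1)) (2*n-(2*n-(k+1))) = k+1 by omega,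
    entry_toCh T k _ (by omega)]
  simp only [indz]
  split_ifs <;> simp_all

lemma prod_wt {K : Type*} [CommRing K] (t : K) (hn : 1 ≤ n) :
    ∏ k ∈ range n, wt t n (k+1) (toCh T (k+1)) (toCh T k) = t ^ (T.rho - 1) := by
  obtain ⟨N, rfl⟩ : ∃ N, n = N+1 := ⟨n-1, by omega⟩
  have e : T.rho - 1 = ((Icc 1 N).filter T.IsElevenCol).card
    + ((Icc (N + 2) (2 * (N+1) - 1)).filter T.IsTenCol).card := by
    rw [AST.rho]; simp only [Nat.add_sub_cancel]; rw [add_assoc, Nat.add_sub_cancel_left]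
  rw [e, pow_add, prod_range_succ, wt, if_pos rfl, mul_one]
  have h1 : ∀ k ∈ range N, wt t (N+1) (k+1) (toCh T (k+1)) (toCh T k) =
      (if T.IsElevenCol (k+1) then t else 1) * (if T.IsTenCol (2*(N+1)-(k+1)) then t else 1) := by
    intro k hk
    rw [mem_range] at hk
    rw [wt, if_neg (by omega)]
    congr 1
    · simp only [eleven_iff T k (by omega)]
      split_ifs <;> simp_all
    · simp only [ten_iff T k (by omega)]
      split_ifs <;> simp_all
  rw [prod_congr rfl h1, prod_mul_distrib, card_filter, card_filter, ← prod_pow_eq_pow_sum, ← prod_pow_eq_pow_sum]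
  congr 1
  · refine prod_nbij' (fun k => k+1) (fun k => k-1) ?_ ?_ ?_ ?_ ?_
    · intro k; simp
    · intro k; simp; omega
    · intro k; simp
    · intro k; simp; omega
    · intro k _; split_ifs <;> simp
  · refine prod_nbij' (fun k => 2*(N+1)-(k+1)) (fun k => 2*(N+1)-k-1) ?_ ?_ ?_ ?_ ?_
    · intro k; simp; omega
    · intro k; simp; omega
    · intro k; simp; omega
    · intro k; simp; omega
    · intro k _; split_ifs <;> simp
end stat

def goodS (n l r : ℕ) (S : Finset ℕ) : Prop := ∀ j ∈ S, j ≠ n → l ≤ AST.label n j ∧ AST.label n j ≤ r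

lemma isASP_iff {n : ℕ} (T : AST n) (l r : ℕ) : T.IsASP l r ↔ goodS n l r (toCh T n) := by
  unfold AST.IsASP goodS
  constructor
  · intro h j hj hjn
    have := toCh_sub T n hj
    rw [mem_Ico] at this
    exact h j this.1 (by omega) hjn ((isOneCol_iff T j).mpr hj)
  · intro h j h1 h2 hjn hj
    exact h j ((isOneCol_iff T j).mp hj) hjn

lemma rho_pos {n : ℕ} (T : AST n) : 1 ≤ T.rho := by rw [AST.rho]; omega

open Classical in
lemma card_eq_Zf (n l r p : ℕ) (hn : 1 ≤ n) (hp : 1 ≤ p) :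
    (Nat.card {P : AST n // P.IsASP l r ∧ P.rho = p} : ℤ) =
    (∑ S ∈ (Ico 1 (2*n)).powerset.filter (goodS n l r), Zf (Polynomial.X : Polynomial ℤ) n n S).coeff (p-1) := by
  set A := ((Ico 1 (2*n)).powerset.filter (goodS n l r)).biUnion (fun S => Ch n n S) with hA
  have hd : ((((Ico 1 (2*n)).powerset.filter (goodS n l r)) : Finset (Finset ℕ)) : Set (Finset ℕ)).PairwiseDisjoint (fun S => Ch n n S) := by
    intro S1 _ S2 _ hne
    rw [Function.onFun, disjoint_left]
    intro c h1 h2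
    rw [mem_Ch] at h1 h2
    exact hne (h1.last.symm.trans h2.last)
  have hmem : ∀ c, c ∈ A ↔ ∃ T : AST n, T.IsASP l r ∧ toCh T = c := by
    intro c
    rw [hA, mem_biUnion]
    constructor
    · rintro ⟨S, hS, hc⟩
      rw [mem_Ch] at hc
      rw [mem_filter, mem_powerset] at hS
      refine ⟨ofCh hS.1 hc, ?_, toCh_ofCh _ _⟩
      rw [isASP_iff, toCh_ofCh, hc.last]; exact hS.2
    · rintro ⟨T, hT, rfl⟩
      refine ⟨toCh T n, ?_, ?_⟩
      · rw [mem_filter, mem_powerset]; exact ⟨toCh_sub T n, (isASP_iff T l r).mp hT⟩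
      · rw [mem_Ch]; exact toCh_IsCh T
  have e1 : ∑ S ∈ (Ico 1 (2*n)).powerset.filter (goodS n l r), Zf (Polynomial.X : Polynomial ℤ) n n S =
      ∑ c ∈ A, ∏ k ∈ range n, wt (Polynomial.X : Polynomial ℤ) n (k+1) (c (k+1)) (c k) := by
    rw [hA, sum_biUnion hd]
    exact sum_congr rfl fun S _ => Zf_eq_sum_Ch _ _ _ _
  rw [e1, Polynomial.finsetSum_coeff]
  let B := A.filter (fun c => ∃ T : AST n, toCh T = c ∧ T.rho = p)
  have e2 : ∑ c ∈ A, (∏ k ∈ range n, wt (Polynomial.X : Polynomial ℤ) n (k+1) (c (k+1)) (c k)).coeff (p-1) = (B.card : ℤ) := by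
    rw [card_filter]
    push_cast
    refine sum_congr rfl fun c hc => ?_
    obtain ⟨T, hT, rfl⟩ := (hmem c).mp hc
    rw [prod_wt T _ hn, Polynomial.coeff_X_pow]
    have := rho_pos T
    have h3 : (∃ T' : AST n, toCh T' = toCh T ∧ T'.rho = p) ↔ p - 1 = T.rho - 1 := by
      constructor
      · rintro ⟨T', h1, h2⟩
        rw [← toCh_injective h1, h2]
      · intro h
        exact ⟨T, rfl, by omega⟩
    simp only [h3]
  rw [e2]
  have h4 : Nat.card {P : AST n // P.IsASP l r ∧ P.rho = p} = Nat.card B := by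
    apply Nat.card_eq_of_bijective (fun P => (⟨toCh P.1, by
      rw [mem_filter]
      exact ⟨(hmem _).mpr ⟨P.1, P.2.1, rfl⟩, P.1, rfl, P.2.2⟩⟩ : B))
    constructor
    · intro P Q h
      have := congrArg Subtype.val h
      exact Subtype.ext (toCh_injective this)
    · rintro ⟨c, hc⟩
      have hc' := mem_filter.mp hc
      obtain ⟨T, hT, rfl⟩ := (hmem c).mp hc'.1
      obtain ⟨T', h1, h2⟩ := hc'.2
      refine ⟨⟨T, hT, ?_⟩, rfl⟩
      rw [← toCh_injective h1]; exact h2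
  rw [h4]
  simp

open Classical in
lemma sum_Zf_eq (n l r : ℕ) (hn : 1 ≤ n) :
    ∑ S ∈ (Ico 1 (2*n)).powerset.filter (goodS n l r), Zf (Polynomial.X : Polynomial ℤ) n n S =
    ∑ S ∈ ((Ico 1 (2*n)).erase n).powerset.filter (fun S => goodS n l r S ∧ S.card = n-1),
      Tl 0 ((LL S 1 (2*n-1)).map (GG (Polynomial.X : Polynomial ℤ) n (n-1))) := by
  have hlen : ∀ S ⊆ Ico 1 (2*n), (LL S 1 (2*n-1)).length = S.card := by
    intro S hS
    have h1 : (LL S 1 (2*n-1)).Nodup := (LL_sorted S 1 (2*n-1)).imp (fun h => ne_of_lt h)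
    rw [← List.toFinset_card_of_nodup h1]
    congr 1
    ext x
    rw [List.mem_toFinset, mem_LL]
    constructor
    · exact fun h => h.2
    · intro h
      have := mem_Ico.mp (hS h)
      exact ⟨by omega, h⟩
  have hs : ∀ S ∈ (Ico 1 (2*n)).powerset.filter (goodS n l r), Zf (Polynomial.X : Polynomial ℤ) n n S =
      if n ∈ S then Zf (Polynomial.X : Polynomial ℤ) n (n-1) (S.erase n) else 0 := by
    intro S hS
    rw [mem_filter, mem_powerset] at hS
    split_ifs with h
    · exact Zf_last _ n hn S hS.1 h
    · exact Zf_last' _ n hn S h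
  rw [sum_congr rfl hs]
  have : ∀ S ∈ ((Ico 1 (2*n)).erase n).powerset.filter (goodS n l r), Zf (Polynomial.X : Polynomial ℤ) n (n-1) S =
      if S.card = n-1 then Tl 0 ((LL S 1 (2*n-1)).map (GG (Polynomial.X : Polynomial ℤ) n (n-1))) else 0 := by
    intro S hS
    rw [mem_filter, mem_powerset] at hS
    have hS' := hS.1.trans (erase_subset _ _)
    rw [Zf_eq _ n (n-1) (by omega) S hS', hlen S hS']
  have e3 : ∑ S ∈ ((Ico 1 (2*n)).erase n).powerset.filter (fun S => goodS n l r S ∧ S.card = n-1),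
      Tl 0 ((LL S 1 (2*n-1)).map (GG (Polynomial.X : Polynomial ℤ) n (n-1))) =
      ∑ S ∈ ((Ico 1 (2*n)).erase n).powerset.filter (goodS n l r), Zf (Polynomial.X : Polynomial ℤ) n (n-1) S := by
    rw [← filter_filter, sum_congr rfl this, ← sum_filter]
  rw [e3, ← sum_filter]
  refine sum_nbij' (fun S => S.erase n) (fun S => insert n S) ?_ ?_ ?_ ?_ ?_
  · intro S hS
    simp only [mem_filter, mem_powerset] at hS ⊢
    refine ⟨erase_subset_erase _ hS.1.1, ?_⟩
    intro j hj
    exact hS.1.2 j (mem_of_mem_erase hj)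
  · intro S hS
    simp only [mem_filter, mem_powerset] at hS ⊢
    refine ⟨⟨?_, ?_⟩, mem_insert_self _ _⟩
    · apply insert_subset
      · rw [mem_Ico]; omega
      · exact hS.1.trans (erase_subset _ _)
    · intro j hj hjn
      exact hS.2 j (mem_of_mem_insert_of_ne hj hjn) hjn
  · intro S hS
    simp only [mem_filter] at hS
    exact insert_erase hS.2
  · intro S hS
    simp only [mem_filter, mem_powerset] at hS
    apply erase_insert
    intro h
    exact absurd (hS.1 h) (notMem_erase _ _)
  · intro S _; rfl
end ASPaux

namespace ASPaux

section nil
variable {R : Type*} [CommRing R] {N : ℕ}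

lemma vand_nil' (y : Fin N → R) (hy : ∀ i, y i ^ N = 0) (U : R) :
    (∏ i, (1 + y i * U)) * pairProd (fun i j => y j - y i) = pairProd (fun i j => y j - y i) := by
  rw [pairProd_Ioi, ← Matrix.det_vandermonde, ← Matrix.det_mul_column]
  set B : Matrix (Fin N) (Fin N) R := Matrix.of fun j k => if j = k then 1 else if (j:ℕ) = k + 1 then U else 0 with hB
  have hdet : B.det = 1 := by
    rw [Matrix.det_of_lowerTriangular]
    · simp [hB]
    · intro i j hij
      have hij' : i < j := hij
      have : (i:ℕ) < j := hij'
      simp only [hB, Matrix.of_apply]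
      rw [if_neg (by intro h; subst h; exact lt_irrefl _ this), if_neg (by omega)]
  have e : (Matrix.of fun i j => (1 + y i * U) * Matrix.vandermonde y i j) = Matrix.vandermonde y * B := by
    ext i k
    rw [Matrix.mul_apply]
    simp only [Matrix.of_apply, Matrix.vandermonde_apply, hB]
    have h1 : ∀ j : Fin N, y i ^ (j:ℕ) * (if j = k then 1 else if (j:ℕ) = k + 1 then U else 0) =
        (if j = k then y i ^ (k:ℕ) else 0) + (if (j:ℕ) = k+1 then U * y i ^ ((k:ℕ)+1) else 0) := by
      intro j
      by_cases h : j = k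
      · subst h; simp
      · by_cases h2 : (j:ℕ) = k+1
        · simp only [h, h2, if_true, if_false]; ring
        · simp [h, h2]
    simp_rw [h1]
    rw [sum_add_distrib, sum_ite_eq' univ k]
    simp only [mem_univ, if_true]
    have h2 : ∑ j : Fin N, (if (j:ℕ) = k+1 then U * y i ^ ((k:ℕ)+1) else 0) = U * y i ^ ((k:ℕ)+1) := by
      by_cases hk : (k:ℕ) + 1 < N
      · rw [Fintype.sum_eq_single (⟨k+1, hk⟩ : Fin N)]
        · simp
        · intro j hj
          rw [if_neg]
          intro h; exact hj (Fin.ext h)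
      · have : (k:ℕ) + 1 = N := by have := k.2; omega
        rw [this, hy, mul_zero]
        simp
    rw [h2]; ring
  rw [e, Matrix.det_mul, hdet, mul_one]

lemma vand_nil (x : Fin N → R) (hx : ∀ i, x i ^ N = 0) (U : R) :
    (∏ i, (1 + x i * U)) * pairProd (fun i j => x i - x j) = pairProd (fun i j => x i - x j) := by
  have := vand_nil' (fun i => - x i) (fun i => by rw [neg_pow, hx, mul_zero]) (-U)
  simpa [sub_eq_add_neg, add_comm] using this

variable (x v : Fin N → R)

lemma nil_c (hx : ∀ i, x i ^ N = 0) (i : Fin N) : (∏ j, (1 + x j + x i * x j)) * pairProd (fun i j => x i - x j) = pairProd (fun i j => x i - x j) := by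
  have := vand_nil x hx (1 + x i)
  have e : ∀ j, 1 + x j + x i * x j = 1 + x j * (1 + x i) := fun j => by ring
  simp_rw [e]
  exact this

lemma nil_a (hx : ∀ i, x i ^ N = 0) (hv : ∀ i, (1 + x i) * v i = 1) (i : Fin N) : (∏ j, (1 + x i + x i * x j)) * pairProd (fun i j => x i - x j) =
    (1 + x i)^N * pairProd (fun i j => x i - x j) := by
  have := vand_nil x hx (x i * v i)
  have e : ∀ j, 1 + x i + x i * x j = (1 + x i) * (1 + x j * (x i * v i)) := by
    intro j
    have := hv i
    linear_combination (- x i * x j) * this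
  simp_rw [e]
  rw [prod_mul_distrib, prod_const, card_univ, Fintype.card_fin, mul_assoc, this]

lemma absorb_prod {ι : Type*} (s : Finset ι) (f g : ι → R) (D : R) (h : ∀ i ∈ s, f i * D = g i * D) :
    (∏ i ∈ s, f i) * D = (∏ i ∈ s, g i) * D := by
  classical
  induction s using Finset.induction_on with
  | empty => rfl
  | insert a s ha ih =>
    rw [prod_insert ha, prod_insert ha]
    have h1 := ih (fun i hi => h i (mem_insert_of_mem hi))
    have h2 := h a (mem_insert_self _ _)
    linear_combination (f a) * h1 + (∏ i ∈ s, g i) * h2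

lemma swap_LR (hx : ∀ i, x i ^ N = 0) (hv : ∀ i, (1 + x i) * v i = 1) (L : Finset (Fin N)) :
    (∏ i ∈ L, ∏ j ∈ Lᶜ, (1 + x j + x i * x j)) * pairProd (fun i j => x i - x j) =
    (∏ i ∈ L, v i ^ N) * (∏ i ∈ L, ∏ j ∈ Lᶜ, (1 + x i + x i * x j)) * pairProd (fun i j => x i - x j) := by
  set D := pairProd (fun i j => x i - x j)
  set P := ∏ i ∈ L, ∏ j ∈ Lᶜ, (1 + x j + x i * x j)
  set A := ∏ i ∈ L, ∏ j ∈ Lᶜ, (1 + x i + x i * x j)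
  set Q := ∏ i ∈ L, ∏ j ∈ L, (1 + x j + x i * x j) with hQ
  have hQ' : Q = ∏ i ∈ L, ∏ j ∈ L, (1 + x i + x i * x j) := by
    rw [hQ, prod_comm]
    refine prod_congr rfl fun i _ => prod_congr rfl fun j _ => by ring
  have h1 : Q * P * D = D := by
    have := absorb_prod L (fun i => ∏ j, (1 + x j + x i * x j)) (fun _ => 1) D
      (fun i _ => by rw [one_mul]; exact nil_c x hx i)
    rw [prod_const_one, one_mul] at this
    rw [hQ, ← prod_mul_distrib]
    simp_rw [prod_mul_prod_compl]
    exact this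
  have h2 : Q * A * D = (∏ i ∈ L, (1 + x i)^N) * D := by
    have := absorb_prod L (fun i => ∏ j, (1 + x i + x i * x j)) (fun i => (1 + x i)^N) D
      (fun i _ => nil_a x v hx hv i)
    rw [hQ', ← prod_mul_distrib]
    simp_rw [prod_mul_prod_compl]
    exact this
  have h3 : (∏ i ∈ L, v i ^ N) * (∏ i ∈ L, (1 + x i)^N) = 1 := by
    rw [← prod_mul_distrib]
    apply prod_eq_one
    intro i _
    rw [← mul_pow, mul_comm, hv, one_pow]
  calc P * D = P * ((∏ i ∈ L, v i ^ N) * (∏ i ∈ L, (1 + x i)^N)) * D := by rw [h3, mul_one]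
    _ = P * (∏ i ∈ L, v i ^ N) * (Q * A * D) := by rw [h2]; ring
    _ = (∏ i ∈ L, v i ^ N) * A * (Q * P * D) := by ring
    _ = _ := by rw [h1]

lemma pairProd_split (L : Finset (Fin N)) (hL : ∀ i ∈ L, ∀ j ∉ L, i < j) (f : Fin N → Fin N → R) :
    pairProd f = pairProd (fun i j => if i ∈ L ∧ j ∉ L then 1 else f i j) * ∏ i ∈ L, ∏ j ∈ Lᶜ, f i j := by
  have e : ∏ i ∈ L, ∏ j ∈ Lᶜ, f i j = pairProd (fun i j => if i ∈ L ∧ j ∉ L then f i j else 1) := by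
    unfold pairProd
    rw [← prod_filter_mul_prod_filter_not univ (fun i => i ∈ L)]
    rw [prod_eq_one (s := univ.filter (fun i => i ∉ L))]
    · rw [mul_one, filter_mem_eq_inter, univ_inter]
      refine prod_congr rfl fun i hi => ?_
      rw [← prod_filter_mul_prod_filter_not univ (fun i => i ∈ L)]
      rw [prod_eq_one (s := univ.filter (fun i => i ∈ L)), one_mul]
      · refine prod_congr (by ext j; simp) fun j hj => ?_
        simp at hj
        simp [hi, hj, hL i hi j hj]
      · intro j hj
        simp at hj
        simp [hj]
    · intro i hi
      simp at hi
      simp [hi]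
  rw [e, ← pairProd_mul]
  congr 1
  funext i j
  split_ifs <;> simp

lemma swap_full (hx : ∀ i, x i ^ N = 0) (hv : ∀ i, (1 + x i) * v i = 1) (L : Finset (Fin N)) (hL : ∀ i ∈ L, ∀ j ∉ L, i < j) (q : Fin N → ℕ) (hq : ∀ i ∈ L, q i < N) :
    (∏ i ∈ L, (1 + x i)^(q i+1)) * (∏ i ∈ Lᶜ, (1 + x i)^(N+1)) * pairProd (fun i j => 1 + x j + x i * x j) * pairProd (fun i j => x i - x j) =
    (∏ i ∈ L, v i^(2*N - q i)) * pairProd (fun i j => if i ∈ L ∧ j ∉ L then 1 + x i + x i * x j else 1 + x j + x i * x j) * pairProd (fun i j => x i - x j) := by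
  rw [pairProd_split L hL (fun i j => 1 + x j + x i * x j), pairProd_split L hL (fun i j => if i ∈ L ∧ j ∉ L then 1 + x i + x i * x j else 1 + x j + x i * x j)]
  have e1 : pairProd (fun i j => if i ∈ L ∧ j ∉ L then (1:R) else if i ∈ L ∧ j ∉ L then 1 + x i + x i * x j else 1 + x j + x i * x j) =
     pairProd (fun i j => if i ∈ L ∧ j ∉ L then (1:R) else 1 + x j + x i * x j) := by
    congr 1; funext i j; split_ifs <;> rfl
  have e2 : ∏ i ∈ L, ∏ j ∈ Lᶜ, (if i ∈ L ∧ j ∉ L then 1 + x i + x i * x j else 1 + x j + x i * x j) = ∏ i ∈ L, ∏ j ∈ Lᶜ, (1 + x i + x i * x j) := by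
    refine prod_congr rfl fun i hi => prod_congr rfl fun j hj => ?_
    rw [if_pos ⟨hi, mem_compl.mp hj⟩]
  rw [e1, e2]
  have hsw := swap_LR x v hx hv L
  have h1 := vand_nil x hx 1
  set D := pairProd (fun i j => x i - x j)
  set P := ∏ i ∈ L, ∏ j ∈ Lᶜ, (1 + x j + x i * x j)
  set A := ∏ i ∈ L, ∏ j ∈ Lᶜ, (1 + x i + x i * x j)
  set W := pairProd (fun i j => if i ∈ L ∧ j ∉ L then (1:R) else 1 + x j + x i * x j)
  simp only [mul_one] at h1
  have h2 : (∏ i ∈ Lᶜ, (1 + x i)^(N+1)) * D = (∏ i ∈ L, v i^(N+1)) * D := by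
    have h3 : (∏ i, (1 + x i)^(N+1)) * D = D := by
      rw [prod_pow]
      generalize N+1 = M
      induction M with
      | zero => simp
      | succ M ih => rw [pow_succ, mul_assoc, h1, ih]
    rw [← prod_mul_prod_compl L] at h3
    have h4 : (∏ i ∈ L, v i ^ (N+1)) * (∏ i ∈ L, (1 + x i)^(N+1)) = 1 := by
      rw [← prod_mul_distrib]
      apply prod_eq_one
      intro i _
      rw [← mul_pow, mul_comm, hv, one_pow]
    linear_combination (∏ i ∈ L, v i ^ (N+1)) * h3 - (∏ i ∈ Lᶜ, (1 + x i)^(N+1)) * D * h4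
  have h5 : (∏ i ∈ L, (1 + x i)^(q i+1)) * (∏ i ∈ L, v i^(N+1)) * (∏ i ∈ L, v i^N) = ∏ i ∈ L, v i^(2*N - q i) := by
    rw [← prod_mul_distrib, ← prod_mul_distrib]
    refine prod_congr rfl fun i hi => ?_
    have := hq i hi
    obtain ⟨b, hb⟩ : ∃ b, N = q i + b := ⟨N - q i, by omega⟩
    have e : v i ^(N+1) = v i^(q i+1) * v i^b := by rw [← pow_add]; congr 1; omega
    have e' : v i ^(2*N - q i) = v i^N * v i^b := by rw [← pow_add]; congr 1; omega
    have e3 : (1 + x i)^(q i + 1) * v i^(q i+1) = 1 := by rw [← mul_pow, hv, one_pow]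
    rw [e, e']
    linear_combination v i ^ b * v i ^ N * e3
  rw [← h5]
  linear_combination (∏ i ∈ L, (1 + x i)^(q i+1)) * W * P * h2 + (∏ i ∈ L, (1 + x i)^(q i+1)) * W * (∏ i ∈ L, v i^(N+1)) * hsw
end nil
end ASPaux

namespace ASPaux
open MvPolynomial

lemma pairProd_congr {R : Type*} [CommRing R] {N : ℕ} {f g : Fin N → Fin N → R} (h : ∀ i j, i < j → f i j = g i j) :
    pairProd f = pairProd g := by
  unfold pairProd
  refine prod_congr rfl fun i _ => prod_congr rfl fun j _ => ?_
  split_ifs with hij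
  · exact h i j hij
  · rfl

lemma pairProd_dd {R : Type*} [CommRing R] {N : ℕ} (y : Fin N → R) :
    pairProd (fun i j => y i * y j) = ∏ i, y i ^ (N-1) := by
  rw [pairProd_mul]
  have e2 : pairProd (fun _ j => y j) = ∏ i, ∏ j, if j < i then y i else 1 := by
    unfold pairProd
    rw [prod_comm]
  rw [e2]
  unfold pairProd
  rw [← prod_mul_distrib]
  refine prod_congr rfl fun i _ => ?_
  rw [← prod_filter, ← prod_filter, prod_const, prod_const, ← pow_add]
  congr 1
  rw [show univ.filter (fun j => i < j) = Ioi i by ext; simp, show univ.filter (fun j => j < i) = Iio i by ext; simp,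
    Fin.card_Ioi, Fin.card_Iio]
  have := i.2; omega

section hom
variable {K : Type*} [CommRing K] 

noncomputable def FP (t : K) (N : ℕ) : MvPolynomial (Fin N) K :=
  (∏ i, (C t + X i)) * pairProd (fun i j => 1 + X i + X i * X j) * pairProd (fun i j => X j - X i)

lemma degreeOf_pairProd_le [Nontrivial K] {N : ℕ} (f : Fin N → Fin N → MvPolynomial (Fin N) K) (i : Fin N)
    (h : ∀ a b, a < b → degreeOf i (f a b) ≤ (if a = i then 1 else 0) + (if b = i then 1 else 0)) :
    degreeOf i (pairProd f) ≤ N - 1 := by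
  unfold pairProd
  have h1 : degreeOf i (∏ a, ∏ b, if a < b then f a b else 1) ≤
      ∑ a : Fin N, ∑ b : Fin N, ((if a = i ∧ a < b then 1 else 0) + (if b = i ∧ a < b then 1 else 0)) := by
    refine (degreeOf_prod_le _ _ _).trans (sum_le_sum fun a _ => (degreeOf_prod_le _ _ _).trans (sum_le_sum fun b _ => ?_))
    by_cases hab : a < b
    · simpa [hab] using h a b hab
    · simp [hab]
  refine h1.trans ?_
  simp_rw [sum_add_distrib]
  have e1 : ∑ a : Fin N, ∑ b : Fin N, (if a = i ∧ a < b then 1 else 0) = (Ioi i).card := by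
    rw [Fintype.sum_eq_single i]
    · rw [card_eq_sum_ones, ← filter_lt_eq_Ioi, sum_filter]; simp
    · intro a ha; simp [ha]
  have e2 : ∑ a : Fin N, ∑ b : Fin N, (if b = i ∧ a < b then 1 else 0) = (Iio i).card := by
    rw [sum_comm, Fintype.sum_eq_single i]
    · rw [card_eq_sum_ones, ← filter_gt_eq_Iio, sum_filter]; simp
    · intro a ha; simp [ha]
  rw [e1, e2, Fin.card_Ioi, Fin.card_Iio]
  have := i.2; omega

lemma degreeOf_X_le' [Nontrivial K] {N : ℕ} (i a : Fin N) : degreeOf i (X a : MvPolynomial (Fin N) K) = (if a = i then 1 else 0) := by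
  rw [degreeOf_X]; simp [eq_comm]

lemma FP_deg [Nontrivial K] (t : K) (N : ℕ) (i : Fin N) : degreeOf i (FP t N) ≤ 2*N-1 := by
  unfold FP
  have h1 : degreeOf i (∏ j, (C t + X j : MvPolynomial (Fin N) K)) ≤ 1 := by
    refine (degreeOf_prod_le _ _ _).trans ?_
    calc _ ≤ ∑ j : Fin N, (if j = i then 1 else 0) := by
          refine sum_le_sum fun j _ => (degreeOf_add_le _ _ _).trans ?_
          rw [degreeOf_C, degreeOf_X_le']; simp
      _ = 1 := by simp
  have h2 : degreeOf i (pairProd (fun i j => (1 + X i + X i * X j : MvPolynomial (Fin N) K))) ≤ N-1 := by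
    apply degreeOf_pairProd_le
    intro a b _
    refine (degreeOf_add_le _ _ _).trans (max_le ((degreeOf_add_le _ _ _).trans (max_le ?_ ?_)) ((degreeOf_mul_le _ _ _).trans ?_))
    · simp
    · rw [degreeOf_X_le']; simp
    · rw [degreeOf_X_le', degreeOf_X_le']
  have h3 : degreeOf i (pairProd (fun i j => (X j - X i : MvPolynomial (Fin N) K))) ≤ N-1 := by
    apply degreeOf_pairProd_le
    intro a b _
    rw [sub_eq_add_neg]
    refine (degreeOf_add_le _ _ _).trans (max_le ?_ ?_)
    · rw [degreeOf_X_le']; simp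
    · rw [degreeOf_neg, degreeOf_X_le']; simp
  have := i.2
  have h4 := degreeOf_mul_le i (∏ j, (C t + X j : MvPolynomial (Fin N) K)) (pairProd (fun i j => (1 + X i + X i * X j : MvPolynomial (Fin N) K)))
  have h5 := degreeOf_mul_le i ((∏ j, (C t + X j : MvPolynomial (Fin N) K)) * (pairProd (fun i j => (1 + X i + X i * X j : MvPolynomial (Fin N) K)))) (pairProd (fun i j => (X j - X i : MvPolynomial (Fin N) K)))
  omega

lemma FP_hom [IsDomain K] (t : K) (N : ℕ) (nn dd : Fin N → MvPolynomial (Fin N) K) (hd : ∀ i, dd i ≠ 0) :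
    ∑ m ∈ (FP t N).support, C (coeff m (FP t N)) * ∏ i, (nn i ^ (m i) * dd i ^ (2*N-1 - m i)) =
    (∏ i, (C t * dd i + nn i)) * pairProd (fun i j => dd i * dd j + nn i * dd j + nn i * nn j) *
      pairProd (fun i j => nn j * dd i - nn i * dd j) := by
  let ι := algebraMap (MvPolynomial (Fin N) K) (FractionRing (MvPolynomial (Fin N) K))
  have hι : Function.Injective ι := IsFractionRing.injective _ _
  apply hι
  have hd' : ∀ i, ι (dd i) ≠ 0 := fun i => by
    rw [Ne, map_eq_zero_iff _ hι]; exact hd i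
  set y : Fin N → FractionRing (MvPolynomial (Fin N) K) := fun i => ι (nn i) / ι (dd i) with hy
  have hyd : ∀ i, y i * ι (dd i) = ι (nn i) := fun i => div_mul_cancel₀ _ (hd' i)
  have e1 : ι (∑ m ∈ (FP t N).support, C (coeff m (FP t N)) * ∏ i, (nn i ^ (m i) * dd i ^ (2*N-1 - m i))) =
      eval₂ (ι.comp C) y (FP t N) * ∏ i, ι (dd i) ^ (2*N-1) := by
    rw [eval₂_eq', map_sum, sum_mul]
    refine sum_congr rfl fun m hm => ?_
    rw [map_mul, map_prod, mul_assoc, ← prod_mul_distrib, RingHom.comp_apply]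
    congr 1
    refine prod_congr rfl fun i _ => ?_
    have hmi : m i ≤ 2*N-1 := by
      refine le_trans ?_ (FP_deg t N i)
      exact monomial_le_degreeOf i hm
    rw [map_mul, map_pow, map_pow, ← hyd, mul_pow, mul_assoc, ← pow_add]
    congr 3; omega
  rw [e1]
  have e2 : eval₂ (ι.comp C) y (FP t N) = (∏ i, (ι (C t) + y i)) * pairProd (fun i j => 1 + y i + y i * y j) * pairProd (fun i j => y j - y i) := by
    rw [← coe_eval₂Hom, FP, map_mul, map_mul, map_prod, map_pairProd, map_pairProd]
    simp
  have e3 : ∏ i, ι (dd i) ^ (2*N-1) = (∏ i, ι (dd i)) * pairProd (fun i j => ι (dd i) * ι (dd j)) * pairProd (fun i j => ι (dd i) * ι (dd j)) := by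
    rw [pairProd_dd, ← prod_mul_distrib, ← prod_mul_distrib]
    refine prod_congr rfl fun i _ => ?_
    have := i.2
    rw [mul_assoc, ← pow_add, ← pow_succ']
    congr 1; omega
  rw [e2, e3]
  have e4 : ∀ a b c a' b' c' : FractionRing (MvPolynomial (Fin N) K), a * b * c * (a' * b' * c') = (a * a') * (b * b') * (c * c') := by
    intros; ring
  rw [e4, ← prod_mul_distrib, ← pairProd_mul, ← pairProd_mul, map_mul, map_mul, map_prod, map_pairProd, map_pairProd]
  congr 1
  · congr 1
    · refine prod_congr rfl fun i _ => ?_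
      rw [map_add, map_mul, ← hyd]; ring
    · congr 1; funext i j
      simp only [map_add, map_mul, ← hyd]; ring
  · congr 1; funext i j
    simp only [map_sub, map_mul, ← hyd]; ring
end hom

section quot
variable {K : Type*} [CommRing K] 

lemma coeff_gP {N : ℕ} (g : Fin N → Polynomial K) (m : Fin N →₀ ℕ) : coeff m (gP g) = ∏ i, (g i).coeff (m i) := by
  unfold gP
  have e : ∀ i, Polynomial.aeval (X i : MvPolynomial (Fin N) K) (g i) = ∑ k ∈ range ((g i).natDegree + m i + 1), monomial (Finsupp.single i k) ((g i).coeff k) := by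
    intro i
    rw [Polynomial.aeval_eq_sum_range' (n := (g i).natDegree + m i + 1) (by omega)]
    refine sum_congr rfl fun k _ => ?_
    rw [X_pow_eq_monomial, smul_monomial, smul_eq_mul, mul_one]
  simp_rw [e]
  rw [prod_univ_sum, coeff_sum]
  have hsum : ∀ p : Fin N → ℕ, (∑ i, Finsupp.single i (p i)) = Finsupp.equivFunOnFinite.symm p := by
    intro p
    ext a
    rw [Finsupp.finsetSum_apply]
    simp [Finsupp.single_apply]
  simp_rw [← monomial_sum_prod, hsum, coeff_monomial]
  rw [Finset.sum_eq_single (fun i => m i)]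
  · rw [if_pos]; ext i; rfl
  · intro p hp hne
    rw [if_neg]
    intro h
    apply hne
    funext i
    rw [← h]; rfl
  · intro h
    exfalso; apply h
    rw [Fintype.mem_piFinset]
    intro i
    rw [mem_range]; omega

lemma coeff_of_quot {N P : ℕ} (hP : 1 ≤ P) (p p' : MvPolynomial (Fin N) K)
    (h : Ideal.Quotient.mk (Ideal.span (Set.range (fun i : Fin N => (X i : MvPolynomial (Fin N) K)^P))) p = Ideal.Quotient.mk _ p') :
    coeff (cst N (P-1)) p = coeff (cst N (P-1)) p' := by
  rw [Ideal.Quotient.eq] at h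
  rw [← sub_eq_zero, ← coeff_sub]
  rw [Ideal.mem_span_range_iff_exists_fun] at h
  obtain ⟨c, hc⟩ := h
  rw [← hc, coeff_sum]
  apply sum_eq_zero
  intro i _
  rw [X_pow_eq_monomial, coeff_mul_monomial', if_neg]
  intro h
  have := h i
  simp at this
  omega

lemma sign_LR {R : Type*} [CommRing R] {N : ℕ} (L : Finset (Fin N)) (hL : ∀ i ∈ L, ∀ j ∉ L, i < j) :
    pairProd (fun i j => if i ∈ L ∧ j ∉ L then (-1:R) else 1) * ∏ i ∈ L, (-1:R)^(N-1) = 1 := by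
  rw [pairProd_split L hL]
  have e1 : pairProd (fun i j => if i ∈ L ∧ j ∉ L then (1:R) else if i ∈ L ∧ j ∉ L then -1 else 1) = 1 := by
    unfold pairProd
    apply prod_eq_one; intro i _; apply prod_eq_one; intro j _
    simp; tauto
  have e2 : ∏ i ∈ L, ∏ j ∈ Lᶜ, (if i ∈ L ∧ j ∉ L then (-1:R) else 1) = ∏ i ∈ L, (-1)^(N - L.card) := by
    refine prod_congr rfl fun i hi => ?_
    rw [prod_congr rfl (fun j hj => if_pos ⟨hi, mem_compl.mp hj⟩), prod_const, card_compl, Fintype.card_fin]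
  rw [e1, e2, one_mul, ← prod_mul_distrib, prod_const, ← pow_add, ← pow_mul]
  have hc : L.card ≤ N := by simpa using card_le_univ L
  apply Even.neg_one_pow
  rcases Nat.eq_zero_or_pos L.card with h | h
  · rw [h]; simp
  obtain ⟨b, hb⟩ : ∃ b, N = L.card + b := ⟨N - L.card, by omega⟩
  have : (N - L.card + (N-1)) * L.card = 2 * b * L.card + (L.card - 1) * L.card := by
    rw [← add_mul]; congr 1; omega
  rw [this]
  apply Even.add
  · rw [mul_assoc]; exact even_two_mul _
  · have := Nat.even_mul_pred_self L.card
    rwa [mul_comm]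

/-- Left/right one-variable polynomials. -/
noncomputable def hpol (K : Type*) [CommRing K] (N q m : ℕ) : Polynomial K :=
  if q < N then
    if m < q then (-Polynomial.X)^(N-1-(q-m)) * (1 + Polynomial.X)^(q-m-1)
    else if m = q then (-Polynomial.X)^(N-1) else 0
  else Polynomial.X^(q - N + (2*N-1-m))

lemma hpol_coeff (N q m : ℕ) (hN : 1 ≤ N) (hm : m ≤ 2*N-1) :
    (hpol K N q m).coeff (N-1) = if m = q then (if q < N then (-1)^(N-1) else 1) else 0 := by
  unfold hpol
  split_ifs with h1 h2 h3 h4 h5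
  · omega
  · rw [neg_pow, mul_assoc, ← Polynomial.C_1, ← Polynomial.C_neg, ← Polynomial.C_pow, Polynomial.coeff_C_mul, Polynomial.coeff_X_pow_mul']
    rw [if_pos (by omega), Polynomial.C_1, add_comm, Polynomial.coeff_X_add_one_pow, Nat.choose_eq_zero_of_lt (by omega)]
    simp
  · rw [neg_pow, ← Polynomial.C_1, ← Polynomial.C_neg, ← Polynomial.C_pow, Polynomial.coeff_C_mul, Polynomial.coeff_X_pow, if_pos rfl, mul_one]
  · simp
  · rw [Polynomial.coeff_X_pow, if_pos (by omega)]
  · rw [Polynomial.coeff_X_pow, if_neg (by omega)]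

theorem partII [IsDomain K] (t : K) (N : ℕ) (hN : 1 ≤ N) (q : Fin N → ℕ) (hq : StrictMono q) (hq2 : ∀ i, q i < 2*N) :
    Theta 0 (fun i => GG t (N+1) N (if q i < N then q i + 1 else q i + 2)) =
    coeff (Finsupp.equivFunOnFinite.symm q) (FP t N) := by
  set L : Finset (Fin N) := univ.filter (fun i => q i < N) with hLdef
  have hmL : ∀ i, i ∈ L ↔ q i < N := by intro i; simp [hLdef]
  have hL : ∀ i ∈ L, ∀ j ∉ L, i < j := by
    intro i hi j hj
    rw [hmL] at hi hj
    by_contra hc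
    have := hq.monotone (not_lt.mp hc)
    omega
  set I := Ideal.span (Set.range (fun i : Fin N => (X i : MvPolynomial (Fin N) K)^N)) with hI
  set φ := Ideal.Quotient.mk I with hφ
  set x : Fin N → MvPolynomial (Fin N) K ⧸ I := fun i => φ (X i) with hxdef
  set v : Fin N → MvPolynomial (Fin N) K ⧸ I := fun i => ∑ k ∈ range N, (-x i)^k with hvdef
  have hx : ∀ i, x i ^ N = 0 := by
    intro i
    rw [hxdef, ← map_pow, hφ, Ideal.Quotient.eq_zero_iff_mem]
    exact Ideal.subset_span ⟨i, rfl⟩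
  have hv : ∀ i, (1 + x i) * v i = 1 := by
    intro i
    have := mul_neg_geom_sum (-x i) N
    rw [neg_pow (x i), hx, mul_zero, sub_zero, sub_neg_eq_add] at this
    exact this
  set τ := φ (C t) with hτ
  -- the sum representation
  set E := ∑ m ∈ (FP t N).support, C (coeff m (FP t N)) * ∏ i, Polynomial.aeval (X i : MvPolynomial (Fin N) K) (hpol K N (q i) (m i)) with hE
  set sg : MvPolynomial (Fin N) K := pairProd (fun i j => if i ∈ L ∧ j ∉ L then (-1) else 1) with hsg
  have main : φ (gP (fun i => GG t (N+1) N (if q i < N then q i + 1 else q i + 2)) * cP K N * vP K N) = φ (sg * E) := by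
    set nn : Fin N → MvPolynomial (Fin N) K := fun i => if i ∈ L then - X i else 1 with hnn
    set dd : Fin N → MvPolynomial (Fin N) K := fun i => if i ∈ L then 1 + X i else X i with hdd
    set z : Fin N → MvPolynomial (Fin N) K ⧸ I := fun i => if i ∈ L then (- x i)^(N-1-q i) else x i^(q i - N) with hz
    set uq : Fin N → MvPolynomial (Fin N) K ⧸ I := fun i => if i ∈ L then (1 + x i)^(q i+1) else (1 + x i)^(N+1) with huq
    set vq : Fin N → MvPolynomial (Fin N) K ⧸ I := fun i => if i ∈ L then v i^(2*N-q i) else 1 with hvq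
    have hdd0 : ∀ i, dd i ≠ 0 := by
      intro i h
      have h1 := congrArg (coeff (Finsupp.single i 1)) h
      simp only [hdd] at h1
      split_ifs at h1
      · rw [coeff_add, coeff_X, ← C_1, coeff_C, if_neg] at h1
        · simp at h1
        · intro h2; simpa using (DFunLike.congr_fun h2 i)
      · simp at h1
    have hom := FP_hom t N nn dd hdd0
    have hg : φ (gP (fun i => GG t (N+1) N (if q i < N then q i + 1 else q i + 2))) =
        (∏ i, uq i) * (∏ i, z i) * φ (∏ i, (C t * dd i + nn i)) := by
      rw [gP, map_prod, map_prod, ← prod_mul_distrib, ← prod_mul_distrib]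
      refine prod_congr rfl fun i _ => ?_
      simp only [huq, hz, hdd, hnn, hmL]
      have := hq2 i
      by_cases h : q i < N
      · simp only [h, if_true]
        rw [GG, if_pos (by omega), uu, show N - (q i + 1) = N - 1 - q i by omega]
        simp only [map_mul, map_pow, map_add, map_sub, map_neg, map_one, Polynomial.aeval_X, Polynomial.aeval_C, algebraMap_eq, hxdef, hτ]
        ring
      · simp only [h, if_false]
        rw [GG, if_neg (by omega), if_neg (by omega), uu, show N + (q i + 2) - 2*(N+1) = q i - N by omega, show 2*(N+1)-N-1 = N+1 by omega]
        simp only [map_mul, map_pow, map_add, map_one, Polynomial.aeval_X, Polynomial.aeval_C, algebraMap_eq, hxdef, hτ]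
        ring
    have hEφ : φ E = (∏ i, z i) * (∏ i, vq i) * φ ((∏ i, (C t * dd i + nn i)) * pairProd (fun i j => dd i * dd j + nn i * dd j + nn i * nn j) *
      pairProd (fun i j => nn j * dd i - nn i * dd j)) := by
      rw [← hom, hE, map_sum, map_sum, mul_sum]
      refine sum_congr rfl fun m hm => ?_
      rw [map_mul, map_mul, mul_left_comm, map_prod, map_prod, ← prod_mul_distrib, ← prod_mul_distrib]
      congr 1
      refine prod_congr rfl fun i _ => ?_
      have hmi : m i ≤ 2*N-1 := (monomial_le_degreeOf i hm).trans (FP_deg t N i)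
      generalize m i = a at hmi
      have hqi := hq2 i
      simp only [hz, hvq, hdd, hnn, hmL, hpol]
      by_cases h : q i < N
      · simp only [h, if_true]
        have huv : ∀ k, (1 + x i)^k * v i^k = 1 := fun k => by rw [← mul_pow, hv, one_pow]
        split_ifs with h1 h2
        · simp only [map_mul, map_pow, map_add, map_neg, map_one, Polynomial.aeval_X]
          change (- x i)^(N-1-(q i - a)) * (1 + x i)^(q i - a - 1) = (-x i)^(N-1-q i) * v i^(2*N - q i) * ((- x i)^a * (1 + x i)^(2*N-1-a))
          rw [show N-1-(q i - a) = (N-1-q i) + a by omega, show 2*N-1-a = (2*N-q i) + (q i - a - 1) by omega, pow_add, pow_add]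
          linear_combination (-(-x i)^(N-1-q i) * (-x i)^a * (1 + x i)^(q i - a - 1)) * huv (2*N-q i)
        · simp only [map_pow, map_neg, Polynomial.aeval_X, map_mul, map_add, map_one]
          change (- x i)^(N-1) = (-x i)^(N-1-q i) * v i^(2*N - q i) * ((- x i)^a * (1 + x i)^(2*N-1-a))
          rw [h2, show (2*N - q i) = 2*N-1-q i + 1 by omega, pow_succ]
          have e5 : (-x i)^(N-1-q i) * (-x i)^q i = (-x i)^(N-1) := by rw [← pow_add]; congr 1; omega
          have e6 : (-x i)^(N-1) * v i = (-x i)^(N-1) := by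
            have e7 : (-x i)^(N-1) * x i = 0 := by
              rw [neg_pow (x i) (N-1), mul_assoc, ← pow_succ, show N-1+1 = N by omega, hx, mul_zero]
            linear_combination (-x i)^(N-1) * hv i - v i * e7
          linear_combination -e6 - (-x i)^(N-1) * v i * huv (2*N-1-q i) - v i^(2*N-1-q i) * v i * (1 + x i)^(2*N-1-q i) * e5
        · simp only [map_zero, map_pow, map_neg, map_mul, map_add, map_one]
          change 0 = (-x i)^(N-1-q i) * v i^(2*N - q i) * ((- x i)^a * (1 + x i)^(2*N-1-a))
          have e5 : (-x i)^(N-1-q i) * (-x i)^a = 0 := by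
            rw [← pow_add, show N-1-q i + a = N + (a - q i - 1) by omega, pow_add, neg_pow (x i) N, hx]; ring
          linear_combination (-v i^(2*N - q i) * (1 + x i)^(2*N-1-a)) * e5
      · simp only [h, if_false]
        simp only [map_mul, map_pow, map_one, Polynomial.aeval_X, one_pow, one_mul, mul_one]
        rw [← pow_add]
    have hpair : φ (pairProd (fun i j => dd i * dd j + nn i * dd j + nn i * nn j) * pairProd (fun i j => nn j * dd i - nn i * dd j)) =
       φ sg * (pairProd (fun i j => if i ∈ L ∧ j ∉ L then 1 + x i + x i * x j else 1 + x j + x i * x j) * pairProd (fun i j => x i - x j)) := by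
      rw [hsg, map_mul, map_pairProd, map_pairProd, map_pairProd, ← pairProd_mul, ← pairProd_mul, ← pairProd_mul]
      apply pairProd_congr
      intro i j hij
      by_cases hi : i ∈ L <;> by_cases hj : j ∈ L
      · simp [hdd, hnn, hi, hj, hxdef]; ring
      · simp [hdd, hnn, hi, hj, hxdef]; ring
      · exact absurd (hL j hj i hi) (not_lt.mpr hij.le)
      · simp [hdd, hnn, hi, hj, hxdef]; ring
    have hsg1 : φ sg * φ sg = 1 := by
      rw [hsg, ← map_mul, ← pairProd_mul]
      have h1 : ∀ i j : Fin N, (if i ∈ L ∧ j ∉ L then (-1 : MvPolynomial (Fin N) K) else 1) * (if i ∈ L ∧ j ∉ L then (-1 : MvPolynomial (Fin N) K) else 1) = 1 := by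
        intro i j; split_ifs <;> ring
      simp only [h1]
      simp [pairProd]
    have hsw := swap_full x v hx hv L hL q (fun i hi => (hmL i).mp hi)
    have huq2 : ∏ i, uq i = (∏ i ∈ L, (1 + x i)^(q i+1)) * (∏ i ∈ Lᶜ, (1 + x i)^(N+1)) := by
      rw [← prod_mul_prod_compl L]
      congr 1
      · refine prod_congr rfl fun i hi => ?_
        simp [huq, hi]
      · refine prod_congr rfl fun i hi => ?_
        simp [huq, mem_compl.mp hi]
    have hvq2 : ∏ i, vq i = (∏ i ∈ L, v i^(2*N - q i)) := by
      rw [← prod_mul_prod_compl L, prod_eq_one (s := Lᶜ), mul_one]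
      · refine prod_congr rfl fun i hi => ?_
        simp [hvq, hi]
      · intro i hi
        simp [hvq, mem_compl.mp hi]
    have hc : φ (cP K N) = pairProd (fun i j => 1 + x j + x i * x j) := by
      rw [cP, map_pairProd]; simp [hxdef]
    have hvv : φ (vP K N) = pairProd (fun i j => x i - x j) := by
      rw [vP, map_pairProd]; simp [hxdef]
    rw [← huq2, ← hvq2] at hsw
    rw [map_mul, map_mul, map_mul, hg, hEφ, hc, hvv, mul_assoc (∏ i, (C t * dd i + nn i)), map_mul φ (∏ i, (C t * dd i + nn i)), hpair]
    generalize φ (∏ i, (C t * dd i + nn i)) = y0 at *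
    linear_combination (∏ i, z i) * y0 * hsw - (∏ i, z i) * y0 * (∏ i, vq i) * pairProd (fun i j => if i ∈ L ∧ j ∉ L then 1 + x i + x i * x j else 1 + x j + x i * x j) * pairProd (fun i j => x i - x j) * hsg1
  unfold Theta
  rw [add_zero]
  rw [coeff_of_quot hN _ _ main]
  have hsg2 : sg = C (pairProd (fun i j => if i ∈ L ∧ j ∉ L then (-1:K) else 1)) := by
    rw [hsg, map_pairProd]
    congr 1; funext i j; split_ifs <;> simp
  rw [hsg2, coeff_C_mul, hE, coeff_sum]
  have e1 : ∀ m ∈ (FP t N).support, coeff (cst N (N-1)) (C (coeff m (FP t N)) * ∏ i, Polynomial.aeval (X i : MvPolynomial (Fin N) K) (hpol K N (q i) (m i))) =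
      if m = Finsupp.equivFunOnFinite.symm q then coeff m (FP t N) * ∏ i ∈ L, (-1)^(N-1) else 0 := by
    intro m hm
    rw [coeff_C_mul]
    have := coeff_gP (fun i => hpol K N (q i) (m i)) (cst N (N-1))
    rw [gP] at this
    rw [this]
    have e2 : ∀ i, (hpol K N (q i) (m i)).coeff (cst N (N-1) i) = if m i = q i then (if q i < N then (-1)^(N-1) else 1) else 0 := by
      intro i
      exact hpol_coeff N (q i) (m i) hN ((monomial_le_degreeOf i hm).trans (FP_deg t N i))
    simp_rw [e2]
    split_ifs with h
    · subst h
      simp only [Finsupp.equivFunOnFinite_symm_apply_apply, if_true]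
      rw [hLdef, prod_filter]
    · obtain ⟨i, hi⟩ : ∃ i, m i ≠ q i := by
        by_contra hc
        push Not at hc
        apply h; ext i; exact hc i
      rw [prod_eq_zero (mem_univ i), mul_zero]
      rw [if_neg hi]
  rw [sum_congr rfl e1, sum_ite_eq' ]
  split_ifs with h
  · rw [mul_left_comm, sign_LR L hL, mul_one]
  · rw [mul_zero]
    exact (notMem_support_iff.mp h).symm
end quot
end ASPaux

namespace ASPaux

section lag
variable {F : Type*} [Field F]

lemma prod_erase_ite {ι : Type*} [DecidableEq ι] (s : Finset ι) (i : ι) (f : ι → F) :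
    ∏ j ∈ s.erase i, f j = ∏ j ∈ s, if j = i then 1 else f j := by
  rw [← prod_filter_mul_prod_filter_not s (fun j => j = i)]
  rw [prod_eq_one (s := s.filter (fun j => j = i)) (by intro j hj; simp [(mem_filter.mp hj).2]), one_mul]
  refine prod_congr (by ext j; simp [and_comm]) fun j hj => ?_
  simp [(mem_filter.mp hj).2]

/-- Lagrange interpolation identity. -/
lemma lagr {ι : Type*} [DecidableEq ι] (T : Finset ι) (x α β w : ι → F)
    (hw : ∀ i, w i = x i * α i) (h2 : ∀ i, α i + β i = 1 + w i)
    (hinj : Function.Injective w) (hw0 : ∀ i, w i ≠ 0) (hw1 : ∀ i, w i ≠ -1) :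
    ∑ i ∈ T, (1 - x i) * ∏ j ∈ T.erase i, (x j * (α j - w i * β j) / (w j - w i)) = 1 - ∏ i ∈ T, x i := by
  have hx0 : ∀ i, x i ≠ 0 := fun i h => hw0 i (by rw [hw, h, zero_mul])
  have ha0 : ∀ i, α i ≠ 0 := fun i h => hw0 i (by rw [hw, h, mul_zero])
  have hw1' : ∀ i, 1 + w i ≠ 0 := fun i h => hw1 i (by linear_combination h)
  let P : Polynomial F := ∏ j ∈ T, (Polynomial.C (α j) - Polynomial.X * Polynomial.C (β j))
  let v : Option (Option ι) → F := fun o => o.elim 0 (fun o' => o'.elim (-1) w)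
  have hdeg : P.natDegree ≤ T.card := by
    refine (Polynomial.natDegree_prod_le _ _).trans ?_
    rw [card_eq_sum_ones]
    refine sum_le_sum fun j _ => ?_
    compute_degree
  have hdeg2 : P.degree < ((insertNone (insertNone T)).card : ℕ) := by
    refine lt_of_le_of_lt Polynomial.degree_le_natDegree ?_
    simp only [card_insertNone]
    exact_mod_cast (by omega)
  have hv : Set.InjOn v (insertNone (insertNone T)) := by
    intro a _ b _ hab
    rcases a with _ | _ | a <;> rcases b with _ | _ | b <;> simp [v] at hab ⊢
    · exact hw0 b hab.symm
    · exact hw1 b hab.symm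
    · exact hw0 a hab
    · exact hw1 a hab
    · exact hinj hab
  have key := Lagrange.coeff_eq_sum hv hdeg2
  rw [Polynomial.coeff_eq_zero_of_natDegree_lt (by simp only [card_insertNone]; omega)] at key
  simp only [prod_erase_ite] at key
  have hs : ∀ (s : Finset ι) (f : Option (Option ι) → F), ∑ i ∈ insertNone (insertNone s), f i = f none + (f (some none) + ∑ i ∈ s, f (some (some i))) := by
    intro s f; rw [sum_insertNone, sum_insertNone]
  have hpp : ∀ (s : Finset ι) (f : Option (Option ι) → F), ∏ i ∈ insertNone (insertNone s), f i = f none * (f (some none) * ∏ i ∈ s, f (some (some i))) := by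
    intro s f; rw [prod_insertNone, prod_insertNone]
  simp only [hs, hpp] at key
  simp only [v, P, Option.elim, Polynomial.eval_prod, Polynomial.eval_sub, Polynomial.eval_mul, Polynomial.eval_X, Polynomial.eval_C,
    if_true, Option.some.injEq, reduceCtorEq, if_false, zero_mul, sub_zero, one_mul, zero_sub, sub_neg_eq_add, zero_add, neg_mul, neg_neg] at key
  have hxP : ∏ i ∈ T, x i ≠ 0 := prod_ne_zero_iff.mpr fun i _ => hx0 i
  have e1 : (∏ i ∈ T, α i) / ∏ i ∈ T, -w i = (-1)^T.card / ∏ i ∈ T, x i := by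
    rw [← prod_const, ← prod_div_distrib, ← prod_div_distrib]
    refine prod_congr rfl fun i _ => ?_
    rw [hw]
    have := hx0 i; have := ha0 i
    field_simp
  have e2 : (∏ i ∈ T, (α i + β i)) / -∏ i ∈ T, (-1 - w i) = -(-1)^T.card := by
    rw [div_neg, ← prod_const, ← prod_div_distrib]
    congr 1
    refine prod_congr rfl fun i _ => ?_
    rw [h2]
    have := hw1' i
    rw [show -1 - w i = -(1 + w i) by ring]
    field_simp
  have e3 : ∀ i ∈ T, (∏ j ∈ T, (α j - w i * β j)) / (w i * ((w i + 1) * ∏ j ∈ T, if j = i then 1 else w i - w j)) =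
      -(-1)^T.card / (∏ j ∈ T, x j) * ((1 - x i) * ∏ j ∈ T.erase i, (x j * (α j - w i * β j) / (w j - w i))) := by
    intro i hi
    rw [← prod_erase_ite T i (fun j => w i - w j), prod_div_distrib, prod_mul_distrib,
      ← mul_prod_erase T x hi, ← mul_prod_erase T (fun j => α j - w i * β j) hi]
    have e4 : ∏ j ∈ T.erase i, (w j - w i) = -(-1)^T.card * ∏ j ∈ T.erase i, (w i - w j) := by
      rw [← card_erase_add_one hi, pow_succ, ← prod_const]
      rw [mul_neg_one, neg_neg, ← prod_mul_distrib]
      exact prod_congr rfl fun j _ => by ring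
    have hne : ∏ j ∈ T.erase i, (w i - w j) ≠ 0 := by
      rw [prod_ne_zero_iff]; intro j hj h
      exact ne_of_mem_erase hj (hinj (by linear_combination -h))
    have hne2 : ∏ j ∈ T.erase i, x j ≠ 0 := prod_ne_zero_iff.mpr fun i _ => hx0 i
    have hsg : ((-1:F)^T.card) * (-1)^T.card = 1 := by
      rw [← pow_add, ← two_mul, pow_mul]; simp
    have hsn : ((-1:F)^T.card) ≠ 0 := by simp
    rw [e4]
    have hb : α i - w i * β i = (1 + w i) * α i * (1 - x i) := by
      have := h2 i; have := hw i
      linear_combination (-w i) * h2 i - (1 + w i) * hw i 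
    have h5 := hw1' i; have h6 := hx0 i; have h7 := ha0 i
    have h8 : w i + 1 ≠ 0 := by rwa [add_comm]
    rw [hb, add_comm (w i) 1]
    generalize (∏ j ∈ T.erase i, (w i - w j)) = A at *
    generalize (∏ j ∈ T.erase i, (α j - w i * β j)) = A2 at *
    generalize (∏ j ∈ T.erase i, x j) = A3 at *
    generalize (-1:F)^T.card = s at *
    rw [hw i] at *
    field_simp
  rw [sum_congr rfl e3, ← mul_sum, e1, e2] at key
  have hsg : ((-1:F)^T.card) * (-1)^T.card = 1 := by
    rw [← pow_add, ← two_mul, pow_mul]; simp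
  generalize (∑ i ∈ T, (1 - x i) * ∏ j ∈ T.erase i, (x j * (α j - w i * β j) / (w j - w i))) = S at *
  generalize (-1:F)^T.card = s at *
  generalize (∏ j ∈ T, x j) = A3 at *
  field_simp at key
  linear_combination s * key + (1 - S - A3) * hsg
end lag
end ASPaux

namespace ASPaux

section det
variable {F : Type*} [Field F]

/-- The determinant on the right-hand side of the bounded Littlewood identity. -/
noncomputable def DW {R : Type*} [CommRing R] {N : ℕ} (B : ℕ) (x α β : Fin N → R) : R :=
  Matrix.det (fun i j : Fin N => (x i * α i)^(j:ℕ) - x i ^ B * (α i^(j:ℕ) * β i ^ (j.rev : ℕ)))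

noncomputable def PV {R : Type*} [CommRing R] {N : ℕ} (T : Finset (Fin N)) (α β w : Fin N → R) : R :=
  pairProd (fun i j => (if j ∈ T then w j else α j) * (if i ∈ T then 1 else β i) - (if i ∈ T then w i else α i) * (if j ∈ T then 1 else β j))

lemma DW_expand {R : Type*} [CommRing R] {N : ℕ} (B : ℕ) (x α β : Fin N → R) :
    DW B x α β = ∑ T : Finset (Fin N), (∏ i ∈ Tᶜ, (- x i ^ B)) * PV T α β (fun i => x i * α i) := by
  unfold DW
  have := (Matrix.detRowAlternating (R := R) (n := Fin N)).map_add_univ (fun i (j : Fin N) => (x i * α i)^(j:ℕ)) (fun i (j : Fin N) => - x i ^ B * (α i^(j:ℕ) * β i ^ (j.rev : ℕ)))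
  have e : (fun i j : Fin N => (x i * α i)^(j:ℕ) - x i ^ B * (α i^(j:ℕ) * β i ^ (j.rev : ℕ))) = (fun i (j : Fin N) => (x i * α i)^(j:ℕ)) + (fun i (j : Fin N) => - x i ^ B * (α i^(j:ℕ) * β i ^ (j.rev : ℕ))) := by
    ext i j; simp only [Pi.add_apply]; ring
  rw [e]
  refine Eq.trans this ?_
  refine sum_congr rfl fun T _ => ?_
  have e2 : (T.piecewise (fun i (j : Fin N) => (x i * α i)^(j:ℕ)) (fun i (j : Fin N) => - x i ^ B * (α i^(j:ℕ) * β i ^ (j.rev : ℕ)))) =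
     fun i j => (if i ∈ T then 1 else - x i ^ B) * Matrix.projVandermonde (fun i => if i ∈ T then x i * α i else α i) (fun i => if i ∈ T then 1 else β i) i j := by
    ext i j
    by_cases h : i ∈ T <;> simp [h, Matrix.projVandermonde_apply]
  rw [e2]
  have e3 := Matrix.det_mul_column (fun i => if i ∈ T then 1 else - x i ^ B) (Matrix.projVandermonde (fun i => if i ∈ T then x i * α i else α i) (fun i => if i ∈ T then 1 else β i))
  refine Eq.trans e3 ?_
  rw [Matrix.det_projVandermonde, PV, pairProd_Ioi]
  congr 1
  rw [← prod_mul_prod_compl T, prod_eq_one (s := T) (by intro i hi; simp [hi]), one_mul]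
  exact prod_congr rfl fun i hi => by simp [mem_compl.mp hi]

lemma prod_succAbove_split {R : Type*} [CommRing R] {N : ℕ} (f : Fin (N+1) → R) (T : Finset (Fin (N+1))) (k : Fin (N+1)) (hk : k ∈ T) :
    ∏ j, f (k.succAbove j) = (∏ j ∈ Tᶜ, f j) * ∏ j ∈ T.erase k, f j := by
  have : univ.erase k = univ.map (Fin.succAboveEmb k) := by
    ext j; simp [Fin.exists_succAbove_eq_iff]
  have h2 : ∏ j, f (k.succAbove j) = ∏ j ∈ univ.erase k, f j := by
    rw [this, prod_map]; rfl
  rw [h2, ← prod_filter_mul_prod_filter_not (univ.erase k) (fun j => j ∈ T), mul_comm]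
  congr 1
  · refine prod_congr ?_ fun j hj => rfl
    ext j; simp; intro h h'; exact h (h' ▸ hk)
  · exact prod_congr (by ext j; simp) fun j hj => rfl

lemma prod_compl_succAbove {R : Type*} [CommRing R] {N : ℕ} (f : Fin (N+1) → R) (T : Finset (Fin (N+1))) (k : Fin (N+1)) (hk : k ∈ T) :
    ∏ i ∈ (univ.filter (fun i => k.succAbove i ∈ T))ᶜ, f (k.succAbove i) = ∏ i ∈ Tᶜ, f i := by
  have := prod_succAbove_split (fun j => if j ∈ T then 1 else f j) T k hk
  rw [prod_congr (s₁ := T.erase k) rfl (fun j hj => if_pos (mem_of_mem_erase hj)), prod_const_one, mul_one,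
    prod_congr (s₁ := Tᶜ) rfl (fun j hj => if_neg (mem_compl.mp hj))] at this
  rw [← this, compl_filter, prod_filter]
  refine prod_congr rfl fun j _ => ?_
  by_cases h : k.succAbove j ∈ T <;> simp [h]

lemma sum_finset_succAbove {R : Type*} [CommRing R] {N : ℕ} (f : Finset (Fin N) → R) (k : Fin (N+1)) :
    ∑ T, f T = ∑ T ∈ univ.filter (fun T : Finset (Fin (N+1)) => k ∈ T), f (univ.filter (fun i => k.succAbove i ∈ T)) := by
  refine sum_nbij' (fun T => insert k (T.map (Fin.succAboveEmb k))) (fun T => univ.filter (fun i => k.succAbove i ∈ T)) ?_ ?_ ?_ ?_ ?_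
  · intro T _; simp
  · intro T _; simp
  · intro T _; ext i; simp [Fin.succAbove_ne]
  · intro T hT
    simp only [mem_filter, mem_univ, true_and] at hT
    ext i
    rcases Fin.eq_self_or_eq_succAbove k i with rfl | ⟨j, rfl⟩
    · simpa using hT
    · simp [Fin.succAbove_ne]
  · intro T _; congr 1; ext i; simp [Fin.succAbove_ne]

lemma PV_succAbove {R : Type*} [CommRing R] {N : ℕ} (T : Finset (Fin (N+1))) (α β w : Fin (N+1) → R) (k : Fin (N+1)) (hk : k ∈ T) :
    PV T α β w = (-1)^(k:ℕ) * PV (univ.filter (fun i => k.succAbove i ∈ T)) (fun i => α (k.succAbove i)) (fun i => β (k.succAbove i)) (fun i => w (k.succAbove i)) *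
      ((∏ j ∈ Tᶜ, (α j - w k * β j)) * ∏ j ∈ T.erase k, (w j - w k)) := by
  unfold PV
  rw [pairProd_succAbove _ k]
  simp only [mem_filter, mem_univ, true_and]
  have h1 : (∏ j ∈ Tᶜ, (α j - w k * β j)) * ∏ j ∈ T.erase k, (w j - w k) = ∏ j, ((if k.succAbove j ∈ T then w (k.succAbove j) else α (k.succAbove j)) - w k * (if k.succAbove j ∈ T then 1 else β (k.succAbove j))) := by
    rw [prod_succAbove_split (fun j => (if j ∈ T then w j else α j) - w k * (if j ∈ T then 1 else β j)) T k hk]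
    congr 1
    · exact prod_congr rfl fun j hj => by simp [mem_compl.mp hj]
    · exact prod_congr rfl fun j hj => by simp [mem_of_mem_erase hj]
  have h3 : (-1 : R)^(k:ℕ) = ∏ j : Fin N, if k.succAbove j < k then -1 else 1 := by
    have := Fin.prod_univ_succAbove (fun j => if j < k then (-1:R) else 1) k
    rw [if_neg (lt_irrefl k), one_mul] at this
    rw [← this, ← prod_filter, prod_const, filter_gt_eq_Iio, Fin.card_Iio]
  rw [h1, h3, mul_comm (∏ j : Fin N, if k.succAbove j < k then (-1:R) else 1), mul_assoc, ← prod_mul_distrib]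
  congr 1
  refine prod_congr rfl fun j _ => ?_
  split_ifs <;> simp

theorem DW_rec {N : ℕ} (B : ℕ) (x α β : Fin (N+1) → F)
    (h2 : ∀ i, α i + β i = 1 + x i * α i)
    (hinj : Function.Injective (fun i => x i * α i)) (hw0 : ∀ i, x i * α i ≠ 0) (hw1 : ∀ i, x i * α i ≠ -1) :
    DW (B+1) x α β = (∏ i, x i) * DW B x α β + ∑ k : Fin (N+1), (-1)^(k:ℕ) * (1 - x k) *
      (∏ j, (x (k.succAbove j) * (α (k.succAbove j) - x k * α k * β (k.succAbove j)))) *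
      DW B (fun j => x (k.succAbove j)) (fun j => α (k.succAbove j)) (fun j => β (k.succAbove j)) := by
  have hk : ∀ k : Fin (N+1), (-1)^(k:ℕ) * (1 - x k) *
      (∏ j, (x (k.succAbove j) * (α (k.succAbove j) - x k * α k * β (k.succAbove j)))) *
      DW B (fun j => x (k.succAbove j)) (fun j => α (k.succAbove j)) (fun j => β (k.succAbove j)) =
      ∑ T : Finset (Fin (N+1)), if k ∈ T then (∏ i ∈ Tᶜ, (- x i ^ (B+1))) * PV T α β (fun i => x i * α i) *
        ((1 - x k) * ∏ j ∈ T.erase k, (x j * (α j - x k * α k * β j) / (x j * α j - x k * α k))) else 0 := by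
    intro k
    rw [DW_expand, sum_finset_succAbove _ k, mul_sum, sum_filter]
    refine sum_congr rfl fun T _ => ?_
    split_ifs with hkT
    · rw [PV_succAbove T α β _ k hkT, prod_compl_succAbove (fun i => - x i ^ B) T k hkT,
        prod_succAbove_split (fun j => x j * (α j - x k * α k * β j)) T k hkT, prod_div_distrib]
      have hne : ∏ j ∈ T.erase k, (x j * α j - x k * α k) ≠ 0 := by
        rw [prod_ne_zero_iff]; intro j hj h
        exact ne_of_mem_erase hj (hinj (sub_eq_zero.mp h))
      have e1 : ∏ i ∈ Tᶜ, (- x i ^ (B+1)) = (∏ i ∈ Tᶜ, x i) * ∏ i ∈ Tᶜ, (- x i ^ B) := by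
        rw [← prod_mul_distrib]; exact prod_congr rfl fun i _ => by ring
      rw [e1, prod_mul_distrib (s := Tᶜ)]
      field_simp
    · rfl
  rw [sum_congr rfl (fun k _ => hk k), sum_comm, DW_expand, DW_expand, mul_sum, ← sum_add_distrib]
  refine sum_congr rfl fun T _ => ?_
  rw [← sum_filter, ← mul_sum, filter_univ_mem,
    lagr T x α β (fun i => x i * α i) (fun i => rfl) h2 hinj hw0 hw1, ← prod_mul_prod_compl T]
  have e1 : ∏ i ∈ Tᶜ, (- x i ^ (B+1)) = (∏ i ∈ Tᶜ, x i) * ∏ i ∈ Tᶜ, (- x i ^ B) := by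
    rw [← prod_mul_distrib]; exact prod_congr rfl fun i _ => by ring
  rw [e1]; ring

theorem DW_zero {N : ℕ} (x α β : Fin (N+1) → F) (h2 : ∀ i, α i + β i = 1 + x i * α i) : DW 0 x α β = 0 := by
  unfold DW
  refine Matrix.exists_mulVec_eq_zero_iff.mp ⟨fun j => (N.choose j : F), ?_, ?_⟩
  · intro h; have := congrFun h 0; simp at this
  · ext i
    simp only [Matrix.mulVec, dotProduct, Pi.zero_apply, pow_zero, one_mul, sub_mul, sum_sub_distrib]
    have e1 := add_pow (x i * α i) 1 N
    have e2 := add_pow (α i) (β i) N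
    rw [h2, add_comm 1, e1, ← Fin.sum_univ_eq_sum_range (fun j => (x i * α i)^j * 1^(N-j) * (N.choose j : F)),
       ← Fin.sum_univ_eq_sum_range (fun j => (α i)^j * (β i)^(N-j) * (N.choose j : F))] at e2
    rw [sub_eq_zero]
    simpa [Fin.val_rev] using e2
end det
end ASPaux

namespace ASPaux

/-- strictly increasing tuples with values `< B`. -/
def inc (N B : ℕ) : Finset (Fin N → ℕ) :=
  (Fintype.piFinset fun _ => range B).filter fun k => ∀ i j, i < j → k i < k j

lemma mem_inc {N B : ℕ} {k : Fin N → ℕ} : k ∈ inc N B ↔ (∀ i, k i < B) ∧ ∀ i j, i < j → k i < k j := by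
  simp [inc]

section
variable {R : Type*} [CommRing R]

noncomputable def hS (N B : ℕ) (x : Fin N → R) : R := ∑ k ∈ inc N B, ∏ i, x i ^ k i

lemma hS_zero (B : ℕ) (x : Fin 0 → R) : hS 0 B x = 1 := by
  have : inc 0 B = univ := by ext k; simp only [mem_inc, mem_univ, iff_true]; exact ⟨fun i => i.elim0, fun i => i.elim0⟩
  simp [hS, this]

lemma hS_zero' (N : ℕ) (x : Fin (N+1) → R) : hS (N+1) 0 x = 0 := by
  apply sum_eq_zero
  intro k hk
  rw [mem_inc] at hk
  exact absurd (hk.1 0) (by omega)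

lemma hS_rec (N B : ℕ) (x : Fin (N+1) → R) : hS (N+1) (B+1) x =
    (∏ i, x i) * hS (N+1) B x + (∏ j : Fin N, x j.succ) * hS N B (fun j => x j.succ) := by
  unfold hS
  rw [← sum_filter_not_add_sum_filter (inc (N+1) (B+1)) (fun k => k 0 = 0), mul_sum, mul_sum]
  congr 1
  · refine sum_nbij' (fun k i => k i - 1) (fun k i => k i + 1) ?_ ?_ ?_ ?_ ?_
    · intro k hk
      simp only [mem_filter, mem_inc] at hk ⊢
      obtain ⟨⟨h1, h2⟩, h3⟩ := hk
      have h4 : ∀ i, 1 ≤ k i := fun i => by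
        rcases Fin.eq_zero_or_eq_succ i with rfl | ⟨j, rfl⟩
        · omega
        · have := h2 0 j.succ (Fin.succ_pos j); omega
      exact ⟨fun i => by have := h1 i; have := h4 i; omega, fun i j hij => by have := h2 i j hij; have := h4 i; omega⟩
    · intro k hk
      simp only [mem_filter, mem_inc] at hk ⊢
      exact ⟨⟨fun i => by have := hk.1 i; omega, fun i j hij => by have := hk.2 i j hij; omega⟩, by omega⟩
    · intro k hk
      simp only [mem_filter, mem_inc] at hk
      obtain ⟨⟨h1, h2⟩, h3⟩ := hk
      ext i
      have h4 : 1 ≤ k i := by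
        rcases Fin.eq_zero_or_eq_succ i with rfl | ⟨j, rfl⟩
        · omega
        · have := h2 0 j.succ (Fin.succ_pos j); omega
      simp only; omega
    · intro k hk; ext i; simp
    · intro k hk
      simp only [mem_filter, mem_inc] at hk
      obtain ⟨⟨h1, h2⟩, h3⟩ := hk
      rw [← prod_mul_distrib]
      refine prod_congr rfl fun i _ => ?_
      have h4 : 1 ≤ k i := by
        rcases Fin.eq_zero_or_eq_succ i with rfl | ⟨j, rfl⟩
        · omega
        · have := h2 0 j.succ (Fin.succ_pos j); omega
      rw [← pow_succ']; congr 1; dsimp only; omega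
  · refine sum_nbij' (fun k i => k i.succ - 1) (fun k => Fin.cons 0 (fun i => k i + 1)) ?_ ?_ ?_ ?_ ?_
    · intro k hk
      simp only [mem_filter, mem_inc] at hk ⊢
      obtain ⟨⟨h1, h2⟩, h3⟩ := hk
      have h4 : ∀ j : Fin N, 1 ≤ k j.succ := fun j => by
        have := h2 0 j.succ (Fin.succ_pos j); omega
      exact ⟨fun i => by have := h1 i.succ; have := h4 i; omega, fun i j hij => by have := h2 i.succ j.succ (by simpa using hij); have := h4 i; omega⟩
    · intro k hk
      simp only [mem_filter, mem_inc] at hk ⊢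
      refine ⟨⟨fun i => ?_, fun i j hij => ?_⟩, by simp⟩
      · rcases Fin.eq_zero_or_eq_succ i with rfl | ⟨j, rfl⟩
        · simp
        · simpa using hk.1 j
      · rcases Fin.eq_zero_or_eq_succ j with rfl | ⟨j, rfl⟩
        · exact absurd hij (by simp)
        rcases Fin.eq_zero_or_eq_succ i with rfl | ⟨i, rfl⟩
        · simp
        · simpa using hk.2 i j (by simpa using hij)
    · intro k hk
      simp only [mem_filter, mem_inc] at hk
      obtain ⟨⟨h1, h2⟩, h3⟩ := hk
      ext i
      rcases Fin.eq_zero_or_eq_succ i with rfl | ⟨j, rfl⟩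
      · simp [h3]
      · have := h2 0 j.succ (Fin.succ_pos j)
        simp only [Fin.cons_succ]; omega
    · intro k hk; ext i; simp
    · intro k hk
      simp only [mem_filter, mem_inc] at hk
      obtain ⟨⟨h1, h2⟩, h3⟩ := hk
      rw [← prod_mul_distrib, Fin.prod_univ_succ, h3, pow_zero, one_mul]
      refine prod_congr rfl fun j _ => ?_
      have := h2 0 j.succ (Fin.succ_pos j)
      rw [← pow_succ']; congr 1; dsimp only; omega

lemma sum_perm_succ {N : ℕ} (G : (Fin (N+1) → Fin (N+1)) → R) :
    ∑ σ : Equiv.Perm (Fin (N+1)), ((Equiv.Perm.sign σ : ℤ) : R) * G σ =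
    ∑ k : Fin (N+1), (-1)^(k:ℕ) * ∑ τ : Equiv.Perm (Fin N), ((Equiv.Perm.sign τ : ℤ) : R) * G (Fin.cons k (fun j => k.succAbove (τ j))) := by
  rw [Finset.univ_perm_fin_succ, ← Finset.univ_product_univ]
  simp only [Finset.sum_map, Equiv.toEmbedding_apply, Finset.sum_product]
  refine sum_congr rfl fun k _ => ?_
  have hz : ∀ τ : Equiv.Perm (Fin N), (⇑(Equiv.Perm.decomposeFin.symm (k, τ)) : Fin (N+1) → Fin (N+1)) = Fin.cons k (fun j => Equiv.swap 0 k (τ j).succ) := by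
    intro τ
    ext1 j
    rcases Fin.eq_zero_or_eq_succ j with rfl | ⟨j, rfl⟩ <;> simp
  simp only [hz, Equiv.Perm.decomposeFin.symm_sign]
  rcases Fin.eq_zero_or_eq_succ k with rfl | ⟨k, rfl⟩
  · simp
  · rw [mul_sum]
    refine Eq.trans ?_ (Equiv.sum_comp (Equiv.mulLeft (Fin.cycleRange k)) _)
    refine sum_congr rfl fun τ _ => ?_
    have hf : (fun j => Equiv.swap 0 k.succ (τ j).succ) = fun j => k.succ.succAbove ((Equiv.mulLeft (Fin.cycleRange k)) τ j) := by
      ext1 j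
      rw [← Fin.succAbove_cycleRange]; rfl
    rw [hf]
    generalize G _ = g
    simp [Fin.sign_cycleRange, Fin.succ_ne_zero, pow_succ]
    rw [← mul_assoc, ← mul_assoc, ← mul_pow]; simp

/-- antisymmetrisation -/
noncomputable def AA (N B : ℕ) (x : Fin N → R) (p : Fin N → Fin N → R) : R :=
  ∑ σ : Equiv.Perm (Fin N), ((Equiv.Perm.sign σ : ℤ) : R) * (pairProd (fun i j => p (σ i) (σ j)) * hS N B (fun i => x (σ i)))

lemma AA_rec (N B : ℕ) (x : Fin (N+1) → R) (p : Fin (N+1) → Fin (N+1) → R) :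
    AA (N+1) (B+1) x p = (∏ i, x i) * AA (N+1) B x p + ∑ k : Fin (N+1), (-1)^(k:ℕ) *
      (∏ j, (p k (k.succAbove j) * x (k.succAbove j))) * AA N B (fun j => x (k.succAbove j)) (fun i j => p (k.succAbove i) (k.succAbove j)) := by
  unfold AA
  have h1 : ∀ σ : Equiv.Perm (Fin (N+1)), ((Equiv.Perm.sign σ : ℤ) : R) * (pairProd (fun i j => p (σ i) (σ j)) * hS (N+1) (B+1) (fun i => x (σ i))) =
     (∏ i, x i) * (((Equiv.Perm.sign σ : ℤ) : R) * (pairProd (fun i j => p (σ i) (σ j)) * hS (N+1) B (fun i => x (σ i)))) +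
     ((Equiv.Perm.sign σ : ℤ) : R) * (fun f : Fin (N+1) → Fin (N+1) => pairProd (fun i j => p (f i) (f j)) * ((∏ j : Fin N, x (f j.succ)) * hS N B (fun j => x (f j.succ)))) σ := by
    intro σ
    rw [hS_rec, Equiv.prod_comp σ x]; ring
  rw [sum_congr rfl (fun σ _ => h1 σ), sum_add_distrib, ← mul_sum, sum_perm_succ (fun f : Fin (N+1) → Fin (N+1) => pairProd (fun i j => p (f i) (f j)) * ((∏ j : Fin N, x (f j.succ)) * hS N B (fun j => x (f j.succ))))]
  congr 1
  refine sum_congr rfl fun k _ => ?_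
  rw [mul_assoc]
  congr 1
  rw [mul_sum]
  refine sum_congr rfl fun τ _ => ?_
  simp only [Fin.cons_succ]
  rw [pairProd_succAbove _ 0]
  simp only [Fin.succAbove_zero, Fin.cons_succ, Fin.cons_zero, Fin.not_lt_zero, if_false]
  rw [← Equiv.prod_comp τ (fun j => p k (k.succAbove j) * x (k.succAbove j)), prod_mul_distrib]
  ring
end

/-- The bounded Littlewood identity. -/
theorem boundedL {F : Type*} [Field F] (N : ℕ) : ∀ (B : ℕ) (x α β : Fin N → F) (p : Fin N → Fin N → F)
    (_ : ∀ i j, α j - x i * α i * β j = p i j * (1 - x i * x j))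
    (_ : ∀ i, α i + β i = 1 + x i * α i)
    (_ : Function.Injective (fun i => x i * α i)) (_ : ∀ i, x i * α i ≠ 0) (_ : ∀ i, x i * α i ≠ -1),
    AA N B x p * ((∏ i, (1 - x i)) * pairProd (fun i j => 1 - x i * x j)) = DW B x α β := by
  induction N with
  | zero =>
    intro B x α β p _ _ _ _ _
    have : DW B x α β = 1 := Matrix.det_isEmpty
    rw [this]; simp [AA, hS_zero, pairProd]
  | succ N ih =>
    intro B
    induction B with
    | zero =>
      intro x α β p _ h2 _ _ _
      rw [DW_zero x α β h2]
      simp [AA, hS_zero']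
    | succ B ihB =>
      intro x α β p h1 h2 h3 h4 h5
      rw [DW_rec B x α β h2 h3 h4 h5, ← ihB x α β p h1 h2 h3 h4 h5, AA_rec, add_mul, mul_assoc, sum_mul]
      congr 1
      refine sum_congr rfl fun k _ => ?_
      rw [← ih B (fun j => x (k.succAbove j)) (fun j => α (k.succAbove j)) (fun j => β (k.succAbove j)) (fun i j => p (k.succAbove i) (k.succAbove j))
        (fun i j => h1 _ _) (fun i => h2 _) (fun i j hij => Fin.succAbove_right_injective (h3 hij)) (fun i => h4 _) (fun i => h5 _)]
      rw [Fin.prod_univ_succAbove _ k, pairProd_succAbove _ k]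
      have e : ∏ j, (x (k.succAbove j) * (α (k.succAbove j) - x k * α k * β (k.succAbove j))) =
         (∏ j, (p k (k.succAbove j) * x (k.succAbove j))) * ∏ j, (if k.succAbove j < k then 1 - x (k.succAbove j) * x k else 1 - x k * x (k.succAbove j)) := by
        rw [← prod_mul_distrib]
        refine prod_congr rfl fun j _ => ?_
        rw [h1 k (k.succAbove j), mul_comm (x (k.succAbove j)) (x k), ite_self]; ring
      rw [e]; ring
end ASPaux

namespace ASPaux
open MvPolynomial

lemma map_hS {R S : Type*} [CommRing R] [CommRing S] (φ : R →+* S) (N B : ℕ) (x : Fin N → R) :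
    φ (hS N B x) = hS N B (fun i => φ (x i)) := by
  simp [hS, map_sum, map_prod]

lemma map_AA {R S : Type*} [CommRing R] [CommRing S] (φ : R →+* S) (N B : ℕ) (x : Fin N → R) (p : Fin N → Fin N → R) :
    φ (AA N B x p) = AA N B (fun i => φ (x i)) (fun i j => φ (p i j)) := by
  simp only [AA, map_sum, map_mul, map_pairProd, map_hS, map_intCast]

lemma map_DW {R S : Type*} [CommRing R] [CommRing S] (φ : R →+* S) (N B : ℕ) (x α β : Fin N → R) :
    φ (DW B x α β) = DW B (fun i => φ (x i)) (fun i => φ (α i)) (fun i => φ (β i)) := by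
  unfold DW
  refine (RingHom.map_det φ _).trans ?_
  congr 1
  refine Matrix.ext fun i j => ?_
  change φ ((x i * α i)^(j:ℕ) - x i ^ B * (α i^(j:ℕ) * β i ^ (j.rev : ℕ))) = _
  simp

theorem boundedL_dom {R : Type*} [CommRing R] [IsDomain R] (N B : ℕ) (x α β : Fin N → R) (p : Fin N → Fin N → R)
    (h1 : ∀ i j, α j - x i * α i * β j = p i j * (1 - x i * x j))
    (h2 : ∀ i, α i + β i = 1 + x i * α i)
    (h3 : Function.Injective (fun i => x i * α i)) (h4 : ∀ i, x i * α i ≠ 0) (h5 : ∀ i, x i * α i ≠ -1) :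
    AA N B x p * ((∏ i, (1 - x i)) * pairProd (fun i j => 1 - x i * x j)) = DW B x α β := by
  have hι : Function.Injective (algebraMap R (FractionRing R)) := IsFractionRing.injective _ _
  apply hι
  rw [map_DW, map_mul, map_AA, map_mul, map_prod, map_pairProd]
  simp only [map_sub, map_one, map_mul]
  apply boundedL
  · intro i j; simpa using congrArg (algebraMap R (FractionRing R)) (h1 i j)
  · intro i; simpa using congrArg (algebraMap R (FractionRing R)) (h2 i)
  · intro i j hij
    simp only [← map_mul] at hij
    exact h3 (hι hij)
  · intro i h
    rw [← map_mul, map_eq_zero_iff _ hι] at h; exact h4 i h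
  · intro i h
    apply h5 i
    apply hι; simpa using h

variable {K : Type*} [CommRing K]

lemma bl1 [IsDomain K] (N B : ℕ) :
    AA N B (X : Fin N → MvPolynomial (Fin N) K) (fun i j => 1 + X j + X i * X j) * ((∏ i, (1 - X i)) * pairProd (fun i j => 1 - X i * X j)) =
      DW B X (fun i => 1 + X i) (fun i => X i ^ 2) := by
  have hc : ∀ p q : MvPolynomial (Fin N) K, p = q → constantCoeff p = constantCoeff q := fun p q h => by rw [h]
  apply boundedL_dom
  · intro i j; ring
  · intro i; ring
  · intro i j hij
    have h : (X i - X j : MvPolynomial (Fin N) K) * (1 + X i + X j) = 0 := by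
      simp only at hij; linear_combination hij
    rcases mul_eq_zero.mp h with h | h
    · exact X_injective (sub_eq_zero.mp h)
    · have := hc _ _ h; simp at this
  · intro i h
    rcases mul_eq_zero.mp h with h | h
    · exact X_ne_zero _ h
    · have := hc _ _ h; simp at this
  · intro i h
    have := hc _ _ h; simp at this

lemma bl2 [IsDomain K] (N B : ℕ) :
    AA N B (X : Fin N → MvPolynomial (Fin N) K) (fun i j => 1) * ((∏ i, (1 - X i)) * pairProd (fun i j => 1 - X i * X j)) =
      DW B X (fun i => 1) (fun i => X i) := by
  have hc : ∀ p q : MvPolynomial (Fin N) K, p = q → constantCoeff p = constantCoeff q := fun p q h => by rw [h]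
  apply boundedL_dom
  · intro i j; ring
  · intro i; ring
  · intro i j hij
    simp only [mul_one] at hij
    exact X_injective hij
  · intro i h
    simp at h
  · intro i h
    have := hc _ _ h; simp at this

noncomputable def DelP (K : Type*) [CommRing K] (N : ℕ) : MvPolynomial (Fin N) K := pairProd (fun i j => X j - X i)

lemma DelP_det (N : ℕ) : DelP K N = (Matrix.vandermonde (X : Fin N → MvPolynomial (Fin N) K)).det := by
  rw [Matrix.det_vandermonde, DelP, pairProd_Ioi]

lemma anti_det {N : ℕ} (M : Matrix (Fin N) (Fin N) (MvPolynomial (Fin N) K)) (σ : Equiv.Perm (Fin N))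
    (h : ∀ i j, rename σ (M i j) = M (σ i) j) : rename σ M.det = ((Equiv.Perm.sign σ : ℤ) : MvPolynomial (Fin N) K) * M.det := by
  rw [← Matrix.det_permute]
  rw [AlgHom.map_det]
  congr 1
  refine Matrix.ext fun i j => ?_
  exact h i j

lemma DelP_anti {N : ℕ} (σ : Equiv.Perm (Fin N)) : rename σ (DelP K N) = ((Equiv.Perm.sign σ : ℤ) : MvPolynomial (Fin N) K) * DelP K N := by
  rw [DelP_det]
  apply anti_det
  intro i j; simp [Matrix.vandermonde_apply]

noncomputable def D1 (K : Type*) [CommRing K] (N B : ℕ) : MvPolynomial (Fin N) K := DW B X (fun i => 1 + X i) (fun i => X i ^ 2)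

lemma D1_anti {N B : ℕ} (σ : Equiv.Perm (Fin N)) : rename σ (D1 K N B) = ((Equiv.Perm.sign σ : ℤ) : MvPolynomial (Fin N) K) * D1 K N B := by
  unfold D1 DW
  apply anti_det
  intro i j; simp

lemma D2_quot (N r : ℕ) : Ideal.Quotient.mk (Ideal.span (Set.range (fun i : Fin N => (X i : MvPolynomial (Fin N) K)^(r+1)))) (DW (r+1) X (fun _ => 1) (fun i => X i)) =
    Ideal.Quotient.mk _ (DelP K N) := by
  rw [DelP_det, map_DW]
  rw [RingHom.map_det]
  unfold DW
  congr 1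
  refine Matrix.ext fun i j => ?_
  have : Ideal.Quotient.mk (Ideal.span (Set.range (fun i : Fin N => (X i : MvPolynomial (Fin N) K)^(r+1)))) (X i) ^ (r+1) = 0 := by
    rw [← map_pow, Ideal.Quotient.eq_zero_iff_mem]
    exact Ideal.subset_span ⟨i, rfl⟩
  rw [this]
  simp [Matrix.vandermonde_apply]

noncomputable def TP (t : K) (N : ℕ) : MvPolynomial (Fin N) K := ∏ i, (C t + X i)

lemma TP_symm {N : ℕ} (t : K) (σ : Equiv.Perm (Fin N)) : rename σ (TP t N) = TP t N := by
  unfold TP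
  rw [map_prod]
  simp only [map_add, rename_C, rename_X]
  exact Equiv.prod_comp σ (fun i => (C t + X i : MvPolynomial (Fin N) K))

lemma symm_sum {N r : ℕ} (H f : MvPolynomial (Fin N) K) (hH : ∀ σ : Equiv.Perm (Fin N), rename σ H = ((Equiv.Perm.sign σ : ℤ) : MvPolynomial (Fin N) K) * H) :
    coeff (cst N r) (H * ∑ σ : Equiv.Perm (Fin N), ((Equiv.Perm.sign σ : ℤ) : MvPolynomial (Fin N) K) * rename σ f) = (N.factorial : K) * coeff (cst N r) (H * f) := by
  rw [mul_sum, coeff_sum]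
  have : ∀ σ : Equiv.Perm (Fin N), coeff (cst N r) (H * (((Equiv.Perm.sign σ : ℤ) : MvPolynomial (Fin N) K) * rename σ f)) = coeff (cst N r) (H * f) := by
    intro σ
    rw [← coeff_rename_perm σ (H * f), map_mul, hH]
    congr 1; ring
  rw [sum_congr rfl (fun σ _ => this σ), sum_const, card_univ, Fintype.card_perm, Fintype.card_fin, nsmul_eq_mul]

theorem partIIIa [IsDomain K] [CharZero K] (t : K) (N B r : ℕ) :
    coeff (cst N r) (TP t N * DelP K N * (pairProd (fun i j => 1 + X j + X i * X j) * hS N B X)) =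
    coeff (cst N r) (TP t N * D1 K N B * hS N (r+1) X) := by
  have hf : (N.factorial : K) ≠ 0 := by exact_mod_cast N.factorial_ne_zero
  apply mul_left_cancel₀ hf
  rw [← symm_sum (TP t N * DelP K N) _ (fun σ => by rw [map_mul, TP_symm, DelP_anti]; ring),
    ← symm_sum (TP t N * D1 K N B) _ (fun σ => by rw [map_mul, TP_symm, D1_anti]; ring)]
  have hr : ∀ (σ : Equiv.Perm (Fin N)) (B' : ℕ), rename σ (hS N B' X : MvPolynomial (Fin N) K) = hS N B' (fun i => X (σ i)) := by
    intro σ B'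
    have := map_hS (rename (R := K) σ).toRingHom N B' X
    refine Eq.trans this ?_
    congr 1; ext1 i; exact rename_X _ _
  have e1 : ∑ σ : Equiv.Perm (Fin N), ((Equiv.Perm.sign σ : ℤ) : MvPolynomial (Fin N) K) * rename σ (pairProd (fun i j => 1 + X j + X i * X j) * hS N B X) =
     AA N B X (fun i j => 1 + X j + X i * X j) := by
    unfold AA
    refine sum_congr rfl fun σ _ => ?_
    rw [map_mul, rename_pairProd, hr]
    simp
  have e2 : ∑ σ : Equiv.Perm (Fin N), ((Equiv.Perm.sign σ : ℤ) : MvPolynomial (Fin N) K) * rename σ (hS N (r+1) X) =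
     AA N (r+1) X (fun i j => 1) := by
    unfold AA
    refine sum_congr rfl fun σ _ => ?_
    rw [hr]
    simp [pairProd]
  rw [e1, e2]
  have h3 : coeff (cst N r) (TP t N * DelP K N * AA N B X (fun i j => 1 + X j + X i * X j)) =
      coeff (cst N r) (TP t N * DW (r+1) X (fun _ => 1) (fun i => X i) * AA N B X (fun i j => 1 + X j + X i * X j)) := by
    have := coeff_of_quot (P := r+1) (by omega) (TP t N * DelP K N * AA N B X (fun i j => 1 + X j + X i * X j))
      (TP t N * DW (r+1) X (fun _ => 1) (fun i => X i) * AA N B X (fun i j => 1 + X j + X i * X j)) (by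
        rw [map_mul, map_mul, map_mul, map_mul, D2_quot])
    simpa using this
  rw [h3]
  have b1 := bl1 (K := K) N B
  have b2 := bl2 (K := K) N (r+1)
  have h4 : TP t N * DW (r+1) X (fun _ => 1) (fun i => X i) * AA N B X (fun i j => 1 + X j + X i * X j) = TP t N * D1 K N B * AA N (r+1) X (fun i j => 1) := by
    unfold D1
    rw [← b1]
    refine Eq.trans (congrArg (fun z => TP t N * z * AA N B X (fun i j => 1 + X j + X i * X j)) b2.symm) ?_
    generalize AA N B (X : Fin N → MvPolynomial (Fin N) K) (fun i j => 1 + X j + X i * X j) = A1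
    generalize AA N (r+1) (X : Fin N → MvPolynomial (Fin N) K) (fun i j => 1) = A2
    ring
  rw [h4]
end ASPaux

namespace ASPaux
open MvPolynomial
variable {K : Type*} [CommRing K]

lemma det_fun {R : Type*} [CommRing R] {N : ℕ} (M : Fin N → Fin N → R) :
    Matrix.det M = ∑ σ : Equiv.Perm (Fin N), ((Equiv.Perm.sign σ : ℤ) : R) * ∏ i, M i (σ i) := by
  refine (Matrix.det_transpose (Matrix.of M)).symm.trans ?_
  rw [Matrix.det_apply']
  rfl

lemma coeff_det {N r : ℕ} (g : Fin N → Fin N → Polynomial K) :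
    coeff (cst N r) (Matrix.det (fun i j : Fin N => Polynomial.aeval (X i : MvPolynomial (Fin N) K) (g i j))) =
      Matrix.det (fun i j : Fin N => (g i j).coeff r) := by
  refine (congrArg (coeff (cst N r)) (det_fun _)).trans (Eq.trans ?_ (det_fun _).symm)
  rw [coeff_sum]
  refine sum_congr rfl fun σ _ => ?_
  have h := coeff_gP (fun i => g i (σ i)) (cst N r)
  rw [gP] at h
  have hc : (((Equiv.Perm.sign σ : ℤ)) : MvPolynomial (Fin N) K) = C ((Equiv.Perm.sign σ : ℤ) : K) := by simp
  rw [hc, coeff_C_mul]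
  congr 1

noncomputable def gent (t : K) (N B k j : ℕ) : Polynomial K :=
  (Polynomial.C t + Polynomial.X) * Polynomial.X ^ k * ((Polynomial.X * (1 + Polynomial.X))^j - Polynomial.X^B * ((1 + Polynomial.X)^j * (Polynomial.X^2)^(N - 1 - j)))

lemma coeff_TD (t : K) (N B r : ℕ) : coeff (cst N r) (TP t N * D1 K N B * hS N (r+1) X) =
    ∑ k ∈ inc N (r+1), Matrix.det (fun i j : Fin N => (gent t N B (k i) j).coeff r) := by
  rw [hS, mul_sum, coeff_sum]
  refine sum_congr rfl fun k _ => ?_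
  rw [← coeff_det (fun i j : Fin N => gent t N B (k i) j)]
  congr 1
  unfold TP D1 DW
  rw [mul_right_comm, ← prod_mul_distrib]
  refine (Matrix.det_mul_column _ _).symm.trans ?_
  congr 1
  refine Matrix.ext fun i j => ?_
  simp only [Matrix.of_apply, gent, map_mul, map_add, map_sub, map_pow, Polynomial.aeval_X, Polynomial.aeval_C, map_one, algebraMap_eq, Fin.val_rev]
  rw [show N - (↑j + 1) = N - 1 - (j:ℕ) by omega]

/-- sum of coefficients of `FP` over increasing tuples in `[l, r]` -/
theorem partIIIb [IsDomain K] [CharZero K] (t : K) (N l r : ℕ) (hlr : l ≤ r) :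
    ∑ q ∈ (inc N (r+1)).filter (fun q => ∀ i, l ≤ q i), coeff (Finsupp.equivFunOnFinite.symm q) (FP t N) =
    ((Equiv.Perm.sign (Fin.revPerm : Equiv.Perm (Fin N)) : ℤ) : K) *
    ∑ k ∈ inc N (r+1), Matrix.det (fun i j : Fin N => (gent t N (r - l + 1) (k i) j).coeff r) := by
  rw [← coeff_TD, ← partIIIa, hS, mul_sum, mul_sum, coeff_sum, mul_sum]
  refine sum_nbij' (fun q i => r - q i.rev) (fun k i => r - k i.rev) ?_ ?_ ?_ ?_ ?_
  · intro q hq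
    simp only [mem_filter, mem_inc] at hq ⊢
    obtain ⟨⟨h1, h2⟩, h3⟩ := hq
    refine ⟨fun i => ?_, fun i j hij => ?_⟩
    · have := h3 i.rev; omega
    · have := h2 j.rev i.rev (Fin.rev_lt_rev.mpr hij); have := h1 i.rev; omega
  · intro q hq
    simp only [mem_filter, mem_inc] at hq ⊢
    obtain ⟨h1, h2⟩ := hq
    refine ⟨⟨fun i => by omega, fun i j hij => ?_⟩, fun i => ?_⟩
    · have := h2 j.rev i.rev (Fin.rev_lt_rev.mpr hij); have := h1 i.rev; omega
    · have := h1 i.rev; omega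
  · intro q hq
    simp only [mem_filter, mem_inc] at hq
    ext i
    have := hq.1.1 i
    simp only [Fin.rev_rev]; omega
  · intro q hq
    simp only [mem_inc] at hq
    ext i
    have := hq.1 i
    simp only [Fin.rev_rev]; omega
  · intro q hq
    simp only [mem_filter, mem_inc] at hq
    obtain ⟨⟨h1, h2⟩, h3⟩ := hq
    have e1 : coeff (Finsupp.equivFunOnFinite.symm q) (FP t N) = coeff (cst N r) (FP t N * ∏ i, X i ^ (r - q i)) := by
      have hm : (∏ i, (X i : MvPolynomial (Fin N) K) ^ (r - q i)) = monomial (Finsupp.equivFunOnFinite.symm fun i => r - q i) 1 := by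
        rw [monomial_eq, Finsupp.prod_fintype _ _ (by simp)]; simp
      have hs : cst N r = Finsupp.equivFunOnFinite.symm q + (Finsupp.equivFunOnFinite.symm fun i => r - q i) := by
        ext i
        have := h1 i
        simp; omega
      rw [hm, hs, coeff_mul_monomial, mul_one]
    rw [e1, ← coeff_rename_perm Fin.revPerm, map_mul]
    have e2 : rename Fin.revPerm (FP t N) = ((Equiv.Perm.sign (Fin.revPerm : Equiv.Perm (Fin N)) : ℤ) : MvPolynomial (Fin N) K) * (TP t N * DelP K N * pairProd (fun i j => 1 + X j + X i * X j)) := by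
      unfold FP
      rw [map_mul, map_mul]
      have a1 := TP_symm t (Fin.revPerm : Equiv.Perm (Fin N))
      have a2 := DelP_anti (K := K) (Fin.revPerm : Equiv.Perm (Fin N))
      unfold TP at a1 ⊢
      unfold DelP at a2 ⊢
      rw [a1, a2, rename_pairProd]
      have a3 : pairProd (fun i j : Fin N => rename Fin.revPerm (1 + X i + X i * X j : MvPolynomial (Fin N) K)) = pairProd (fun i j => 1 + X j + X i * X j) := by
        simp only [map_add, map_mul, map_one, rename_X, Fin.revPerm_apply]
        unfold pairProd
        rw [prod_comm]
        rw [← Equiv.prod_comp Fin.revPerm]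
        refine prod_congr rfl fun i _ => ?_
        rw [← Equiv.prod_comp Fin.revPerm]
        refine prod_congr rfl fun j _ => ?_
        simp only [Fin.revPerm_apply, Fin.rev_rev, Fin.rev_lt_rev]
        split_ifs
        · ring
        · rfl
      rw [a3]; ring
    have e3 : rename Fin.revPerm (∏ i, (X i : MvPolynomial (Fin N) K) ^ (r - q i)) = ∏ i : Fin N, X i ^ (r - q i.rev) := by
      rw [map_prod, ← Equiv.prod_comp Fin.revPerm]
      refine prod_congr rfl fun i _ => ?_
      simp
    rw [e2, e3]
    have hc : (((Equiv.Perm.sign (Fin.revPerm : Equiv.Perm (Fin N)) : ℤ)) : MvPolynomial (Fin N) K) = C ((Equiv.Perm.sign (Fin.revPerm : Equiv.Perm (Fin N)) : ℤ) : K) := by simp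
    rw [hc, mul_assoc, coeff_C_mul, mul_assoc]
end ASPaux

namespace ASPaux

lemma intChoose_symm (j : ℕ) (b : ℤ) : intChoose j b = intChoose j (j - b) := by
  unfold intChoose
  by_cases h1 : 0 ≤ b
  · by_cases h2 : b ≤ j
    · rw [if_pos h1, if_pos (by omega), ← Nat.choose_symm (n := j) (k := b.toNat) (by omega)]
      congr 2
      omega
    · rw [if_pos h1, if_neg (by omega), Nat.choose_eq_zero_of_lt (by omega)]
      rfl
  · rw [if_neg h1, if_pos (by omega), Nat.choose_eq_zero_of_lt (by omega)]
    rfl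

lemma cx {K : Type*} [CommRing K] (a j m : ℕ) :
    (Polynomial.X ^ a * (1 + Polynomial.X) ^ j : Polynomial K).coeff m = ((intChoose j ((m:ℤ) - a) : ℤ) : K) := by
  rw [Polynomial.coeff_X_pow_mul', Polynomial.coeff_one_add_X_pow]
  unfold intChoose
  by_cases h : a ≤ m
  · rw [if_pos h, if_pos (by omega)]
    rw [show ((m:ℤ) - a).toNat = m - a by omega]
    simp
  · rw [if_neg h, if_neg (by omega)]
    simp

lemma gent_coeff {K : Type*} [CommRing K] (t : K) (N l r k j : ℕ) (hk : k ≤ r) (hlr : l ≤ r) (hj : j < N) (n e : ℕ) (hn : n = N + 1)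
    (he : e = r + 1 - k) :
    (gent t N (r - l + 1) k j).coeff r =
    ((intChoose j ((e : ℤ) - (j + 1))
        - intChoose j ((r : ℤ) - (e : ℤ) - (l : ℤ) + 2 * (n : ℤ) - 1 - (j + 1)) : ℤ) : K) * t
    + ((intChoose j ((e : ℤ) - 1 - (j + 1))
        - intChoose j ((r : ℤ) - (e : ℤ) - (l : ℤ) + 2 * (n : ℤ) - (j + 1)) : ℤ) : K) := by
  have hg : gent t N (r - l + 1) k j =
      Polynomial.C t * (Polynomial.X ^ (k + j) * (1 + Polynomial.X) ^ j)
      + Polynomial.X ^ (k + j + 1) * (1 + Polynomial.X) ^ j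
      - Polynomial.C t * (Polynomial.X ^ (k + (r - l + 1) + 2 * (N - 1 - j)) * (1 + Polynomial.X) ^ j)
      - Polynomial.X ^ (k + (r - l + 1) + 2 * (N - 1 - j) + 1) * (1 + Polynomial.X) ^ j := by
    unfold gent
    rw [mul_pow, ← pow_mul]
    ring
  rw [hg, Polynomial.coeff_sub, Polynomial.coeff_sub, Polynomial.coeff_add, Polynomial.coeff_C_mul,
    Polynomial.coeff_C_mul, cx, cx, cx, cx]
  rw [intChoose_symm j ((r:ℤ) - ((k + (r - l + 1) + 2 * (N - 1 - j) : ℕ) : ℤ)),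
    intChoose_symm j ((r:ℤ) - ((k + (r - l + 1) + 2 * (N - 1 - j) + 1 : ℕ) : ℤ))]
  rw [show (r:ℤ) - ((k + j : ℕ) : ℤ) = (e : ℤ) - (j + 1) by omega,
    show (r:ℤ) - ((k + j + 1 : ℕ) : ℤ) = (e : ℤ) - 1 - (j + 1) by omega,
    show (j:ℤ) - ((r:ℤ) - ((k + (r - l + 1) + 2 * (N - 1 - j) : ℕ) : ℤ)) = (r : ℤ) - (e : ℤ) - (l : ℤ) + 2 * (n : ℤ) - 1 - (j + 1) by omega,
    show (j:ℤ) - ((r:ℤ) - ((k + (r - l + 1) + 2 * (N - 1 - j) + 1 : ℕ) : ℤ)) = (r : ℤ) - (e : ℤ) - (l : ℤ) + 2 * (n : ℤ) - (j + 1) by omega]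
  push_cast
  ring

lemma sum_astDet (N l r : ℕ) (hlr : l ≤ r) :
    ∑ e ∈ incTuples N r, astDet (N+1) l r e =
    ((Equiv.Perm.sign (Fin.revPerm : Equiv.Perm (Fin N)) : ℤ) : Polynomial ℤ) *
    ∑ k ∈ inc N (r+1), Matrix.det (fun i j : Fin N => (gent (Polynomial.X : Polynomial ℤ) N (r - l + 1) (k i) j).coeff r) := by
  rw [mul_sum]
  symm
  refine sum_nbij' (fun q i => r + 1 - q i.rev) (fun k i => r + 1 - k i.rev) ?_ ?_ ?_ ?_ ?_
  · intro q hq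
    simp only [mem_filter, mem_inc, incTuples, Fintype.mem_piFinset, mem_Icc] at hq ⊢
    obtain ⟨h1, h2⟩ := hq
    refine ⟨fun i => ?_, fun i j hij => ?_⟩
    · have := h1 i.rev; omega
    · have := h2 j.rev i.rev (Fin.rev_lt_rev.mpr hij); have := h1 i.rev; omega
  · intro q hq
    simp only [mem_filter, mem_inc, incTuples, Fintype.mem_piFinset, mem_Icc] at hq ⊢
    obtain ⟨h1, h2⟩ := hq
    refine ⟨fun i => ?_, fun i j hij => ?_⟩
    · have := h1 i.rev; omega
    · have := h2 j.rev i.rev (Fin.rev_lt_rev.mpr hij); have := h1 i.rev; omega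
  · intro q hq
    simp only [mem_inc] at hq
    ext i
    have := hq.1 i
    simp only [Fin.rev_rev]; omega
  · intro q hq
    simp only [mem_filter, incTuples, Fintype.mem_piFinset, mem_Icc] at hq
    ext i
    have := hq.1 i
    simp only [Fin.rev_rev]; omega
  · intro q hq
    simp only [mem_inc] at hq
    refine (Matrix.det_permute (Fin.revPerm : Equiv.Perm (Fin N)) _).symm.trans ?_
    unfold astDet
    refine congrArg Matrix.det (Matrix.ext fun i j => ?_)
    have h := gent_coeff (Polynomial.X : Polynomial ℤ) N l r (q (Fin.rev i)) j (by have := hq.1 (Fin.rev i); omega) hlr j.2 (N+1)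
      (r + 1 - q (Fin.rev i)) rfl rfl
    refine h.trans ?_
    rw [eq_intCast Polynomial.C, eq_intCast Polynomial.C]

def cl (N q : ℕ) : ℕ := if q < N then q + 1 else q + 2

lemma cl_strictMono (N : ℕ) : StrictMono (cl N) := by
  intro a b h
  unfold cl
  split_ifs <;> omega

lemma label_cl (N q : ℕ) : AST.label (N+1) (cl N q) = q := by
  unfold AST.label cl
  split_ifs <;> omega

lemma cl_label (N c : ℕ) (h1 : 1 ≤ c) (h2 : c ≠ N + 1) : cl N (AST.label (N+1) c) = c := by
  unfold AST.label cl
  split_ifs <;> omega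

lemma LL_image (N M : ℕ) (f : Fin N → ℕ) (hf : StrictMono f) (hb : ∀ i, 1 ≤ f i ∧ f i < 1 + M) :
    LL (univ.image f) 1 M = List.ofFn f := by
  refine List.Pairwise.eq_of_mem_iff (r := (· < ·)) (LL_sorted _ _ _) ?_ ?_
  · rw [List.pairwise_ofFn]
    exact fun i j h => hf h
  · intro a
    rw [mem_LL, List.mem_ofFn]
    simp only [mem_image, mem_univ, true_and]
    constructor
    · rintro ⟨_, i, h⟩; exact ⟨i, h⟩
    · rintro ⟨i, rfl⟩; exact ⟨hb i, i, rfl⟩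

open Classical in
lemma partIV (N l r : ℕ) (hN : 1 ≤ N) (hr : r < 2 * N) :
    ∑ S ∈ ((Ico 1 (2*(N+1))).erase (N+1)).powerset.filter (fun S => goodS (N+1) l r S ∧ S.card = N+1-1),
      Tl 0 ((LL S 1 (2*(N+1)-1)).map (GG (Polynomial.X : Polynomial ℤ) (N+1) (N+1-1))) =
    ∑ q ∈ (inc N (r+1)).filter (fun q => ∀ i, l ≤ q i),
      MvPolynomial.coeff (Finsupp.equivFunOnFinite.symm q) (FP (Polynomial.X : Polynomial ℤ) N) := by
  symm
  have hsm : ∀ q ∈ (inc N (r+1)).filter (fun q => ∀ i, l ≤ q i), StrictMono q ∧ ∀ i, q i < 2 * N := by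
    intro q hq
    rw [mem_filter, mem_inc] at hq
    exact ⟨fun i j h => hq.1.2 i j h, fun i => by have := hq.1.1 i; omega⟩
  have hcb : ∀ a, a < 2 * N → 1 ≤ cl N a ∧ cl N a < 2*(N+1) ∧ cl N a ≠ N+1 := by
    intro a ha
    unfold cl
    split_ifs <;> omega
  refine sum_nbij (fun q => univ.image fun i => cl N (q i)) ?_ ?_ ?_ ?_
  · intro q hq
    obtain ⟨h1, h2⟩ := hsm q hq
    rw [mem_filter, mem_inc] at hq
    rw [mem_filter, mem_powerset]
    refine ⟨?_, ?_, ?_⟩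
    · intro x hx
      obtain ⟨i, -, rfl⟩ := mem_image.mp hx
      have := hcb _ (h2 i)
      rw [mem_erase, mem_Ico]
      exact ⟨this.2.2, this.1, this.2.1⟩
    · intro x hx _
      obtain ⟨i, -, rfl⟩ := mem_image.mp hx
      rw [label_cl]
      have := hq.1.1 i
      exact ⟨hq.2 i, by omega⟩
    · exact (card_image_of_injective univ ((cl_strictMono N).comp h1).injective).trans (by simp)
  · intro q hq q' hq' h
    have h1 := (hsm q hq).1
    have h2 := (hsm q' hq').1
    have h' : (univ.image fun i => cl N (q i)) = univ.image fun i => cl N (q' i) := h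
    have h3 : Set.range (cl N ∘ q) = Set.range (cl N ∘ q') := by
      have := congrArg (fun s : Finset ℕ => (s : Set ℕ)) h'
      simpa [Function.comp_def] using this
    have h4 := (StrictMono.range_inj ((cl_strictMono N).comp h1) ((cl_strictMono N).comp h2)).mp h3
    ext i
    exact (cl_strictMono N).injective (congrFun h4 i)
  · intro S hS
    rw [mem_coe, mem_filter, mem_powerset] at hS
    obtain ⟨h1, h2, h3⟩ := hS
    have h3' : S.card = N := by omega
    have hm : ∀ i, S.orderEmbOfFin h3' i ∈ S := fun i => S.orderEmbOfFin_mem h3' i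
    have hcl : ∀ i, cl N (AST.label (N+1) (S.orderEmbOfFin h3' i)) = S.orderEmbOfFin h3' i := by
      intro i
      have := h1 (hm i)
      rw [mem_erase, mem_Ico] at this
      exact cl_label N _ this.2.1 this.1
    refine ⟨fun i => AST.label (N+1) (S.orderEmbOfFin h3' i), ?_, ?_⟩
    · rw [mem_coe, mem_filter, mem_inc]
      have hg : ∀ i, _ := fun i => h2 _ (hm i) (by have := h1 (hm i); rw [mem_erase] at this; exact this.1)
      refine ⟨⟨fun i => ?_, fun i j hij => ?_⟩, fun i => (hg i).1⟩
      · have := (hg i).2; omega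
      · rw [← (cl_strictMono N).lt_iff_lt, hcl, hcl]
        exact (S.orderEmbOfFin h3').strictMono hij
    · simp only [hcl]
      ext x
      have := S.range_orderEmbOfFin h3'
      have hx : x ∈ S ↔ x ∈ Set.range (S.orderEmbOfFin h3') := by rw [this, mem_coe]
      rw [hx, mem_image]
      simp only [mem_univ, true_and, Set.mem_range]
  · intro q hq
    obtain ⟨h1, h2⟩ := hsm q hq
    have hL : LL (univ.image fun i => cl N (q i)) 1 (2*(N+1)-1) = List.ofFn fun i => cl N (q i) :=
      LL_image N _ _ ((cl_strictMono N).comp h1) (fun i => by have := hcb _ (h2 i); omega)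
    have hp := partII (Polynomial.X : Polynomial ℤ) N hN q h1 h2
    rw [← hp]
    symm
    refine Tl_eq 0 _ ?_ _ ?_
    · rw [hL]; simp
    · intro i
      rw [hL, List.map_ofFn, List.getD_eq_getElem _ _ (by simp)]
      simp [cl]

theorem main (n l r p : ℕ) (hp1 : 1 ≤ p) (hl : l + 2 ≤ n) (hr1 : n < r + 2) (hr2 : r + 3 ≤ 2 * n) :
    (Nat.card {P : AST n // P.IsASP l r ∧ P.rho = p} : ℤ)
      = (∑ e ∈ incTuples (n - 1) r, astDet n l r e).coeff (p - 1) := by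
  obtain ⟨N, rfl⟩ : ∃ N, n = N + 1 := ⟨n - 1, by omega⟩
  rw [card_eq_Zf (N+1) l r p (by omega) hp1, sum_Zf_eq (N+1) l r (by omega), partIV N l r (by omega) (by omega),
    partIIIb _ N l r (by omega)]
  exact congrArg (fun f : Polynomial ℤ => f.coeff (p-1)) (sum_astDet N l r (by omega)).symm
end ASPaux

/-- For `1 ≤ p ≤ n` and `0 ≤ l ≤ n-2 < r ≤ 2n-3`, the number of
`(n,l,r)`-ASPs `P` with `ρ(P) = p` is the constant term w.r.t. `t` of
`t^{1-p} · Σ_{1 ≤ e_1 < … < e_{n-1} ≤ r+1} astDet`, i.e. the coefficient of `t^{p-1}` in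
the polynomial `Σ_e astDet n l r e`. -/
theorem card_ASP_eq_coeff_detSum (n l r p : ℕ) (hp1 : 1 ≤ p) (hpn : p ≤ n)
    (hl : l + 2 ≤ n) (hr1 : n < r + 2) (hr2 : r + 3 ≤ 2 * n) :
    (Nat.card {P : AST n // P.IsASP l r ∧ P.rho = p} : ℤ)
      = (∑ e ∈ incTuples (n - 1) r, astDet n l r e).coeff (p - 1) :=
  ASPaux.main n l r p hp1 hl hr1 hr2
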